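/- Fix t ∈ (0,1/4) and set k = 4t. For all integers l,p ≥ 1 and every α ∈ (π/2)ℤ with α > 0, the sum over walks defining W^{(α,(0,α))}_{l,p}(t) converges, and W^{(α,(0,α))}_{l,p}(t) = (2π/K(k)) · Σ_{m=1}^∞ a_{l,m}·a_{p,m} / ((q_k^{−mα/π} − q_k^{mα/π})·(q_k^{−m} − q_k^{m})), the series on the right converging absolutely. -/

import Mathlib

open Complex Real Set

noncomputable section

/-- A lattice point `(x,y)` viewed as the complex number `x + iy`. -/
def ptC (p : ℤ × ℤ) : ℂ := (p.1 : ℂ) + (p.2 : ℂ) * Complex.I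

/-- A diagonal step on `ℤ²`. -/
def IsDiagStep (a b : ℤ × ℤ) : Prop :=
  b - a = (1, 1) ∨ b - a = (1, -1) ∨ b - a = (-1, -1) ∨ b - a = (-1, 1)

/-- A rectilinear step on `ℤ²`. -/
def IsRectStep (a b : ℤ × ℤ) : Prop :=
  b - a = (1, 0) ∨ b - a = (-1, 0) ∨ b - a = (0, 1) ∨ b - a = (0, -1)

/-- `w` encodes a simple diagonal walk `(w₀, …, w_n)` as a list of length `n+1`. -/
def IsWalkList (w : List (ℤ × ℤ)) : Prop := w ≠ [] ∧ w.Chain' IsDiagStep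

/-- Winding angle of the walk `w` around the origin up to time `i`. -/
def windTo (w : List (ℤ × ℤ)) (i : ℕ) : ℝ :=
  ∑ j ∈ Finset.range i, (ptC (w.getD (j + 1) 0) / ptC (w.getD j 0)).arg

/-- The full winding angle of the walk `w` around the origin. -/
def wind (w : List (ℤ × ℤ)) : ℝ := windTo w (w.length - 1)

/-- The condition on walks counted by `W^{(α,I)}_{l,p}`: a simple diagonal walk on
`ℤ² ∖ {0}` from `(p,0)` to a point on one of the axes at distance `l` from the origin,
with full winding angle `α` and intermediate winding angles in `I`. -/
def WCond (l p : ℕ) (α : ℝ) (I : Set ℝ) (w : List (ℤ × ℤ)) : Prop :=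
  IsWalkList w ∧ (∀ x ∈ w, x ≠ (0, 0)) ∧ w.head? = some ((p : ℤ), 0) ∧
    (w.getLast? = some ((l : ℤ), 0) ∨ w.getLast? = some (-(l : ℤ), 0) ∨
      w.getLast? = some (0, (l : ℤ)) ∨ w.getLast? = some (0, -(l : ℤ))) ∧
    wind w = α ∧ (∀ i, 1 ≤ i → i ≤ w.length - 2 → windTo w i ∈ I)

/-- The generating function `W^{(α,I)}_{l,p}(t)`. -/
def Wgen (t : ℝ) (l p : ℕ) (α : ℝ) (I : Set ℝ) : ℝ :=
  ∑' w : {w : List (ℤ × ℤ) // WCond l p α I w}, t ^ (w.val.length - 1)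

/-- The complete elliptic integral of the first kind `K(k)`. -/
def Kell (k : ℝ) : ℝ := ∫ y in (0:ℝ)..1, 1 / Real.sqrt ((1 - y ^ 2) * (1 - k ^ 2 * y ^ 2))

/-- The complete elliptic integral of the second kind `E(k)`. -/
def Eell (k : ℝ) : ℝ := ∫ y in (0:ℝ)..1, Real.sqrt (1 - k ^ 2 * y ^ 2) / Real.sqrt (1 - y ^ 2)

/-- The complementary modulus `k' = √(1-k²)`. -/
def kComp (k : ℝ) : ℝ := Real.sqrt (1 - k ^ 2)

/-- The elliptic nome `q_k = exp(-π K(k')/K(k))`. -/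
def qNome (k : ℝ) : ℝ := Real.exp (-π * Kell (kComp k) / Kell k)

/-- The descending Landen transformation `k₁ = (1-k')/(1+k')`. -/
def kLanden (k : ℝ) : ℝ := (1 - kComp k) / (1 + kComp k)

/-- `T_k = K(k')/(4K(k))`. -/
def Tell (k : ℝ) : ℝ := Kell (kComp k) / (4 * Kell k)

/-- The plane minus the two real slits `{z ∈ ℝ : z² ≥ κ}`. -/
def slitDom (κ : ℝ) : Set ℂ := {z : ℂ | ¬(z.im = 0 ∧ κ ≤ z.re ^ 2)}

/-- `v` is the analytic function `v_κ` on `ℂ ∖ {z ∈ ℝ : z² ≥ κ}` with `v 0 = 0` and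
`v'(z) = 1/(4K(κ)√((κ-z²)(1-κz²)))`, the branch of the square root being positive on
`(-√κ, √κ)` (by analytic continuation this determines `v` uniquely). -/
structure IsVmap (κ : ℝ) (v : ℂ → ℂ) : Prop where
  map_zero : v 0 = 0
  analytic : AnalyticOnNhd ℂ v (slitDom κ)
  deriv_real : ∀ x : ℝ, x ^ 2 < κ →
    HasDerivAt v ((1 / (4 * Kell κ * Real.sqrt ((κ - x ^ 2) * (1 - κ * x ^ 2))) : ℝ) : ℂ)
      (x : ℂ)

/-- The function `f_m(z) = cos(2πm(v(z) + 1/4)) - cos(πm/2)` built from `v = v_{k₁}`. -/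
def fmFun (v : ℂ → ℂ) (m : ℕ) (z : ℂ) : ℂ :=
  Complex.cos (2 * (π : ℂ) * m * (v z + 1 / 4)) - Complex.cos ((π : ℂ) * m / 2)

/-- `a n m` is the (real) Taylor coefficient `[zⁿ] f_m(z)` at `0`. -/
def IsCoeff (κ : ℝ) (v : ℂ → ℂ) (a : ℕ → ℕ → ℝ) : Prop :=
  ∀ m : ℕ, 1 ≤ m → ∀ z : ℂ, z ∈ slitDom κ → ‖z‖ < 1 →
    HasSum (fun n : ℕ => (a n m : ℂ) * z ^ n) (fmFun v m z)

/-- An excursion: a nonempty simple diagonal walk from the origin to the origin with no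
intermediate visits to the origin. -/
def IsExcursion (w : List (ℤ × ℤ)) : Prop :=
  2 ≤ w.length ∧ w.Chain' IsDiagStep ∧ w.head? = some (0, 0) ∧ w.getLast? = some (0, 0) ∧
    ∀ i, 1 ≤ i → i ≤ w.length - 2 → w.getD i 0 ≠ (0, 0)

/-- The winding angle sequence of an excursion: `θ₀ = θ₁ = 0`, increments of the first and
last step do not contribute, and `θ_n = θ_{n-1}`. -/
def windExcTo (w : List (ℤ × ℤ)) (i : ℕ) : ℝ :=
  ∑ j ∈ Finset.Icc 2 (min i (w.length - 2)), (ptC (w.getD j 0) / ptC (w.getD (j - 1) 0)).arg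

/-- The full winding angle of an excursion. -/
def windExc (w : List (ℤ × ℤ)) : ℝ := windExcTo w (w.length - 1)

/-- `F^{(α)}(t)`: generating function of excursions with winding angle `α`. -/
def Fgen (t α : ℝ) : ℝ :=
  ∑' w : {w : List (ℤ × ℤ) // IsExcursion w ∧ windExc w = α}, t ^ (w.val.length - 1)

/-- `F(t,b) = Σ_w t^{|w|} e^{i b θ^w}`, the characteristic function of excursions. -/
def Fchar (t b : ℝ) : ℂ :=
  ∑' w : {w : List (ℤ × ℤ) // IsExcursion w},
    (t : ℂ) ^ (w.val.length - 1) * Complex.exp (Complex.I * b * windExc w.val)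

/-- `ψ_k(z) = (1 - √(1-kz²))/(√k z)` (principal square root), `ψ_k(0) = 0`. -/
def psiK (k : ℝ) (z : ℂ) : ℂ :=
  if z = 0 then 0 else (1 - (1 - (k : ℂ) * z ^ 2) ^ ((1 : ℂ) / 2)) / ((Real.sqrt k : ℂ) * z)

/-- Rotation of the lattice by a quarter turn. -/
def rot (P : ℤ × ℤ) : ℤ × ℤ := (-P.2, P.1)

/-- The four diagonal steps. -/
def diagSteps : Finset (ℤ × ℤ) := {(1, 1), (1, -1), (-1, -1), (-1, 1)}

/-- The winding angle increment of the step from `P` to `Q`. -/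
def stepAng (P Q : ℤ × ℤ) : ℝ := (ptC Q / ptC P).arg

/-- `P` lies on one of the coordinate axes at distance `l` from the origin. -/
def AxisDist (l : ℕ) (P : ℤ × ℤ) : Prop :=
  P = ((l : ℤ), 0) ∨ P = (-(l : ℤ), 0) ∨ P = (0, (l : ℤ)) ∨ P = (0, -(l : ℤ))

/-- The walk `w` starts at `P` with initial angle `θ` and leaves the wedge `(0, α)` for the first
time at its last point, which has angle `α` and distance `l` from the origin. -/
def ExitCond (l : ℕ) (α : ℝ) (P : ℤ × ℤ) (θ : ℝ) (w : List (ℤ × ℤ)) : Prop :=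
  IsWalkList w ∧ (∀ x ∈ w, x ≠ (0, 0)) ∧ w.head? = some P ∧
    (w.getLast? = some ((l : ℤ), 0) ∨ w.getLast? = some (-(l : ℤ), 0) ∨
      w.getLast? = some (0, (l : ℤ)) ∨ w.getLast? = some (0, -(l : ℤ))) ∧
    θ + wind w = α ∧ ∀ i, 1 ≤ i → i ≤ w.length - 2 → θ + windTo w i ∈ Ioo 0 α

open Classical in
/-- The finite set of walks with `n` steps satisfying `ExitCond`. -/
def exitWalks (l : ℕ) (α : ℝ) : ℕ → ℤ × ℤ → ℝ → Finset (List (ℤ × ℤ))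
  | 0, P, θ => if P ≠ 0 ∧ AxisDist l P ∧ θ = α then {[P]} else ∅
  | n + 1, P, θ => if P = 0 then ∅ else diagSteps.biUnion fun δ =>
      if n = 0 ∨ θ + stepAng P (P + δ) ∈ Ioo 0 α then
        (exitWalks l α n (P + δ) (θ + stepAng P (P + δ))).image (List.cons P) else ∅

lemma windTo_cons_cons (a b : ℤ × ℤ) (w : List (ℤ × ℤ)) (i : ℕ) :
    windTo (a :: b :: w) (i + 1) = stepAng a b + windTo (b :: w) i := by
  simp only [windTo, Finset.sum_range_succ', stepAng, List.getD_cons_succ, List.getD_cons_zero]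
  ring

lemma wind_cons_cons (a b : ℤ × ℤ) (w : List (ℤ × ℤ)) :
    wind (a :: b :: w) = stepAng a b + wind (b :: w) := by
  simp only [wind, List.length_cons, Nat.add_sub_cancel, windTo_cons_cons]

lemma isDiagStep_iff (a b : ℤ × ℤ) : IsDiagStep a b ↔ ∃ δ ∈ diagSteps, b = a + δ := by
  simp only [IsDiagStep, diagSteps, Finset.mem_insert, Finset.mem_singleton, sub_eq_iff_eq_add',
    exists_eq_or_imp, exists_eq_left]

lemma isWalkList_iff (w : List (ℤ × ℤ)) :
    IsWalkList w ↔ w ≠ [] ∧ w.IsChain IsDiagStep := Iff.rfl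

lemma exitCond_singleton (l : ℕ) (α : ℝ) (P a : ℤ × ℤ) (θ : ℝ) :
    ExitCond l α P θ [a] ↔ a = P ∧ a ≠ 0 ∧ AxisDist l a ∧ θ = α := by
  simp only [ExitCond, isWalkList_iff, AxisDist, wind, windTo]
  simp
  constructor
  · rintro ⟨h1, h2, h3, h4⟩
    exact ⟨h2, h1, h3, h4.1⟩
  · rintro ⟨h1, h2, h3, h4⟩
    exact ⟨h2, h1, h3, h4, fun i hi hi' => by omega⟩

lemma exitCond_cons_cons (l : ℕ) (α : ℝ) (P a b : ℤ × ℤ) (θ : ℝ) (w : List (ℤ × ℤ)) :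
    ExitCond l α P θ (a :: b :: w) ↔ a = P ∧ a ≠ 0 ∧ IsDiagStep a b ∧
      ExitCond l α b (θ + stepAng a b) (b :: w) ∧
      (w = [] ∨ θ + stepAng a b ∈ Ioo 0 α) := by
  have hw0 : ∀ u : List (ℤ × ℤ), windTo u 0 = 0 := fun u => by simp [windTo]
  simp only [ExitCond, isWalkList_iff, wind_cons_cons, List.isChain_cons_cons, List.head?_cons,
    Option.some.injEq, List.getLast?_cons_cons, ne_eq, reduceCtorEq, not_false_eq_true, true_and,
    List.mem_cons, forall_eq_or_imp, add_assoc, List.length_cons]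
  constructor
  · rintro ⟨⟨h1, h2⟩, ⟨h3, h4⟩, h5, h6, h7, h8⟩
    refine ⟨h5, h3, h1, ⟨h2, h4, h6, h7, fun i hi hi' => ?_⟩, ?_⟩
    · have := h8 (i + 1) (by omega) (by omega)
      rwa [windTo_cons_cons] at this
    · rcases w with _ | ⟨c, w⟩
      · simp
      · right
        have := h8 1 le_rfl (by simp)
        rwa [show (1 : ℕ) = 0 + 1 from rfl, windTo_cons_cons, hw0, add_zero] at this
  · rintro ⟨h5, h3, h1, ⟨h2, h4, h6, h7, h8⟩, h9⟩
    refine ⟨⟨h1, h2⟩, ⟨h3, h4⟩, h5, h6, h7, fun i hi hi' => ?_⟩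
    obtain ⟨i, rfl⟩ : ∃ i', i = i' + 1 := ⟨i - 1, by omega⟩
    rw [windTo_cons_cons]
    rcases Nat.eq_zero_or_pos i with rfl | hi0
    · rcases h9 with rfl | h9
      · simp at hi'
      · rwa [hw0, add_zero]
    · exact h8 i hi0 (by omega)

lemma mem_exitWalks (l : ℕ) (α : ℝ) (n : ℕ) : ∀ (P : ℤ × ℤ) (θ : ℝ) (w : List (ℤ × ℤ)),
    w ∈ exitWalks l α n P θ ↔ ExitCond l α P θ w ∧ w.length = n + 1 := by
  induction n with
  | zero =>
    intro P θ w
    rcases w with _ | ⟨a, _ | ⟨b, w⟩⟩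
    · simp only [exitWalks]
      split_ifs <;> simp
    · rw [exitCond_singleton]
      simp only [exitWalks]
      split_ifs with h
      · rw [Finset.mem_singleton]
        constructor
        · intro h'
          obtain rfl : a = P := by simpa using h'
          exact ⟨⟨rfl, h⟩, rfl⟩
        · exact fun h' => by rw [h'.1.1]
      · simp only [Finset.notMem_empty, false_iff]
        rintro ⟨⟨rfl, h'⟩, -⟩
        exact h h'
    · simp only [exitWalks]
      split_ifs <;> simp
  | succ n ih =>
    intro P θ w
    by_cases hP : P = 0
    · simp only [exitWalks, hP, if_true, Finset.notMem_empty, false_iff]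
      rintro ⟨h, -⟩
      rcases w with _ | ⟨a, w⟩
      · exact h.1.1 rfl
      · have h2 := h.2.1 a (by simp)
        have h3 := h.2.2.1
        simp only [List.head?_cons, Option.some.injEq] at h3
        exact h2 h3
    · simp only [exitWalks, hP, if_false, Finset.mem_biUnion]
      rcases w with _ | ⟨a, _ | ⟨b, w⟩⟩
      · simp only [List.length_nil]
        constructor
        · rintro ⟨δ, hδ, h⟩
          split_ifs at h <;> simp at h
        · rintro ⟨-, h⟩; omega
      · simp only [List.length_singleton]
        constructor
        · rintro ⟨δ, hδ, h⟩
          split_ifs at h with h'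
          · simp only [Finset.mem_image, List.cons.injEq] at h
            obtain ⟨u, hu, rfl, rfl⟩ := h
            exact absurd ((ih _ _ _).1 hu).2 (by simp)
          · simp at h
        · rintro ⟨-, h⟩; omega
      · rw [exitCond_cons_cons, isDiagStep_iff]
        constructor
        · rintro ⟨δ, hδ, h⟩
          split_ifs at h with h'
          · simp only [Finset.mem_image, List.cons.injEq] at h
            obtain ⟨u, hu, rfl, rfl⟩ := h
            obtain ⟨h1, h2⟩ := (ih _ _ _).1 hu
            have hb : b = P + δ := by simpa using h1.2.2.1
            subst hb
            refine ⟨⟨rfl, hP, ⟨δ, hδ, rfl⟩, h1, ?_⟩, by simp at h2 ⊢; omega⟩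
            rcases h' with rfl | h'
            · left; simpa using h2
            · exact Or.inr h'
          · simp at h
        · rintro ⟨⟨rfl, -, ⟨δ, hδ, rfl⟩, h1, h2⟩, h3⟩
          refine ⟨δ, hδ, ?_⟩
          rw [if_pos]
          · rw [Finset.mem_image]
            exact ⟨_, (ih _ _ _).2 ⟨h1, by simpa using h3⟩, rfl⟩
          · rcases h2 with rfl | h2
            · left; simpa using h3.symm
            · exact Or.inr h2

open Classical in
lemma card_exitWalks_succ (l : ℕ) (α : ℝ) (n : ℕ) (P : ℤ × ℤ) (hP : P ≠ 0) (θ : ℝ) :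
    (exitWalks l α (n + 1) P θ).card = ∑ δ ∈ diagSteps,
      if n = 0 ∨ θ + stepAng P (P + δ) ∈ Ioo 0 α then
        (exitWalks l α n (P + δ) (θ + stepAng P (P + δ))).card else 0 := by
  rw [exitWalks, if_neg hP, Finset.card_biUnion]
  · refine Finset.sum_congr rfl fun δ _ => ?_
    split_ifs
    · exact Finset.card_image_of_injective _ (List.cons_injective)
    · rfl
  · intro δ _ δ' _ hne
    rw [Function.onFun, Finset.disjoint_left]
    intro w hw hw'
    split_ifs at hw hw'
    · simp only [Finset.mem_image] at hw hw'
      obtain ⟨u, hu, rfl⟩ := hw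
      obtain ⟨u', hu', h⟩ := hw'
      obtain rfl : u' = u := by simpa using h
      have h1 := ((mem_exitWalks _ _ _ _ _ _).1 hu).1.2.2.1
      have h2 := ((mem_exitWalks _ _ _ _ _ _).1 hu').1.2.2.1
      rw [h1] at h2
      exact hne (by simpa using h2)
    all_goals simp at hw hw'

lemma exitWalks_zero_left (l : ℕ) (α : ℝ) (n : ℕ) (θ : ℝ) : exitWalks l α n 0 θ = ∅ := by
  cases n <;> simp [exitWalks]

/-- The generating function of exit walks with between `1` and `N` steps. -/
def exitSum (t : ℝ) (l : ℕ) (α : ℝ) (N : ℕ) (P : ℤ × ℤ) (θ : ℝ) : ℝ :=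
  ∑ n ∈ Finset.range N, t ^ (n + 1) * (exitWalks l α (n + 1) P θ).card

open Classical in
/-- Contribution of a walk that has just arrived at `P` with angle `θ`. -/
def arrival (t : ℝ) (l : ℕ) (α : ℝ) (N : ℕ) (P : ℤ × ℤ) (θ : ℝ) : ℝ :=
  (exitWalks l α 0 P θ).card + if θ ∈ Ioo 0 α then exitSum t l α N P θ else 0

lemma exitSum_succ (t : ℝ) (l : ℕ) (α : ℝ) (N : ℕ) (P : ℤ × ℤ) (hP : P ≠ 0) (θ : ℝ) :
    exitSum t l α (N + 1) P θ =
      t * ∑ δ ∈ diagSteps, arrival t l α N (P + δ) (θ + stepAng P (P + δ)) := by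
  classical
  rw [exitSum, Finset.sum_range_succ']
  simp only [arrival, Finset.sum_add_distrib, mul_add]
  rw [add_comm]
  congr 1
  · rw [card_exitWalks_succ l α 0 P hP]
    simp
  · rw [Finset.mul_sum]
    simp_rw [card_exitWalks_succ l α _ P hP, Nat.cast_sum, Finset.mul_sum]
    rw [Finset.sum_comm]
    refine Finset.sum_congr rfl fun δ _ => ?_
    simp only [Nat.add_eq_zero_iff, one_ne_zero, and_false, false_or]
    split_ifs
    · rw [exitSum, Finset.mul_sum]
      exact Finset.sum_congr rfl fun n _ => by ring
    · simp

lemma wCond_iff (l p : ℕ) (α : ℝ) (w : List (ℤ × ℤ)) :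
    WCond l p α (Ioo 0 α) w ↔ ExitCond l α ((p : ℤ), 0) 0 w := by
  simp only [WCond, ExitCond, zero_add]

/-- The walk sum is the limit of the truncated sums. -/
lemma hasSum_walks_of_tendsto (t : ℝ) (ht : 0 ≤ t) (l p : ℕ) (α : ℝ) (hα : 0 < α) (V : ℝ)
    (hV : Filter.Tendsto (fun N => exitSum t l α N ((p : ℤ), 0) 0) Filter.atTop (nhds V)) :
    HasSum (fun w : {w : List (ℤ × ℤ) // WCond l p α (Ioo 0 α) w} =>
        t ^ (w.val.length - 1)) V := by
  let e : (Σ n : ℕ, {w // w ∈ exitWalks l α (n + 1) ((p : ℤ), 0) 0}) ≃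
      {w : List (ℤ × ℤ) // WCond l p α (Ioo 0 α) w} :=
    { toFun := fun x => ⟨x.2.1, (wCond_iff _ _ _ _).2 ((mem_exitWalks _ _ _ _ _ _).1 x.2.2).1⟩
      invFun := fun w => ⟨w.1.length - 2, ⟨w.1, (mem_exitWalks _ _ _ _ _ _).2
        ⟨(wCond_iff _ _ _ _).1 w.2, by
          rcases w with ⟨_ | ⟨a, _ | ⟨b, w⟩⟩, hw⟩
          · exact absurd rfl hw.1.1
          · rw [wCond_iff, exitCond_singleton] at hw
            exact absurd hw.2.2.2 hα.ne
          · simp⟩⟩⟩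
      left_inv := by
        rintro ⟨n, w, hw⟩
        have h := ((mem_exitWalks _ _ _ _ _ _).1 hw).2
        have h2 : w.length - 2 = n := by omega
        subst h2
        rfl
      right_inv := fun w => rfl }
  rw [← e.hasSum_iff]
  have key : ∀ n : ℕ, HasSum (fun w : {w // w ∈ exitWalks l α (n + 1) ((p : ℤ), 0) 0} =>
      t ^ ((e ⟨n, w⟩).val.length - 1))
      (t ^ (n + 1) * (exitWalks l α (n + 1) ((p : ℤ), 0) 0).card) := by
    intro n
    have := hasSum_fintype (fun w : {w // w ∈ exitWalks l α (n + 1) ((p : ℤ), 0) 0} =>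
      t ^ ((e ⟨n, w⟩).val.length - 1))
    convert this using 1
    rw [Finset.sum_congr rfl (g := fun _ => t ^ (n + 1))]
    · simp [mul_comm]
    · rintro ⟨w, hw⟩ -
      have h := ((mem_exitWalks _ _ _ _ _ _).1 hw).2
      change t ^ (w.length - 1) = _
      rw [h]; rfl
  have hsum : HasSum (fun n : ℕ => t ^ (n + 1) *
      ((exitWalks l α (n + 1) ((p : ℤ), 0) 0).card : ℝ)) V :=
    (hasSum_iff_tendsto_nat_of_nonneg (fun n => by positivity) _).2 hV
  have hs : Summable ((fun w : {w : List (ℤ × ℤ) // WCond l p α (Ioo 0 α) w} =>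
        t ^ (w.val.length - 1)) ∘ e) := by
    rw [summable_sigma_of_nonneg (fun x => by simp only [Function.comp]; positivity)]
    refine ⟨fun n => (key n).summable, ?_⟩
    convert hsum.summable using 2 with n
    exact (key n).tsum_eq
  have := hs.hasSum
  rwa [(hs.hasSum.sigma key).unique hsum] at this

lemma ptC_eq_zero_iff (P : ℤ × ℤ) : ptC P = 0 ↔ P = 0 := by
  rcases P with ⟨a, b⟩
  rw [ptC, Complex.ext_iff]
  simp

lemma ptC_rot_iterate (i : ℕ) (P : ℤ × ℤ) : ptC (rot^[i] P) = Complex.I ^ i * ptC P := by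
  induction i with
  | zero => simp
  | succ i ih =>
    rw [Function.iterate_succ_apply', pow_succ', mul_assoc, ← ih]
    apply Complex.ext <;> simp [ptC, rot]

lemma stepAng_rot_iterate (i : ℕ) (P Q : ℤ × ℤ) :
    stepAng (rot^[i] P) (rot^[i] Q) = stepAng P Q := by
  rw [stepAng, ptC_rot_iterate, ptC_rot_iterate, mul_div_mul_left _ _ (pow_ne_zero _ Complex.I_ne_zero),
    stepAng]

lemma rot_iterate_add (i : ℕ) (P Q : ℤ × ℤ) : rot^[i] (P + Q) = rot^[i] P + rot^[i] Q := by
  induction i with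
  | zero => rfl
  | succ i ih =>
    simp only [Function.iterate_succ_apply', ih]
    ext <;> simp [rot]; ring

lemma rot_iterate_zero (i : ℕ) : rot^[i] (0 : ℤ × ℤ) = 0 := by
  rw [← ptC_eq_zero_iff, ptC_rot_iterate]
  simp [ptC]

lemma rot_iterate_eq_zero_iff (i : ℕ) (P : ℤ × ℤ) : rot^[i] P = 0 ↔ P = 0 := by
  rw [← ptC_eq_zero_iff, ptC_rot_iterate, mul_eq_zero, ptC_eq_zero_iff]
  simp

lemma axisDist_rot (l : ℕ) (P : ℤ × ℤ) : AxisDist l (rot P) ↔ AxisDist l P := by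
  rcases P with ⟨a, b⟩
  simp only [AxisDist, rot, Prod.mk.injEq]
  omega

lemma axisDist_rot_iterate (l i : ℕ) (P : ℤ × ℤ) : AxisDist l (rot^[i] P) ↔ AxisDist l P := by
  induction i with
  | zero => rfl
  | succ i ih => rw [Function.iterate_succ_apply', axisDist_rot, ih]

lemma sum_diagSteps (g : ℤ × ℤ → ℝ) : ∑ δ ∈ diagSteps, g δ =
    g (1, 1) + g (1, -1) + g (-1, -1) + g (-1, 1) := by
  simp only [diagSteps]
  rw [Finset.sum_insert (by decide), Finset.sum_insert (by decide), Finset.sum_insert (by decide),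
    Finset.sum_singleton]
  ring

lemma sum_diagSteps_rot_iterate (i : ℕ) (g : ℤ × ℤ → ℝ) :
    ∑ δ ∈ diagSteps, g (rot^[i] δ) = ∑ δ ∈ diagSteps, g δ := by
  induction i generalizing g with
  | zero => rfl
  | succ i ih =>
    simp only [Function.iterate_succ_apply']
    rw [ih (fun δ => g (rot δ)), sum_diagSteps, sum_diagSteps]
    simp [rot]
    ring

lemma sum_neighbours (i : ℕ) (P : ℤ × ℤ) (g : ℤ × ℤ → ℝ) :
    ∑ δ ∈ diagSteps, g (rot^[i] P + δ) = g (rot^[i] (P + (1, 1))) + g (rot^[i] (P + (1, -1))) +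
      g (rot^[i] (P + (-1, -1))) + g (rot^[i] (P + (-1, 1))) := by
  rw [← sum_diagSteps_rot_iterate i, ← sum_diagSteps (fun δ => g (rot^[i] (P + δ)))]
  simp only [rot_iterate_add]

/-- The polar angle of the point with coordinates `(x, y)` in the `i`-th quadrant of the
universal cover. -/
def coverAng (i : ℕ) (P : ℤ × ℤ) : ℝ := π / 2 * i + (ptC P).arg

lemma arg_ptC_mem (x y : ℕ) : (ptC (x, y)).arg ∈ Icc 0 (π / 2) := by
  constructor
  · rw [Complex.arg_nonneg_iff]; simp [ptC]
  · rw [Complex.arg_le_pi_div_two_iff]; left; simp [ptC]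

lemma arg_div_of_bounds {z w : ℂ} (hz : z ≠ 0) (hw : w ≠ 0) (h : w.arg - z.arg ∈ Ioc (-π) π) :
    (w / z).arg = w.arg - z.arg := by
  have := Complex.arg_div_coe_angle hw hz
  have h2 : (((w / z).arg : ℝ) : Real.Angle).toReal = ((w.arg - z.arg : ℝ) : Real.Angle).toReal := by
    rw [this]; rfl
  rwa [Real.Angle.toReal_coe_eq_self_iff_mem_Ioc.2 h,
    Real.Angle.toReal_coe_eq_self_iff_mem_Ioc.2 (Complex.arg_mem_Ioc _)] at h2

lemma coverAng_add_stepAng (i : ℕ) (P Q : ℤ × ℤ) (hP : P ≠ 0) (hQ : Q ≠ 0)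
    (h1 : (ptC P).arg ∈ Icc 0 (π / 2)) (h2 : (ptC Q).arg ∈ Icc 0 (π / 2)) :
    coverAng i P + stepAng (rot^[i] P) (rot^[i] Q) = coverAng i Q := by
  have := Real.pi_pos
  rw [stepAng_rot_iterate, stepAng, arg_div_of_bounds, coverAng, coverAng]
  · ring
  · rwa [Ne, ptC_eq_zero_iff]
  · rwa [Ne, ptC_eq_zero_iff]
  · exact ⟨by linarith [h1.1, h1.2, h2.1, h2.2], by linarith [h1.1, h1.2, h2.1, h2.2]⟩

lemma arg_ptC_axis (x : ℕ) : (ptC ((x : ℤ), 0)).arg = 0 := by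
  rw [Complex.arg_eq_zero_iff]; simp [ptC]

lemma arg_ptC_axis' (y : ℕ) (hy : 1 ≤ y) : (ptC (0, (y : ℤ))).arg = π / 2 := by
  rw [Complex.arg_eq_pi_div_two_iff]; simp [ptC]; omega

lemma arg_ptC_lt (x y : ℕ) (hx : 1 ≤ x) : (ptC (x, y)).arg < π / 2 := by
  rw [Complex.arg_lt_pi_div_two_iff]; left; simp [ptC]; omega

lemma arg_ptC_pos (x y : ℕ) (hy : 1 ≤ y) : 0 < (ptC (x, y)).arg := by
  refine lt_of_le_of_ne (arg_ptC_mem x y).1 fun h => ?_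
  have := (Complex.arg_eq_zero_iff.1 h.symm).2
  simp [ptC] at this
  omega

lemma arg_ptC_below (x : ℕ) : (ptC ((x : ℤ), -1)).arg = (ptC (1, (x : ℤ))).arg - π / 2 := by
  have hz : ptC ((x : ℤ), -1) = ptC (1, (x : ℤ)) / Complex.I := by
    rw [eq_div_iff Complex.I_ne_zero]
    apply Complex.ext <;> simp [ptC]
  have h := arg_ptC_mem 1 x
  have := Real.pi_pos
  rw [hz, arg_div_of_bounds Complex.I_ne_zero, Complex.arg_I]
  · rw [Ne, ptC_eq_zero_iff]; simp
  · rw [Complex.arg_I]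
    have h1 := h.1
    have h2 := h.2
    push_cast at h1 h2
    constructor <;> linarith

lemma arrival_zero (t : ℝ) (l : ℕ) (α : ℝ) (N : ℕ) (θ : ℝ) : arrival t l α N 0 θ = 0 := by
  simp [arrival, exitSum, exitWalks_zero_left]

open Classical in
lemma card_exitWalks_zero (l : ℕ) (α : ℝ) (P : ℤ × ℤ) (θ : ℝ) :
    (exitWalks l α 0 P θ).card = if P ≠ 0 ∧ AxisDist l P ∧ θ = α then 1 else 0 := by
  rw [exitWalks]
  split_ifs <;> simp

lemma arrival_of_mem (t : ℝ) (l : ℕ) (α : ℝ) (N : ℕ) (P : ℤ × ℤ) (θ : ℝ) (h : θ ∈ Ioo 0 α) :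
    arrival t l α N P θ = exitSum t l α N P θ := by
  rw [arrival, if_pos h, card_exitWalks_zero, if_neg fun h' => h.2.ne h'.2.2]
  simp

lemma arrival_of_nonpos (t : ℝ) (l : ℕ) (α : ℝ) (N : ℕ) (P : ℤ × ℤ) (θ : ℝ) (hα : 0 < α)
    (h : θ ≤ 0) : arrival t l α N P θ = 0 := by
  rw [arrival, if_neg fun h' => absurd h'.1 (not_lt.2 h), card_exitWalks_zero,
    if_neg fun h' => by linarith [h'.2.2]]
  simp

lemma coverAng_mem_Ioo (i j x y : ℕ) (hi : i < j) (hx : 1 ≤ x) (hy : i = 0 → 1 ≤ y) :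
    coverAng i (x, y) ∈ Ioo 0 (π / 2 * j) := by
  have hpi := Real.pi_pos
  have h1 := arg_ptC_lt x y hx
  have h2 := (arg_ptC_mem x y).1
  have hij : (i : ℝ) + 1 ≤ j := by exact_mod_cast hi
  rw [coverAng]
  constructor
  · rcases Nat.eq_zero_or_pos i with h0 | h0
    · have := arg_ptC_pos x y (hy h0)
      positivity
    · have : (0:ℝ) < i := by exact_mod_cast h0
      positivity
  · nlinarith

lemma rot_iterate_succ_axis (i : ℕ) (c d : ℤ) : rot^[i + 1] (c, -d) = rot^[i] (d, c) := by
  simp [rot]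

/-- A bounded solution of the boundary value problem on the universal cover approximates the
truncated walk sums for all states on the closed quadrants. -/
lemma abs_sub_arrival_le {t : ℝ} {j l : ℕ} (H : ℕ → ℕ → ℕ → ℝ) (N : ℕ) (ε : ℝ) (hε : 0 ≤ ε)
    (hzz : ∀ i < j, H i 0 0 = 0)
    (hglue : ∀ i n, i + 1 < j → 1 ≤ n → H i 0 n = H (i + 1) n 0)
    (hend : ∀ n, 1 ≤ n → H (j - 1) 0 n = if n = l then 1 else 0)
    (hzero : ∀ n, 1 ≤ n → H 0 n 0 = 0)
    (ih : ∀ i x y, i < j → 1 ≤ x → (i = 0 → 1 ≤ y) →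
      |H i x y - exitSum t l (π / 2 * j) N (rot^[i] (x, y)) (coverAng i (x, y))| ≤ ε)
    (i x y a b : ℕ) (hi : i < j) (hxy : ((x : ℤ), (y : ℤ)) ≠ 0) :
    |H i a b - arrival t l (π / 2 * j) N (rot^[i] (a, b))
      (coverAng i (x, y) + stepAng (rot^[i] (x, y)) (rot^[i] (a, b)))| ≤ ε := by
  have hpi := Real.pi_pos
  have hj : (0 : ℝ) < j := by exact_mod_cast (by omega : 0 < j)
  by_cases hab : ((a : ℤ), (b : ℤ)) = 0
  · have ha : a = 0 := by simpa using congrArg Prod.fst hab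
    have hb : b = 0 := by simpa using congrArg Prod.snd hab
    rw [hab, rot_iterate_zero, arrival_zero, ha, hb, hzz i hi]
    simpa using hε
  rw [coverAng_add_stepAng i _ _ hxy hab (arg_ptC_mem x y) (arg_ptC_mem a b)]
  rcases Nat.eq_zero_or_pos a with ha | ha
  · subst ha
    have hb : 1 ≤ b := by
      rcases Nat.eq_zero_or_pos b with hb | hb
      · subst hb; exact absurd rfl hab
      · exact hb
    by_cases hij : i + 1 < j
    · rw [hglue i b hij hb]
      have h1 := ih (i + 1) b 0 hij hb (by omega)
      have h2 : coverAng i ((0 : ℕ), b) = coverAng (i + 1) (b, (0 : ℕ)) := by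
        simp only [coverAng, Nat.cast_zero, arg_ptC_axis, arg_ptC_axis' b hb]
        push_cast; ring
      have h3 : rot^[i] (((0 : ℕ) : ℤ), (b : ℤ)) = rot^[i + 1] ((b : ℤ), ((0 : ℕ) : ℤ)) := by
        have := rot_iterate_succ_axis i b 0
        simpa using this.symm
      rw [h2, h3, arrival_of_mem]
      · exact h1
      · exact coverAng_mem_Ioo _ _ _ _ hij hb (by omega)
    · obtain rfl : j = i + 1 := by omega
      have h2 : coverAng i ((0 : ℕ), b) = π / 2 * ((i + 1 : ℕ) : ℝ) := by
        simp only [coverAng, Nat.cast_zero, arg_ptC_axis' b hb]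
        push_cast; ring
      have h4 := hend b hb
      rw [Nat.add_sub_cancel] at h4
      rw [h2, arrival, card_exitWalks_zero, if_neg (c := _ ∈ Ioo _ _) fun h => lt_irrefl _ h.2, h4]
      have h5 : rot^[i] (((0 : ℕ) : ℤ), (b : ℤ)) ≠ 0 := by
        rwa [Ne, rot_iterate_eq_zero_iff]
      have h6 : AxisDist l (rot^[i] (((0 : ℕ) : ℤ), (b : ℤ))) ↔ b = l := by
        rw [axisDist_rot_iterate]
        simp only [AxisDist, Prod.mk.injEq]
        omega
      simp only [ne_eq, h5, not_false_eq_true, h6, and_true, true_and]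
      split_ifs <;> simpa using hε
  · by_cases h0 : i = 0 ∧ b = 0
    · obtain ⟨rfl, rfl⟩ := h0
      rw [hzero a ha, arrival_of_nonpos]
      · simpa using hε
      · positivity
      · simp [coverAng, arg_ptC_axis]
    · rw [arrival_of_mem]
      · exact ih i a b hi ha (by omega)
      · exact coverAng_mem_Ioo _ _ _ _ hi ha (by omega)

lemma abs_mul_sum_four_le {t ε a b c d a' b' c' d' : ℝ} (ht : 0 ≤ t) (ha : |a - a'| ≤ ε)
    (hb : |b - b'| ≤ ε) (hc : |c - c'| ≤ ε) (hd : |d - d'| ≤ ε) :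
    |t * (a + b + c + d) - t * (a' + b' + c' + d')| ≤ 4 * t * ε := by
  rw [← mul_sub, abs_mul, abs_of_nonneg ht]
  rw [abs_le] at ha hb hc hd
  have : |a + b + c + d - (a' + b' + c' + d')| ≤ 4 * ε := by
    rw [abs_le]; constructor <;> linarith
  nlinarith

/-- A bounded solution of the boundary value problem on the universal cover approximates the
truncated walk sums. -/
lemma abs_sub_exitSum_le {t B : ℝ} (ht : 0 < t) {j l : ℕ} (H : ℕ → ℕ → ℕ → ℝ)
    (hB : ∀ i x y, i < j → |H i x y| ≤ B)
    (hzz : ∀ i < j, H i 0 0 = 0)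
    (hint : ∀ i x y, i < j → 1 ≤ x → 1 ≤ y → H i x y = t * (H i (x + 1) (y + 1) +
      H i (x + 1) (y - 1) + H i (x - 1) (y - 1) + H i (x - 1) (y + 1)))
    (haxis : ∀ i n, i + 1 < j → 1 ≤ n → H (i + 1) n 0 = t * (H (i + 1) (n + 1) 1 +
      H i 1 (n + 1) + H i 1 (n - 1) + H (i + 1) (n - 1) 1))
    (hglue : ∀ i n, i + 1 < j → 1 ≤ n → H i 0 n = H (i + 1) n 0)
    (hend : ∀ n, 1 ≤ n → H (j - 1) 0 n = if n = l then 1 else 0)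
    (hzero : ∀ n, 1 ≤ n → H 0 n 0 = 0) (N : ℕ) :
    ∀ i x y, i < j → 1 ≤ x → (i = 0 → 1 ≤ y) →
      |H i x y - exitSum t l (π / 2 * j) N (rot^[i] (x, y)) (coverAng i (x, y))| ≤
        B * (4 * t) ^ N := by
  induction N with
  | zero =>
    intro i x y hi _ _
    simpa [exitSum] using hB i x y hi
  | succ N ih =>
    intro i x y hi hx hy
    have hε : 0 ≤ B * (4 * t) ^ N := by
      have := (abs_nonneg _).trans (hB i x y hi)
      positivity
    have hP : ((x : ℤ), (y : ℤ)) ≠ 0 := by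
      simp [Prod.ext_iff]; omega
    have key := abs_sub_arrival_le H N _ hε hzz hglue hend hzero ih
    rw [exitSum_succ _ _ _ _ _ (by rwa [Ne, rot_iterate_eq_zero_iff]),
      sum_neighbours i (x, y) (fun Q => arrival t l (π / 2 * j) N Q
        (coverAng i (x, y) + stepAng (rot^[i] (x, y)) Q)), pow_succ,
      show B * ((4 * t) ^ N * (4 * t)) = 4 * t * (B * (4 * t) ^ N) by ring]
    have hx1 : (x : ℤ) + -1 = ((x - 1 : ℕ) : ℤ) := by omega
    have hx2 : (x : ℤ) + 1 = ((x + 1 : ℕ) : ℤ) := by omega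
    simp only [Prod.mk_add_mk, hx1, hx2]
    rcases Nat.eq_zero_or_pos y with h0 | h0
    · subst h0
      obtain ⟨i, rfl⟩ : ∃ i', i = i' + 1 := ⟨i - 1, by omega⟩
      have h2 : coverAng (i + 1) (x, (0 : ℕ)) = coverAng i ((0 : ℕ), x) := by
        simp only [coverAng, Nat.cast_zero, arg_ptC_axis, arg_ptC_axis' x hx]
        push_cast; ring
      have h3 : rot^[i + 1] ((x : ℤ), ((0 : ℕ) : ℤ)) = rot^[i] (((0 : ℕ) : ℤ), (x : ℤ)) := by
        have := rot_iterate_succ_axis i x 0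
        simpa using this
      have h4 : ∀ c : ℕ, rot^[i + 1] ((c : ℤ), ((0 : ℕ) : ℤ) + -1) = rot^[i] (((1 : ℕ) : ℤ), (c : ℤ)) := by
        intro c
        have := rot_iterate_succ_axis i c 1
        simpa using this
      have h5 : ((0 : ℕ) : ℤ) + 1 = ((1 : ℕ) : ℤ) := by norm_num
      rw [haxis i x hi hx, h4, h4, h5]
      have hP' : (((0 : ℕ) : ℤ), (x : ℤ)) ≠ 0 := by
        simp [Prod.ext_iff]; omega
      refine abs_mul_sum_four_le ht.le (key (i + 1) x 0 (x + 1) 1 hi hP) ?_ ?_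
        (key (i + 1) x 0 (x - 1) 1 hi hP)
      · rw [h2, h3]; exact key i 0 x 1 (x + 1) (by omega) hP'
      · rw [h2, h3]; exact key i 0 x 1 (x - 1) (by omega) hP'
    · have hy1 : (y : ℤ) + -1 = ((y - 1 : ℕ) : ℤ) := by omega
      have hy2 : (y : ℤ) + 1 = ((y + 1 : ℕ) : ℤ) := by omega
      rw [hint i x y hi hx h0]
      simp only [hy1, hy2]
      exact abs_mul_sum_four_le ht.le (key i x y _ _ hi hP) (key i x y _ _ hi hP)
        (key i x y _ _ hi hP) (key i x y _ _ hi hP)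

/-- The walk sum is computed by any bounded solution of the boundary value problem on the
universal cover. -/
lemma hasSum_walks_of_boundary_problem {t B : ℝ} (ht : t ∈ Ioo (0 : ℝ) (1 / 4)) {j l p : ℕ}
    (hj : 1 ≤ j) (hp : 1 ≤ p) (H : ℕ → ℕ → ℕ → ℝ)
    (hB : ∀ i x y, i < j → |H i x y| ≤ B)
    (hzz : ∀ i < j, H i 0 0 = 0)
    (hint : ∀ i x y, i < j → 1 ≤ x → 1 ≤ y → H i x y = t * (H i (x + 1) (y + 1) +
      H i (x + 1) (y - 1) + H i (x - 1) (y - 1) + H i (x - 1) (y + 1)))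
    (haxis : ∀ i n, i + 1 < j → 1 ≤ n → H (i + 1) n 0 = t * (H (i + 1) (n + 1) 1 +
      H i 1 (n + 1) + H i 1 (n - 1) + H (i + 1) (n - 1) 1))
    (hglue : ∀ i n, i + 1 < j → 1 ≤ n → H i 0 n = H (i + 1) n 0)
    (hend : ∀ n, 1 ≤ n → H (j - 1) 0 n = if n = l then 1 else 0)
    (hzero : ∀ n, 1 ≤ n → H 0 n 0 = 0) :
    HasSum (fun w : {w : List (ℤ × ℤ) // WCond l p (π / 2 * j) (Ioo 0 (π / 2 * j)) w} =>
        t ^ (w.val.length - 1)) (t * (H 0 (p + 1) 1 + H 0 (p - 1) 1)) := by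
  have hpi := Real.pi_pos
  have hj' : (0 : ℝ) < j := by exact_mod_cast hj
  have hα : 0 < π / 2 * (j : ℝ) := by positivity
  refine hasSum_walks_of_tendsto t ht.1.le l p _ hα _ ?_
  rw [← Filter.tendsto_add_atTop_iff_nat 1]
  have hlim : Filter.Tendsto (fun N : ℕ => 2 * t * B * (4 * t) ^ N) Filter.atTop (nhds 0) := by
    have := (tendsto_pow_atTop_nhds_zero_of_lt_one (by linarith [ht.1] : 0 ≤ 4 * t)
      (by linarith [ht.2])).const_mul (2 * t * B)
    simpa using this
  rw [← tendsto_sub_nhds_zero_iff]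
  refine squeeze_zero_norm (fun N => ?_) hlim
  have hε : 0 ≤ B * (4 * t) ^ N := by
    have := (abs_nonneg _).trans (hB 0 0 0 (by omega))
    have := ht.1
    positivity
  have hP : ((p : ℤ), ((0 : ℕ) : ℤ)) ≠ 0 := by
    simp [Prod.ext_iff]; omega
  have key := abs_sub_arrival_le (t := t) H N _ hε hzz hglue hend hzero
    (abs_sub_exitSum_le ht.1 H hB hzz hint haxis hglue hend hzero N) 0 p 0
  have hang : coverAng 0 ((p : ℤ), ((0 : ℕ) : ℤ)) = 0 := by simp [coverAng, arg_ptC_axis]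
  rw [exitSum_succ _ _ _ _ _ (by simpa using hP), sum_diagSteps]
  have hp1 : (p : ℤ) + -1 = ((p - 1 : ℕ) : ℤ) := by omega
  have hp2 : (p : ℤ) + 1 = ((p + 1 : ℕ) : ℤ) := by omega
  have hdown : ∀ c : ℕ, arrival t l (π / 2 * j) N ((c : ℤ), -1)
      (0 + stepAng ((p : ℤ), 0) ((c : ℤ), -1)) = 0 := by
    intro c
    refine arrival_of_nonpos _ _ _ _ _ _ hα ?_
    have h1 := arg_ptC_below c
    have h2 := arg_ptC_mem 1 c
    have h3 := arg_ptC_axis p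
    have h4 := h2.1
    have h5 := h2.2
    rw [Nat.cast_one] at h4 h5
    rw [stepAng, arg_div_of_bounds, h3, h1]
    · linarith
    · rw [Ne, ptC_eq_zero_iff]; simpa using hP
    · rw [Ne, ptC_eq_zero_iff]; simp
    · rw [h3, h1]; constructor <;> linarith
  have k1 := key (p + 1) 1 (by omega) hP
  have k2 := key (p - 1) 1 (by omega) hP
  rw [hang] at k1 k2
  simp only [Prod.mk_add_mk, zero_add, hp1, hp2] at hdown ⊢
  rw [hdown, hdown]
  simp only [Function.iterate_zero, id, Nat.cast_zero, Nat.cast_one, zero_add] at k1 k2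
  rw [abs_le] at k1 k2
  rw [add_zero, add_zero, ← mul_sub, norm_mul, Real.norm_of_nonneg ht.1.le]
  have : ‖arrival t l (π / 2 * j) N (((p + 1 : ℕ) : ℤ), 1) (stepAng (↑p, 0) (((p + 1 : ℕ) : ℤ), 1)) +
      arrival t l (π / 2 * j) N (((p - 1 : ℕ) : ℤ), 1) (stepAng (↑p, 0) (((p - 1 : ℕ) : ℤ), 1)) -
      (H 0 (p + 1) 1 + H 0 (p - 1) 1)‖ ≤ 2 * (B * (4 * t) ^ N) := by
    rw [Real.norm_eq_abs, abs_le]; constructor <;> linarith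
  have := mul_le_mul_of_nonneg_left this ht.1.le
  linarith

/-- The integral `∫₀^∞ dx / √((a² + x²)(b² + x²))`. -/
def agmInt (a b : ℝ) : ℝ := ∫ x in Ioi (0:ℝ), 1 / Real.sqrt ((a ^ 2 + x ^ 2) * (b ^ 2 + x ^ 2))

lemma image_Ioi_eq_of_inv {f g : ℝ → ℝ} {s u : Set ℝ} (h1 : ∀ x ∈ s, f x ∈ u)
    (h2 : ∀ y ∈ u, g y ∈ s) (h3 : ∀ y ∈ u, f (g y) = y) : f '' s = u := by
  ext y
  constructor
  · rintro ⟨x, hx, rfl⟩; exact h1 x hx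
  · intro hy; exact ⟨g y, h2 y hy, h3 y hy⟩

lemma kComp_sq {k : ℝ} (hk : k ∈ Ioo (0:ℝ) 1) : kComp k ^ 2 = 1 - k ^ 2 := by
  rw [kComp, Real.sq_sqrt]
  nlinarith [hk.1, hk.2]

lemma kComp_mem {k : ℝ} (hk : k ∈ Ioo (0:ℝ) 1) : kComp k ∈ Ioo (0:ℝ) 1 := by
  have h := kComp_sq hk
  have h1 : 0 < kComp k := Real.sqrt_pos.2 (by nlinarith [hk.1, hk.2])
  exact ⟨h1, by nlinarith [hk.1, hk.2]⟩

lemma kell_eq_agmInt {k : ℝ} (hk : k ∈ Ioo (0:ℝ) 1) : Kell k = agmInt 1 (kComp k) := by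
  have himg : (fun x : ℝ => 1 / Real.sqrt (1 + x ^ 2)) '' Ioi 0 = Ioo 0 1 := by
    refine image_Ioi_eq_of_inv (g := fun y => Real.sqrt (1 - y ^ 2) / y) ?_ ?_ ?_
    · intro x hx
      have hx : 0 < x := hx
      have : 1 < Real.sqrt (1 + x ^ 2) := by
        rw [Real.lt_sqrt (by norm_num)]; nlinarith
      exact ⟨by positivity, by rw [div_lt_one (by positivity)]; exact this⟩
    · intro y hy
      have : 0 < Real.sqrt (1 - y ^ 2) := Real.sqrt_pos.2 (by nlinarith [hy.1, hy.2])
      exact div_pos this hy.1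
    · intro y hy
      have h0 : 0 < y := hy.1
      simp only [div_pow]
      rw [Real.sq_sqrt (by nlinarith [hy.2]), show 1 + (1 - y ^ 2) / y ^ 2 = (1 / y) ^ 2 by
        field_simp; ring, Real.sqrt_sq (by positivity)]
      field_simp
  rw [Kell, intervalIntegral.integral_of_le zero_le_one, MeasureTheory.integral_Ioc_eq_integral_Ioo,
    ← himg, MeasureTheory.integral_image_eq_integral_abs_deriv_smul measurableSet_Ioi
      (f' := fun x => -(x / (Real.sqrt (1 + x ^ 2) * (1 + x ^ 2)))) _ _, agmInt]
  · refine MeasureTheory.setIntegral_congr_fun measurableSet_Ioi fun x hx => ?_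
    have hx : 0 < x := hx
    have hs : Real.sqrt (1 + x ^ 2) ^ 2 = 1 + x ^ 2 := Real.sq_sqrt (by positivity)
    have hkk := kComp_sq hk
    have hq : 0 < kComp k ^ 2 + x ^ 2 := by positivity
    have e1 : (1 - (1 / Real.sqrt (1 + x ^ 2)) ^ 2) * (1 - k ^ 2 * (1 / Real.sqrt (1 + x ^ 2)) ^ 2)
        = (x / (1 + x ^ 2)) ^ 2 * (kComp k ^ 2 + x ^ 2) := by
      rw [div_pow, hs, hkk]; field_simp; ring
    simp only [smul_eq_mul]
    rw [e1, abs_neg, abs_of_pos (by positivity), Real.sqrt_mul (by positivity),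
      Real.sqrt_sq (by positivity), one_pow, Real.sqrt_mul (by positivity)]
    have : 0 < Real.sqrt (kComp k ^ 2 + x ^ 2) := Real.sqrt_pos.2 hq
    field_simp
  · intro x hx
    have hx : 0 < x := hx
    have hs : Real.sqrt (1 + x ^ 2) ^ 2 = 1 + x ^ 2 := Real.sq_sqrt (by positivity)
    have h1 : HasDerivAt (fun x : ℝ => 1 + x ^ 2) (2 * x) x := by
      simpa using (hasDerivAt_pow 2 x).const_add 1
    have h2 := (h1.sqrt (by positivity)).inv (by positivity)
    simp only [one_div]
    refine (h2.congr_deriv ?_).hasDerivWithinAt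
    rw [hs]; field_simp
  · intro x hx y hy h
    have hx : 0 < x := hx
    have hy : 0 < y := hy
    simp only [one_div, inv_inj] at h
    have := (Real.sqrt_inj (by positivity) (by positivity)).1 h
    nlinarith

lemma agmInt_mul {a b s : ℝ} (hs : 0 < s) :
    agmInt (s * a) (s * b) = agmInt a b / s := by
  have h := MeasureTheory.integral_comp_mul_left_Ioi
    (fun x : ℝ => 1 / Real.sqrt (((s * a) ^ 2 + x ^ 2) * ((s * b) ^ 2 + x ^ 2))) 0 hs
  rw [mul_zero, smul_eq_mul] at h
  have h2 : ∀ x : ℝ, 1 / Real.sqrt (((s * a) ^ 2 + (s * x) ^ 2) * ((s * b) ^ 2 + (s * x) ^ 2)) =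
      (1 / s ^ 2) * (1 / Real.sqrt ((a ^ 2 + x ^ 2) * (b ^ 2 + x ^ 2))) := by
    intro x
    rw [show ((s * a) ^ 2 + (s * x) ^ 2) * ((s * b) ^ 2 + (s * x) ^ 2) =
      (s ^ 2) ^ 2 * ((a ^ 2 + x ^ 2) * (b ^ 2 + x ^ 2)) by ring, Real.sqrt_mul (by positivity),
      Real.sqrt_sq (by positivity), one_div_mul_one_div]
  simp only [h2] at h
  rw [MeasureTheory.integral_const_mul] at h
  rw [agmInt, agmInt]
  field_simp at h ⊢
  linarith

lemma agmInt_agm {a b : ℝ} (ha : 0 < a) (hb : 0 < b) :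
    agmInt ((a + b) / 2) (Real.sqrt (a * b)) = agmInt a b := by
  have hab : 0 < a * b := mul_pos ha hb
  set g : ℝ → ℝ := fun x => 1 / Real.sqrt ((((a + b) / 2) ^ 2 + x ^ 2) *
    (Real.sqrt (a * b) ^ 2 + x ^ 2)) with hg
  have h1 : ∫ x, g x = 2 * agmInt ((a + b) / 2) (Real.sqrt (a * b)) := by
    rw [agmInt, ← integral_comp_abs (f := g)]
    simp only [hg, sq_abs]
  have himg : (fun x : ℝ => (x - a * b / x) / 2) '' Ioi 0 = univ := by
    refine image_Ioi_eq_of_inv (g := fun u => u + Real.sqrt (u ^ 2 + a * b)) ?_ ?_ ?_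
    · intro x _; trivial
    · intro u _
      have h1 : |u| < Real.sqrt (u ^ 2 + a * b) := by
        rw [← Real.sqrt_sq_eq_abs]; exact Real.sqrt_lt_sqrt (by positivity) (by linarith)
      have := neg_abs_le u
      rw [mem_Ioi]
      linarith
    · intro u _
      have h1 : |u| < Real.sqrt (u ^ 2 + a * b) := by
        rw [← Real.sqrt_sq_eq_abs]; exact Real.sqrt_lt_sqrt (by positivity) (by linarith)
      have := neg_abs_le u
      have h2 : 0 < u + Real.sqrt (u ^ 2 + a * b) := by linarith
      have h3 : Real.sqrt (u ^ 2 + a * b) ^ 2 = u ^ 2 + a * b := Real.sq_sqrt (by positivity)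
      show (u + Real.sqrt (u ^ 2 + a * b) - a * b / (u + Real.sqrt (u ^ 2 + a * b))) / 2 = u
      have h4 : a * b / (u + Real.sqrt (u ^ 2 + a * b)) = Real.sqrt (u ^ 2 + a * b) - u := by
        rw [div_eq_iff h2.ne']; nlinarith
      rw [h4]; ring
  have h2 : ∫ x, g x = 2 * agmInt a b := by
    rw [← MeasureTheory.setIntegral_univ, ← himg,
      MeasureTheory.integral_image_eq_integral_abs_deriv_smul measurableSet_Ioi
      (f' := fun x => (1 + a * b / x ^ 2) / 2) _ _, agmInt, ← MeasureTheory.integral_const_mul]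
    · refine MeasureTheory.setIntegral_congr_fun measurableSet_Ioi fun x hx => ?_
      have hx : 0 < x := hx
      simp only [smul_eq_mul, hg]
      rw [abs_of_pos (by positivity), Real.sq_sqrt hab.le,
        show (((a + b) / 2) ^ 2 + ((x - a * b / x) / 2) ^ 2) * (a * b + ((x - a * b / x) / 2) ^ 2) =
          ((x + a * b / x) / (4 * x)) ^ 2 * ((a ^ 2 + x ^ 2) * (b ^ 2 + x ^ 2)) by
          field_simp; ring,
        Real.sqrt_mul (by positivity), Real.sqrt_sq (by positivity)]
      have : 0 < Real.sqrt ((a ^ 2 + x ^ 2) * (b ^ 2 + x ^ 2)) := Real.sqrt_pos.2 (by positivity)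
      have : 0 < x ^ 2 + a * b := by positivity
      field_simp
      norm_num
    · intro x hx
      have hx : 0 < x := hx
      have h := (((hasDerivAt_id x).sub (((hasDerivAt_inv hx.ne').const_mul (a * b)))).div_const 2)
      refine HasDerivAt.hasDerivWithinAt ?_
      refine h.congr_deriv ?_
      field_simp; ring
    · intro x hx y hy h
      have hx : 0 < x := hx
      have hy : 0 < y := hy
      have h : (x - a * b / x) / 2 = (y - a * b / y) / 2 := h
      field_simp at h
      have : (x - y) * (x * y + a * b) = 0 := by linarith
      rcases mul_eq_zero.1 this with h' | h'
      · linarith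
      · have : 0 < x * y := mul_pos hx hy
        linarith
  linarith

lemma kLanden_mem {k : ℝ} (hk : k ∈ Ioo (0:ℝ) 1) : kLanden k ∈ Ioo (0:ℝ) 1 := by
  have h := kComp_mem hk
  have h1 := h.1
  have h2 := h.2
  rw [kLanden]
  exact ⟨div_pos (by linarith) (by linarith), by rw [div_lt_one (by linarith)]; linarith⟩

lemma kell_kLanden {k : ℝ} (hk : k ∈ Ioo (0:ℝ) 1) :
    Kell (kLanden k) = (1 + kComp k) / 2 * Kell k := by
  have h := kComp_mem hk
  have h1 := h.1
  have h2 := h.2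
  have hc : kComp (kLanden k) = 2 / (1 + kComp k) * Real.sqrt (kComp k) := by
    rw [kComp, show 1 - kLanden k ^ 2 = (2 / (1 + kComp k)) ^ 2 * kComp k by
      rw [kLanden]; field_simp; ring, Real.sqrt_mul (by positivity), Real.sqrt_sq (by positivity)]
  rw [kell_eq_agmInt (kLanden_mem hk), kell_eq_agmInt hk, ← agmInt_agm zero_lt_one h1, hc,
    one_mul]
  conv_lhs => rw [show (1:ℝ) = 2 / (1 + kComp k) * ((1 + kComp k) / 2) by field_simp]
  rw [show 2 / (2 / (1 + kComp k) * ((1 + kComp k) / 2) + kComp k) * Real.sqrt (kComp k) =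
    2 / (1 + kComp k) * Real.sqrt (kComp k) by congr 3; field_simp, agmInt_mul (by positivity)]
  field_simp

lemma kell_kComp_kLanden {k : ℝ} (hk : k ∈ Ioo (0:ℝ) 1) :
    Kell (kComp (kLanden k)) = (1 + kComp k) * Kell (kComp k) := by
  have h := kComp_mem hk
  have h1 := h.1
  have h2 := h.2
  have hcc : ∀ {x : ℝ}, x ∈ Ioo (0:ℝ) 1 → kComp (kComp x) = x := by
    intro x hx
    rw [kComp, kComp_sq hx, sub_sub_cancel, Real.sqrt_sq hx.1.le]
  rw [kell_eq_agmInt (kComp_mem (kLanden_mem hk)), kell_eq_agmInt h, hcc (kLanden_mem hk), hcc hk]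
  have e : agmInt (1 + kComp k) (1 - kComp k) = agmInt 1 k := by
    rw [← agmInt_agm (by linarith) (by linarith)]
    congr 1
    · ring
    · rw [show (1 + kComp k) * (1 - kComp k) = k ^ 2 by
        have := kComp_sq hk
        linear_combination -this, Real.sqrt_sq hk.1.le]
  have e2 := agmInt_mul (a := 1) (b := kLanden k) (s := 1 + kComp k) (by linarith)
  rw [mul_one, show (1 + kComp k) * kLanden k = 1 - kComp k by
    rw [kLanden]; field_simp, e] at e2
  rw [e2]; field_simp

/-- The laws of the pair `S(u) = -cos (am u)`, `D = S' / ω` of Jacobi elliptic functions of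
modulus `κ`, with the argument normalized so that the real period is `1`. -/
structure JacobiPair (κ ω : ℝ) (S D : ℝ → ℝ) : Prop where
  hκ : κ ∈ Ioo (0:ℝ) 1
  hω : 0 < ω
  deriv_S : ∀ u, HasDerivAt S (ω * D u) u
  deriv_D : ∀ u, HasDerivAt D (ω * (2 * κ ^ 2 * S u ^ 3 - (1 + κ ^ 2) * S u)) u
  sq_D : ∀ u, D u ^ 2 = (1 - S u ^ 2) * (1 - κ ^ 2 * S u ^ 2)
  neg_S : ∀ u, S (-u) = S u
  neg_D : ∀ u, D (-u) = -D u
  half_S : ∀ u, S (u + 1 / 2) = -S u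
  half_D : ∀ u, D (u + 1 / 2) = -D u
  S_zero : S 0 = -1
  S_quarter : S (1 / 4) = 0
  D_pos : ∀ u ∈ Ioo (0:ℝ) (1 / 2), 0 < D u

lemma one_sub_mul_cos_sq_pos {κ : ℝ} (hκ : κ ∈ Ioo (0:ℝ) 1) (τ : ℝ) :
    0 < 1 - κ ^ 2 * Real.cos τ ^ 2 := by
  have h1 := Real.cos_sq_le_one τ
  have h2 : κ ^ 2 < 1 := by nlinarith [hκ.1, hκ.2]
  nlinarith [sq_nonneg (Real.cos τ), sq_nonneg κ]

/-- The integrand of the incomplete elliptic integral. -/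
def ellInt (κ τ : ℝ) : ℝ := 1 / Real.sqrt (1 - κ ^ 2 * Real.cos τ ^ 2)

lemma ellInt_continuous {κ : ℝ} (hκ : κ ∈ Ioo (0:ℝ) 1) : Continuous (ellInt κ) := by
  refine continuous_const.div (by fun_prop) fun τ => ?_
  exact (Real.sqrt_pos.2 (one_sub_mul_cos_sq_pos hκ τ)).ne'

lemma one_le_ellInt {κ : ℝ} (hκ : κ ∈ Ioo (0:ℝ) 1) (τ : ℝ) : 1 ≤ ellInt κ τ := by
  have h := one_sub_mul_cos_sq_pos hκ τ
  rw [ellInt, one_le_div (Real.sqrt_pos.2 h), Real.sqrt_le_one]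
  nlinarith [mul_nonneg (sq_nonneg κ) (sq_nonneg (Real.cos τ))]

lemma kell_eq_integral_ellInt {κ : ℝ} (hκ : κ ∈ Ioo (0:ℝ) 1) :
    Kell κ = ∫ τ in (0:ℝ)..(π / 2), ellInt κ τ := by
  have hpi := Real.pi_pos
  have hsin : ∀ x ∈ Ioo 0 (π / 2), 0 < Real.sin x := fun x hx =>
    Real.sin_pos_of_pos_of_lt_pi hx.1 (by linarith [hx.2])
  have hcos : ∀ x ∈ Ioo 0 (π / 2), 0 < Real.cos x := fun x hx =>
    Real.cos_pos_of_mem_Ioo ⟨by linarith [hx.1], hx.2⟩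
  have himg : Real.cos '' Ioo 0 (π / 2) = Ioo 0 1 := by
    refine image_Ioi_eq_of_inv (g := Real.arccos) ?_ ?_ ?_
    · intro x hx
      refine ⟨hcos x hx, ?_⟩
      have := hsin x hx
      nlinarith [Real.sin_sq_add_cos_sq x, hcos x hx]
    · intro y hy
      exact ⟨Real.arccos_pos.2 hy.2, Real.arccos_lt_pi_div_two.2 hy.1⟩
    · intro y hy
      exact Real.cos_arccos (by linarith [hy.1]) hy.2.le
  rw [Kell, intervalIntegral.integral_of_le zero_le_one, MeasureTheory.integral_Ioc_eq_integral_Ioo,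
    intervalIntegral.integral_of_le (by positivity), MeasureTheory.integral_Ioc_eq_integral_Ioo,
    ← himg, MeasureTheory.integral_image_eq_integral_abs_deriv_smul measurableSet_Ioo
      (f' := fun x => -Real.sin x) _ _]
  · refine MeasureTheory.setIntegral_congr_fun measurableSet_Ioo fun x hx => ?_
    have h1 := hsin x hx
    simp only [smul_eq_mul, ellInt]
    rw [abs_neg, abs_of_pos h1, ← Real.sin_sq, Real.sqrt_mul (by positivity), Real.sqrt_sq h1.le]
    have := Real.sqrt_pos.2 (one_sub_mul_cos_sq_pos hκ x)
    field_simp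
  · intro x _
    exact (Real.hasDerivAt_cos x).hasDerivWithinAt
  · refine Real.injOn_cos.mono fun x hx => ?_
    exact ⟨hx.1.le, by linarith [hx.2]⟩

lemma kell_pos {κ : ℝ} (hκ : κ ∈ Ioo (0:ℝ) 1) : 0 < Kell κ := by
  rw [kell_eq_integral_ellInt hκ]
  refine intervalIntegral.intervalIntegral_pos_of_pos ((ellInt_continuous hκ).intervalIntegrable _ _)
    (fun x => lt_of_lt_of_le one_pos (one_le_ellInt hκ x)) (by positivity)

lemma exists_jacobiPair {κ : ℝ} (hκ : κ ∈ Ioo (0:ℝ) 1) :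
    ∃ S D : ℝ → ℝ, JacobiPair κ (4 * Kell κ) S D := by
  have hpi := Real.pi_pos
  have hω : 0 < 4 * Kell κ := by have := kell_pos hκ; positivity
  set ω := 4 * Kell κ with hωd
  have hc := ellInt_continuous hκ
  have hint : ∀ a b, IntervalIntegrable (ellInt κ) MeasureTheory.volume a b :=
    fun a b => hc.intervalIntegrable a b
  set F : ℝ → ℝ := fun θ => (∫ τ in (0:ℝ)..θ, ellInt κ τ) / ω with hF
  have hF0 : F 0 = 0 := by simp [hF]
  have hFd : ∀ θ, HasDerivAt F (ellInt κ θ / ω) θ := fun θ =>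
    (intervalIntegral.integral_hasDerivAt_right (hint _ _)
      (hc.stronglyMeasurableAtFilter _ _) hc.continuousAt).div_const ω
  have hfpos : ∀ θ, 0 < ellInt κ θ := fun θ => lt_of_lt_of_le one_pos (one_le_ellInt hκ θ)
  have hmono : StrictMono F := strictMono_of_deriv_pos fun θ => by
    rw [(hFd θ).deriv]; exact div_pos (hfpos θ) hω
  have hFq : F (π / 2) = 1 / 4 := by
    simp only [hF]
    rw [← kell_eq_integral_ellInt hκ, hωd]
    have := kell_pos hκ
    field_simp
  have hFneg : ∀ θ, F (-θ) = -F θ := by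
    intro θ
    have h := intervalIntegral.integral_comp_neg (a := 0) (b := θ) (ellInt κ)
    have h2 : ∀ x, ellInt κ (-x) = ellInt κ x := fun x => by simp [ellInt]
    simp only [h2, neg_zero] at h
    simp only [hF]
    rw [h, intervalIntegral.integral_symm (-θ) 0]
    ring
  have hFpi : ∀ θ, F (θ + π) = F θ + 1 / 2 := by
    intro θ
    have hper : Function.Periodic (ellInt κ) π := fun x => by simp [ellInt]
    have h := hper.intervalIntegral_add_eq θ (-(π / 2))
    have h3 : ∀ a b, ∫ x in a..b, ellInt κ x = ω * (F b - F a) := by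
      intro a b
      rw [← intervalIntegral.integral_interval_sub_left (hint 0 b) (hint 0 a)]
      simp only [hF]
      field_simp
    rw [h3, h3, show -(π / 2) + π = π / 2 by ring, hFneg, hFq] at h
    have := mul_left_cancel₀ hω.ne' h
    linarith
  have hsurj : Function.Surjective F := by
    have hcont : Continuous F := continuous_iff_continuousAt.2 fun x => (hFd x).continuousAt
    refine hcont.surjective ?_ ?_
    · refine Filter.tendsto_atTop_mono' _ ?_ ?_ (f₁ := fun x => x / ω)
      · filter_upwards [Filter.eventually_ge_atTop 0] with x hx
        simp only [hF]
        gcongr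
        have := intervalIntegral.integral_mono_on hx (continuous_const.intervalIntegrable 0 x)
          (hint 0 x) (fun y _ => one_le_ellInt hκ y)
        simpa using this
      · exact Filter.tendsto_id.atTop_div_const hω
    · refine Filter.tendsto_atBot_mono' _ ?_ (Filter.tendsto_id.atBot_div_const hω)
      filter_upwards [Filter.eventually_le_atBot 0] with x hx
      have h1 := intervalIntegral.integral_mono_on hx (continuous_const.intervalIntegrable x 0)
          (hint x 0) (fun y _ => one_le_ellInt hκ y)
      simp only [hF, id]
      gcongr
      rw [intervalIntegral.integral_symm]
      simp at h1
      linarith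
  set e := hmono.orderIsoOfSurjective F hsurj with he
  set am : ℝ → ℝ := fun u => e.symm u with ham
  have hFam : ∀ u, F (am u) = u := fun u => e.apply_symm_apply u
  have hamF : ∀ θ u, F θ = u → am u = θ := fun θ u h => by rw [← h]; exact e.symm_apply_apply θ
  set Δ : ℝ → ℝ := fun u => Real.sqrt (1 - κ ^ 2 * Real.cos (am u) ^ 2) with hΔ
  have hΔpos : ∀ u, 0 < Δ u := fun u => Real.sqrt_pos.2 (one_sub_mul_cos_sq_pos hκ _)
  have hΔsq : ∀ u, Δ u ^ 2 = 1 - κ ^ 2 * Real.cos (am u) ^ 2 :=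
    fun u => Real.sq_sqrt (one_sub_mul_cos_sq_pos hκ _).le
  have hamd : ∀ u, HasDerivAt am (ω * Δ u) u := by
    intro u
    have := HasDerivAt.of_local_left_inverse (f := F) (g := am) (a := u)
      e.symm.continuous.continuousAt (hFd (am u)) (div_pos (hfpos _) hω).ne'
      (Filter.Eventually.of_forall hFam)
    refine this.congr_deriv ?_
    have := hΔpos u
    simp only [ellInt, hΔ] at this ⊢
    field_simp
  have hamneg : ∀ u, am (-u) = -am u := fun u => hamF _ _ (by rw [hFneg, hFam])
  have hamhalf : ∀ u, am (u + 1 / 2) = am u + π := fun u => hamF _ _ (by rw [hFpi, hFam])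
  have hS : ∀ u, HasDerivAt (fun u => -Real.cos (am u)) (ω * (Real.sin (am u) * Δ u)) u := by
    intro u
    refine (((Real.hasDerivAt_cos _).comp u (hamd u)).neg).congr_deriv ?_
    ring
  refine ⟨fun u => -Real.cos (am u), fun u => Real.sin (am u) * Δ u, hκ, hω, hS, ?_, ?_, ?_, ?_, ?_,
    ?_, ?_, ?_, ?_⟩
  · intro u
    have h1 := ((((Real.hasDerivAt_cos _).comp u (hamd u)).pow 2).const_mul (κ ^ 2)).const_sub 1
    have h2 := h1.sqrt (one_sub_mul_cos_sq_pos hκ (am u)).ne'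
    have h3 := ((Real.hasDerivAt_sin _).comp u (hamd u)).mul h2
    refine h3.congr_deriv ?_
    have h4 := hΔsq u
    have h5 := hΔpos u
    have h6 := Real.sin_sq (am u)
    simp only [Function.comp]
    change Real.cos (am u) * (ω * Δ u) * Δ u + Real.sin (am u) * (_ / (2 * Δ u)) = _
    field_simp
    simp only [Nat.cast_ofNat, Nat.add_one_sub_one, pow_one]
    linear_combination (2 * Real.cos (am u)) * h4 + (2 * κ ^ 2 * Real.cos (am u)) * h6
  · intro u
    have h4 := hΔsq u
    have h6 := Real.sin_sq (am u)
    simp only [mul_pow, neg_sq]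
    rw [h4, h6]
  · intro u; simp [hamneg]
  · intro u; simp [hamneg, hΔ]
  · intro u; simp only [hamhalf, Real.cos_add_pi]
  · intro u
    simp only [hamhalf, hΔ, Real.cos_add_pi, Real.sin_add_pi, neg_sq]
    ring
  · simp [hamF 0 0 hF0]
  · rw [hamF _ _ hFq]; simp
  · intro u hu
    have h0 : am 0 = 0 := hamF 0 0 hF0
    have h1 : am (1 / 2) = π := by
      have := hamhalf 0
      rw [h0] at this
      simpa using this
    have hm : StrictMono am := e.symm.strictMono
    have h2 : 0 < am u := h0 ▸ hm hu.1
    have h3 : am u < π := h1 ▸ hm hu.2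
    exact mul_pos (Real.sin_pos_of_pos_of_lt_pi h2 h3) (hΔpos u)

/-- The function `√((1 + X²)(1 + κ²X²))`. -/
def ellG (κ X : ℝ) : ℝ := Real.sqrt ((1 + X ^ 2) * (1 + κ ^ 2 * X ^ 2))

/-- The incomplete elliptic integral measuring the imaginary shift. -/
def ellY (κ ω X : ℝ) : ℝ := (∫ x in (0:ℝ)..X, 1 / ellG κ x) / ω

lemma ellG_pos (κ X : ℝ) : 0 < ellG κ X := Real.sqrt_pos.2 (by positivity)

lemma ellG_sq (κ X : ℝ) : ellG κ X ^ 2 = (1 + X ^ 2) * (1 + κ ^ 2 * X ^ 2) :=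
  Real.sq_sqrt (by positivity)

lemma ellG_continuous (κ : ℝ) : Continuous (ellG κ) := by
  unfold ellG; fun_prop

lemma inv_ellG_continuous (κ : ℝ) : Continuous fun x => 1 / ellG κ x :=
  continuous_const.div (ellG_continuous κ) fun x => (ellG_pos κ x).ne'

lemma ellY_zero (κ ω : ℝ) : ellY κ ω 0 = 0 := by simp [ellY]

lemma hasDerivAt_ellY (κ ω X : ℝ) : HasDerivAt (ellY κ ω) (1 / (ω * ellG κ X)) X := by
  have h := (intervalIntegral.integral_hasDerivAt_right
    ((inv_ellG_continuous κ).intervalIntegrable 0 X)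
    ((inv_ellG_continuous κ).stronglyMeasurableAtFilter _ _)
    (inv_ellG_continuous κ).continuousAt).div_const ω
  refine h.congr_deriv ?_
  rw [div_div, mul_comm]

lemma ellY_strictMono {κ ω : ℝ} (hω : 0 < ω) : StrictMono (ellY κ ω) :=
  strictMono_of_deriv_pos fun X => by
    rw [(hasDerivAt_ellY κ ω X).deriv]
    have := ellG_pos κ X
    positivity

lemma agmInt_one_eq {κ : ℝ} (hκ : κ ∈ Ioo (0:ℝ) 1) :
    agmInt 1 κ = 2 * ∫ x in (0:ℝ)..(1 / Real.sqrt κ), 1 / ellG κ x := by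
  have h0 := hκ.1
  set r := Real.sqrt κ with hr
  have hr0 : 0 < r := Real.sqrt_pos.2 h0
  have hrr : r ^ 2 = κ := Real.sq_sqrt h0.le
  set f : ℝ → ℝ := fun x => 1 / Real.sqrt ((1 ^ 2 + x ^ 2) * (κ ^ 2 + x ^ 2)) with hf
  have hfint : MeasureTheory.IntegrableOn (fun x => 1 / ellG κ x) (Ioo 0 (1 / r)) :=
    ((inv_ellG_continuous κ).integrableOn_Icc (a := 0) (b := 1 / r)).mono_set Ioo_subset_Icc_self
  have himg1 : (fun u : ℝ => κ * u) '' Ioo 0 (1 / r) = Ioo 0 r := by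
    refine image_Ioi_eq_of_inv (g := fun x => x / κ) ?_ ?_ ?_
    · intro u hu
      refine ⟨mul_pos h0 hu.1, ?_⟩
      have := mul_lt_mul_of_pos_left hu.2 h0
      calc κ * u < κ * (1 / r) := this
        _ = r := by rw [← hrr]; field_simp
    · intro x hx
      refine ⟨div_pos hx.1 h0, ?_⟩
      rw [div_lt_div_iff₀ h0 hr0, ← hrr]
      nlinarith [hx.2]
    · intro x _
      show κ * (x / κ) = x
      field_simp
  have himg2 : (fun u : ℝ => u⁻¹) '' Ioo 0 (1 / r) = Ioi r := by
    refine image_Ioi_eq_of_inv (g := fun x => x⁻¹) ?_ ?_ ?_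
    · intro u hu
      rw [mem_Ioi, lt_inv_comm₀ hr0 hu.1, ← one_div]
      exact hu.2
    · intro x hx
      have hx : r < x := hx
      refine ⟨inv_pos.2 (hr0.trans hx), ?_⟩
      rw [one_div]
      exact (inv_lt_inv₀ (hr0.trans hx) hr0).2 hx
    · intro x _
      exact inv_inv x
  have hd1 : ∀ u ∈ Ioo 0 (1 / r), HasDerivWithinAt (fun u : ℝ => κ * u) κ (Ioo 0 (1 / r)) u := by
    intro u _
    simpa using ((hasDerivAt_id u).const_mul κ).hasDerivWithinAt
  have hd2 : ∀ u ∈ Ioo 0 (1 / r), HasDerivWithinAt (fun u : ℝ => u⁻¹) (-(u ^ 2)⁻¹)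
      (Ioo 0 (1 / r)) u := fun u hu => (hasDerivAt_inv hu.1.ne').hasDerivWithinAt
  have hi1 : InjOn (fun u : ℝ => κ * u) (Ioo 0 (1 / r)) := fun x _ y _ h => mul_left_cancel₀ h0.ne' h
  have hi2 : InjOn (fun u : ℝ => u⁻¹) (Ioo 0 (1 / r)) := fun x _ y _ h => inv_injective h
  have he1 : ∀ u ∈ Ioo 0 (1 / r), |κ| • f (κ * u) = 1 / ellG κ u := by
    intro u hu
    have := ellG_pos κ u
    simp only [smul_eq_mul, hf]
    rw [abs_of_pos h0, show (1 ^ 2 + (κ * u) ^ 2) * (κ ^ 2 + (κ * u) ^ 2) =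
      κ ^ 2 * ((1 + u ^ 2) * (1 + κ ^ 2 * u ^ 2)) by ring, Real.sqrt_mul (by positivity),
      Real.sqrt_sq h0.le, ← ellG]
    field_simp
  have he2 : ∀ u ∈ Ioo 0 (1 / r), |-(u ^ 2)⁻¹| • f u⁻¹ = 1 / ellG κ u := by
    intro u hu
    have := ellG_pos κ u
    have hu0 := hu.1
    simp only [smul_eq_mul, hf]
    rw [abs_neg, abs_of_pos (by positivity), show (1 ^ 2 + u⁻¹ ^ 2) * (κ ^ 2 + u⁻¹ ^ 2) =
      ((u ^ 2)⁻¹) ^ 2 * ((1 + u ^ 2) * (1 + κ ^ 2 * u ^ 2)) by field_simp; ring,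
      Real.sqrt_mul (by positivity), Real.sqrt_sq (by positivity), ← ellG]
    field_simp
  have I1 : ∫ x in Ioo 0 r, f x = ∫ u in Ioo 0 (1 / r), 1 / ellG κ u := by
    rw [← himg1, MeasureTheory.integral_image_eq_integral_abs_deriv_smul measurableSet_Ioo hd1 hi1]
    exact MeasureTheory.setIntegral_congr_fun measurableSet_Ioo he1
  have I2 : ∫ x in Ioi r, f x = ∫ u in Ioo 0 (1 / r), 1 / ellG κ u := by
    rw [← himg2, MeasureTheory.integral_image_eq_integral_abs_deriv_smul measurableSet_Ioo hd2 hi2]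
    exact MeasureTheory.setIntegral_congr_fun measurableSet_Ioo he2
  have J1 : MeasureTheory.IntegrableOn f (Ioc 0 r) := by
    rw [integrableOn_Ioc_iff_integrableOn_Ioo, ← himg1,
      MeasureTheory.integrableOn_image_iff_integrableOn_abs_deriv_smul measurableSet_Ioo hd1 hi1]
    exact hfint.congr_fun (fun u hu => (he1 u hu).symm) measurableSet_Ioo
  have J2 : MeasureTheory.IntegrableOn f (Ioi r) := by
    rw [← himg2,
      MeasureTheory.integrableOn_image_iff_integrableOn_abs_deriv_smul measurableSet_Ioo hd2 hi2]
    exact hfint.congr_fun (fun u hu => (he2 u hu).symm) measurableSet_Ioo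
  rw [agmInt, ← Ioc_union_Ioi_eq_Ioi hr0.le, MeasureTheory.setIntegral_union
    (Ioc_disjoint_Ioi le_rfl) measurableSet_Ioi J1 J2, MeasureTheory.integral_Ioc_eq_integral_Ioo]
  rw [I1, I2, intervalIntegral.integral_of_le (by positivity),
    MeasureTheory.integral_Ioc_eq_integral_Ioo]
  ring

lemma ellY_inv_sqrt {κ : ℝ} (hκ : κ ∈ Ioo (0:ℝ) 1) :
    ellY κ (4 * Kell κ) (1 / Real.sqrt κ) = Kell (kComp κ) / (8 * Kell κ) := by
  have hcc : kComp (kComp κ) = κ := by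
    rw [kComp, kComp_sq hκ, sub_sub_cancel, Real.sqrt_sq hκ.1.le]
  rw [kell_eq_agmInt (kComp_mem hκ), hcc, agmInt_one_eq hκ, ellY]
  ring

/-- The function `√κ · sn` on the horizontal line at height `X`. -/
def jacZ (κ : ℝ) (S D : ℝ → ℝ) (X s : ℝ) : ℂ :=
  (Real.sqrt κ : ℂ) * (S s * ellG κ X + Complex.I * (D s * X)) / (1 + κ ^ 2 * S s ^ 2 * X ^ 2)

/-- The derivative of `jacZ` along its horizontal line. -/
def jacZd (κ ω : ℝ) (S D : ℝ → ℝ) (X s : ℝ) : ℂ :=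
  (Real.sqrt κ : ℂ) * ω * ((D s * ellG κ X + Complex.I * ((2 * κ ^ 2 * S s ^ 3 -
    (1 + κ ^ 2) * S s) * X)) * (1 + κ ^ 2 * S s ^ 2 * X ^ 2) -
    (S s * ellG κ X + Complex.I * (D s * X)) * (2 * κ ^ 2 * S s * D s * X ^ 2)) /
      (1 + κ ^ 2 * S s ^ 2 * X ^ 2) ^ 2

lemma jacZ_den_ne_zero (κ x X : ℝ) : (1 + (κ:ℂ) ^ 2 * (x:ℂ) ^ 2 * (X:ℂ) ^ 2) ≠ 0 := by
  have : (0:ℝ) < 1 + κ ^ 2 * x ^ 2 * X ^ 2 := by positivity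
  exact_mod_cast this.ne'

lemma ellG_sq_complex (κ X : ℝ) :
    (ellG κ X : ℂ) ^ 2 = (1 + (X:ℂ) ^ 2) * (1 + (κ:ℂ) ^ 2 * (X:ℂ) ^ 2) := by
  exact_mod_cast ellG_sq κ X

lemma hasDerivAt_ellG (κ X : ℝ) :
    HasDerivAt (ellG κ) (X * (1 + κ ^ 2 + 2 * κ ^ 2 * X ^ 2) / ellG κ X) X := by
  have h1 : HasDerivAt (fun X : ℝ => (1 + X ^ 2) * (1 + κ ^ 2 * X ^ 2))
      ((2 * X) * (1 + κ ^ 2 * X ^ 2) + (1 + X ^ 2) * (κ ^ 2 * (2 * X))) X := by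
    have h2 : HasDerivAt (fun X : ℝ => X ^ 2) (2 * X) X := by simpa using hasDerivAt_pow 2 X
    exact (h2.const_add 1).mul ((h2.const_mul (κ ^ 2)).const_add 1)
  refine (h1.sqrt (by positivity)).congr_deriv ?_
  rw [← ellG]
  have := ellG_pos κ X
  field_simp
  ring

namespace JacobiPair

variable {κ ω : ℝ} {S D : ℝ → ℝ}

lemma continuous_S (h : JacobiPair κ ω S D) : Continuous S :=
  continuous_iff_continuousAt.2 fun u => (h.deriv_S u).continuousAt

lemma continuous_D (h : JacobiPair κ ω S D) : Continuous D :=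
  continuous_iff_continuousAt.2 fun u => (h.deriv_D u).continuousAt

lemma continuous_jacZ (h : JacobiPair κ ω S D) :
    Continuous (Function.uncurry (jacZ κ S D)) := by
  have h1 := h.continuous_S
  have h2 := h.continuous_D
  have h3 := ellG_continuous κ
  unfold Function.uncurry jacZ
  refine Continuous.div (by fun_prop) (by fun_prop) fun p => jacZ_den_ne_zero _ _ _

lemma continuous_jacZd (h : JacobiPair κ ω S D) :
    Continuous (Function.uncurry (jacZd κ ω S D)) := by
  have h1 := h.continuous_S
  have h2 := h.continuous_D
  have h3 := ellG_continuous κ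
  unfold Function.uncurry jacZd
  refine Continuous.div (by fun_prop) (by fun_prop) fun p => pow_ne_zero _ (jacZ_den_ne_zero _ _ _)

lemma continuous_jacZ_right (h : JacobiPair κ ω S D) (X : ℝ) : Continuous (jacZ κ S D X) :=
  Continuous.uncurry_left X h.continuous_jacZ

lemma continuous_jacZd_right (h : JacobiPair κ ω S D) (X : ℝ) : Continuous (jacZd κ ω S D X) :=
  Continuous.uncurry_left X h.continuous_jacZd

lemma sq_D_complex (h : JacobiPair κ ω S D) (s : ℝ) :
    (D s : ℂ) ^ 2 = (1 - (S s : ℂ) ^ 2) * (1 - (κ:ℂ) ^ 2 * (S s : ℂ) ^ 2) := by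
  exact_mod_cast h.sq_D s

lemma sq_S_le (h : JacobiPair κ ω S D) (s : ℝ) : S s ^ 2 ≤ 1 := by
  by_contra hc
  have hk := h.hκ
  have hk2 : 0 < κ ^ 2 := by have := hk.1; positivity
  have hk3 : κ ^ 2 < 1 := by nlinarith [hk.1, hk.2]
  have hcont : Continuous fun u => S u ^ 2 := h.continuous_S.pow 2
  have hq : S (1 / 4) ^ 2 = 0 := by rw [h.S_quarter]; ring
  have h1 : 1 < S s ^ 2 := not_le.1 hc
  set v := (1 + min (S s ^ 2) (1 / κ ^ 2)) / 2 with hv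
  have hk4 : 1 < 1 / κ ^ 2 := by rw [lt_div_iff₀ hk2]; linarith
  have hv1 : 1 < v := by
    have := lt_min h1 hk4
    rw [hv]; linarith
  have hv2 : v < S s ^ 2 := by
    have := min_le_left (S s ^ 2) (1 / κ ^ 2)
    rw [hv]; linarith
  have hv3 : v < 1 / κ ^ 2 := by
    have := min_le_right (S s ^ 2) (1 / κ ^ 2)
    rw [hv]; linarith
  obtain ⟨u, hu⟩ : v ∈ range fun u => S u ^ 2 :=
    mem_range_of_exists_le_of_exists_ge hcont ⟨1 / 4, by simp only [hq]; linarith⟩ ⟨s, hv2.le⟩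
  have h2 := h.sq_D u
  have hu : S u ^ 2 = v := hu
  rw [hu] at h2
  have h3 : κ ^ 2 * v < 1 := by
    rw [lt_div_iff₀ hk2] at hv3; linarith
  nlinarith [sq_nonneg (D u), mul_pos (sub_pos.2 hv1) (sub_pos.2 h3)]

lemma hasDerivAt_jacZ (h : JacobiPair κ ω S D) (X s : ℝ) :
    HasDerivAt (jacZ κ S D X) (jacZd κ ω S D X s) s := by
  have h1 := (h.deriv_S s).ofReal_comp
  have h2 := (h.deriv_D s).ofReal_comp
  have h3 := (((h1.mul_const (ellG κ X : ℂ)).add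
    ((h2.mul_const (X:ℂ)).const_mul Complex.I)).const_mul (Real.sqrt κ : ℂ)).div
    ((((h1.pow 2).const_mul ((κ:ℂ) ^ 2)).mul_const ((X:ℂ) ^ 2)).const_add 1)
    (jacZ_den_ne_zero κ (S s) X)
  refine h3.congr_deriv ?_
  rw [jacZd]
  have := jacZ_den_ne_zero κ (S s) X
  simp only [Pi.pow_apply, Pi.add_apply]
  push_cast
  field_simp

lemma hasDerivAt_jacZ_left (h : JacobiPair κ ω S D) (X s : ℝ) :
    HasDerivAt (fun X => jacZ κ S D X s)
      (Complex.I / (ω * ellG κ X) * jacZd κ ω S D X s) X := by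
  have h1 := (hasDerivAt_ellG κ X).ofReal_comp
  have h2 := (hasDerivAt_id X).ofReal_comp
  have h3 := (((h1.const_mul (S s : ℂ)).add
    ((h2.const_mul (D s:ℂ)).const_mul Complex.I)).const_mul (Real.sqrt κ : ℂ)).div
    (((h2.pow 2).const_mul ((κ:ℂ) ^ 2 * (S s : ℂ) ^ 2)).const_add 1)
    (jacZ_den_ne_zero κ (S s) X)
  refine h3.congr_deriv ?_
  rw [jacZd]
  have hd := jacZ_den_ne_zero κ (S s) X
  have hG : (ellG κ X : ℂ) ≠ 0 := by exact_mod_cast (ellG_pos κ X).ne'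
  have hω : (ω : ℂ) ≠ 0 := by exact_mod_cast h.hω.ne'
  have e1 := ellG_sq_complex κ X
  have e2 := h.sq_D_complex s
  have e3 := Complex.I_sq
  simp only [Pi.pow_apply, Pi.add_apply, id]
  push_cast
  field_simp
  congr 1
  linear_combination (Real.sqrt κ : ℂ) * (-2 * (S s : ℂ) ^ 3 * X * (κ:ℂ) ^ 2 * e1 -
    2 * (S s : ℂ) * (X:ℂ) ^ 3 * (κ:ℂ) ^ 2 * e2 - ((1 + (S s : ℂ) ^ 2 * (X:ℂ) ^ 2 * (κ:ℂ) ^ 2) *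
      (S s * X * (2 * (S s : ℂ) ^ 2 * (κ:ℂ) ^ 2 - 1 - (κ:ℂ) ^ 2)) -
      2 * S s * (X:ℂ) ^ 3 * (κ:ℂ) ^ 2 * (D s : ℂ) ^ 2) * e3)

lemma normSq_jacZ (h : JacobiPair κ ω S D) (X s : ℝ) :
    ‖jacZ κ S D X s‖ ^ 2 = κ * (S s ^ 2 + X ^ 2) / (1 + κ ^ 2 * S s ^ 2 * X ^ 2) := by
  have hd : (0:ℝ) < 1 + κ ^ 2 * S s ^ 2 * X ^ 2 := by positivity
  have hz : jacZ κ S D X s = ((Real.sqrt κ / (1 + κ ^ 2 * S s ^ 2 * X ^ 2) : ℝ) : ℂ) *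
      (((S s * ellG κ X : ℝ) : ℂ) + ((D s * X : ℝ) : ℂ) * Complex.I) := by
    rw [jacZ]; push_cast; ring
  rw [hz, norm_mul, mul_pow, Complex.norm_real, Real.norm_eq_abs, sq_abs, Complex.sq_norm,
    Complex.normSq_add_mul_I, div_pow, Real.sq_sqrt h.hκ.1.le, mul_pow, mul_pow, ellG_sq, h.sq_D]
  field_simp
  ring

lemma jacZ_half (h : JacobiPair κ ω S D) (X s : ℝ) :
    jacZ κ S D X (s + 1 / 2) = -jacZ κ S D X s := by
  rw [jacZ, jacZ, h.half_S, h.half_D]; push_cast; ring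

lemma jacZd_half (h : JacobiPair κ ω S D) (X s : ℝ) :
    jacZd κ ω S D X (s + 1 / 2) = -jacZd κ ω S D X s := by
  rw [jacZd, jacZd, h.half_S, h.half_D]; push_cast; ring

lemma jacZ_one (h : JacobiPair κ ω S D) (X s : ℝ) :
    jacZ κ S D X (s + 1) = jacZ κ S D X s := by
  rw [show s + 1 = s + 1 / 2 + 1 / 2 by ring, h.jacZ_half, h.jacZ_half, neg_neg]

lemma jacZ_mul (h : JacobiPair κ ω S D) {X : ℝ} (hX : 0 < X) (s : ℝ) :
    jacZ κ S D X s * jacZ κ S D (-(1 / (κ * X))) s = 1 := by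
  have hk := h.hκ.1
  have hG : ellG κ (-(1 / (κ * X))) = ellG κ X / (κ * X ^ 2) := by
    rw [ellG, ellG, show (1 + (-(1 / (κ * X))) ^ 2) * (1 + κ ^ 2 * (-(1 / (κ * X))) ^ 2) =
      (1 / (κ * X ^ 2)) ^ 2 * ((1 + X ^ 2) * (1 + κ ^ 2 * X ^ 2)) by field_simp; ring,
      Real.sqrt_mul (by positivity), Real.sqrt_sq (by positivity)]
    field_simp
  have hd1 := jacZ_den_ne_zero κ (S s) X
  have hd2 := jacZ_den_ne_zero κ (S s) (-(1 / (κ * X)))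
  have e1 := ellG_sq_complex κ X
  have e2 := h.sq_D_complex s
  have e3 := Complex.I_sq
  have e4 : (Real.sqrt κ : ℂ) ^ 2 = κ := by exact_mod_cast Real.sq_sqrt hk.le
  have hkc : (κ : ℂ) ≠ 0 := by exact_mod_cast hk.ne'
  have hXc : (X : ℂ) ≠ 0 := by exact_mod_cast hX.ne'
  rw [jacZ, jacZ, hG, div_mul_div_comm, div_eq_one_iff_eq (mul_ne_zero hd1 hd2)]
  push_cast
  field_simp
  linear_combination (S s * ellG κ X + Complex.I * D s * X) * (S s * ellG κ X +
    -(Complex.I * D s * X)) * e4 + (κ:ℂ) * ((S s : ℂ) ^ 2 * e1 + (X:ℂ) ^ 2 * e2 -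
      (D s : ℂ) ^ 2 * (X:ℂ) ^ 2 * e3)

lemma jacZ_zero (s : ℝ) : jacZ κ S D 0 s = ((Real.sqrt κ * S s : ℝ) : ℂ) := by
  simp [jacZ, ellG]

lemma norm_jacZ_le (h : JacobiPair κ ω S D) (X s : ℝ) :
    ‖jacZ κ S D X s‖ ≤ Real.sqrt (κ * (1 + X ^ 2)) := by
  refine Real.le_sqrt_of_sq_le ?_
  have hk := h.hκ.1
  rw [h.normSq_jacZ]
  refine div_le_of_le_mul₀ (by positivity) (by positivity) ?_
  have := h.sq_S_le s
  have : κ * (S s ^ 2 + X ^ 2) ≤ κ * (1 + X ^ 2) := by gcongr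
  have : 0 ≤ κ * (1 + X ^ 2) * (κ ^ 2 * S s ^ 2 * X ^ 2) := by positivity
  linarith

lemma exists_norm_jacZ_le (h : JacobiPair κ ω S D) {X : ℝ} (hX : κ * X ^ 2 < 1) :
    ∃ r < 1, 0 ≤ r ∧ ∀ s, ‖jacZ κ S D X s‖ ≤ r := by
  have hk := h.hκ.1
  have hk1 := h.hκ.2
  refine ⟨Real.sqrt (κ * (1 + X ^ 2) / (1 + κ ^ 2 * X ^ 2)), ?_, Real.sqrt_nonneg _, fun s => ?_⟩
  · rw [Real.sqrt_lt' one_pos, div_lt_iff₀ (by positivity)]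
    nlinarith [mul_pos (sub_pos.2 hX) (sub_pos.2 hk1)]
  · refine Real.le_sqrt_of_sq_le ?_
    rw [h.normSq_jacZ, div_le_div_iff₀ (by positivity) (by positivity)]
    have h1 := h.sq_S_le s
    have h2 : 0 ≤ 1 - (κ * X ^ 2) ^ 2 := by
      have : 0 ≤ κ * X ^ 2 := by positivity
      nlinarith
    nlinarith [mul_nonneg hk.le (mul_nonneg (sub_nonneg.2 h1) h2)]

end JacobiPair

namespace JacobiPair

variable {κ ω : ℝ} {S D : ℝ → ℝ}

lemma sqrt_pos' (h : JacobiPair κ ω S D) : 0 < Real.sqrt κ := Real.sqrt_pos.2 h.hκ.1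

lemma ellG_inv_sqrt (h : JacobiPair κ ω S D) :
    ellG κ (1 / Real.sqrt κ) = (1 + κ) / Real.sqrt κ := by
  have h0 := h.hκ.1
  have h1 := h.sqrt_pos'
  have h2 : Real.sqrt κ ^ 2 = κ := Real.sq_sqrt h0.le
  rw [ellG, div_pow, h2, show (1 + 1 ^ 2 / κ) * (1 + κ ^ 2 * (1 ^ 2 / κ)) = (1 + κ) ^ 2 / κ by
    field_simp; ring, Real.sqrt_div (by positivity), Real.sqrt_sq (by positivity)]

lemma one_add_mul_sq_ne_zero (h : JacobiPair κ ω S D) (s : ℝ) :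
    (1 + (κ:ℂ) * (S s : ℂ) ^ 2) ≠ 0 := by
  have h0 := h.hκ.1
  have : (0:ℝ) < 1 + κ * S s ^ 2 := by positivity
  exact_mod_cast this.ne'

lemma one_add_kappa_ne_zero (h : JacobiPair κ ω S D) : (1 + (κ:ℂ)) ≠ 0 := by
  have h0 := h.hκ.1
  have : (0:ℝ) < 1 + κ := by positivity
  exact_mod_cast this.ne'

lemma jacW_eq (h : JacobiPair κ ω S D) (s : ℝ) : jacZ κ S D (1 / Real.sqrt κ) s =
    ((1 + κ) * S s + Complex.I * D s) / (1 + κ * (S s : ℂ) ^ 2) := by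
  have h0 := h.hκ.1
  have h1 : (Real.sqrt κ : ℂ) ≠ 0 := by exact_mod_cast h.sqrt_pos'.ne'
  have h2 : (Real.sqrt κ : ℂ) ^ 2 = κ := by exact_mod_cast Real.sq_sqrt h0.le
  have h3 : (κ : ℂ) ≠ 0 := by exact_mod_cast h0.ne'
  have h4 := h.one_add_mul_sq_ne_zero s
  rw [jacZ, h.ellG_inv_sqrt]
  push_cast
  rw [div_pow, h2, show 1 + (κ:ℂ) ^ 2 * (S s : ℂ) ^ 2 * (1 ^ 2 / (κ:ℂ)) = 1 + κ * (S s : ℂ) ^ 2 by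
    field_simp]
  field_simp

lemma jacWd_eq (h : JacobiPair κ ω S D) (s : ℝ) : jacZd κ ω S D (1 / Real.sqrt κ) s =
    -Complex.I * (ω * (1 + κ)) * (1 - κ * (S s : ℂ) ^ 2) / (1 + κ * (S s : ℂ) ^ 2) *
      jacZ κ S D (1 / Real.sqrt κ) s := by
  have h0 := h.hκ.1
  have h1 : (Real.sqrt κ : ℂ) ≠ 0 := by exact_mod_cast h.sqrt_pos'.ne'
  have h2 : (Real.sqrt κ : ℂ) ^ 2 = κ := by exact_mod_cast Real.sq_sqrt h0.le
  have h3 : (κ : ℂ) ≠ 0 := by exact_mod_cast h0.ne'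
  have h4 := h.one_add_mul_sq_ne_zero s
  have e2 := h.sq_D_complex s
  have e3 := Complex.I_sq
  rw [h.jacW_eq, jacZd, h.ellG_inv_sqrt]
  push_cast
  rw [div_pow, h2, show 1 + (κ:ℂ) ^ 2 * (S s : ℂ) ^ 2 * (1 ^ 2 / (κ:ℂ)) = 1 + κ * (S s : ℂ) ^ 2 by
    field_simp]
  field_simp
  linear_combination (-2 * (S s : ℂ) * κ * Complex.I * ω) * e2 +
    (ω * (1 + κ) * (D s : ℂ) * (1 - κ * (S s : ℂ) ^ 2)) * e3

lemma jacW_sq_add_one (h : JacobiPair κ ω S D) (s : ℝ) :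
    jacZ κ S D (1 / Real.sqrt κ) s ^ 2 + 1 =
      2 * (1 + κ) * S s / (1 + κ * (S s : ℂ) ^ 2) * jacZ κ S D (1 / Real.sqrt κ) s := by
  have h4 := h.one_add_mul_sq_ne_zero s
  have e2 := h.sq_D_complex s
  have e3 := Complex.I_sq
  rw [h.jacW_eq]
  field_simp
  linear_combination -e2 + (D s : ℂ) ^ 2 * e3

lemma norm_jacW (h : JacobiPair κ ω S D) (s : ℝ) : ‖jacZ κ S D (1 / Real.sqrt κ) s‖ = 1 := by
  have h0 := h.hκ.1
  have h2 : Real.sqrt κ ^ 2 = κ := Real.sq_sqrt h0.le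
  have : ‖jacZ κ S D (1 / Real.sqrt κ) s‖ ^ 2 = 1 := by
    rw [h.normSq_jacZ, div_pow, h2]
    have : 0 < 1 + κ * S s ^ 2 := by positivity
    rw [div_eq_one_iff_eq (by positivity)]
    field_simp
    ring
  exact (pow_eq_one_iff_of_nonneg (norm_nonneg _) two_ne_zero).1 this

lemma norm_jacZ_zero_le (h : JacobiPair κ ω S D) (s : ℝ) : ‖jacZ κ S D 0 s‖ ≤ 1 := by
  obtain ⟨r, hr, -, hz⟩ := h.exists_norm_jacZ_le (X := 0) (by norm_num)
  exact (hz s).trans hr.le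

lemma jacZd_zero (s : ℝ) : jacZd κ ω S D 0 s = Real.sqrt κ * ω * D s := by
  simp [jacZd, ellG]

section Kernel

variable {t : ℝ}

lemma sqrt_complex (ht : Real.sqrt κ = 2 * t * (1 + κ)) :
    (Real.sqrt κ : ℂ) = 2 * t * (1 + κ) := by
  exact_mod_cast congrArg (Complex.ofReal) ht

/-- The kernel identity of the diagonal walk. -/
lemma kernel (h : JacobiPair κ ω S D) (ht : Real.sqrt κ = 2 * t * (1 + κ)) (s : ℝ) :
    t * (jacZ κ S D 0 s ^ 2 + 1) * (jacZ κ S D (1 / Real.sqrt κ) s ^ 2 + 1) =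
      jacZ κ S D 0 s * jacZ κ S D (1 / Real.sqrt κ) s := by
  have h2 : (Real.sqrt κ : ℂ) ^ 2 = κ := by exact_mod_cast Real.sq_sqrt h.hκ.1.le
  have h4 := h.one_add_mul_sq_ne_zero s
  have h5 := sqrt_complex ht
  rw [h.jacW_sq_add_one, jacZ_zero]
  push_cast
  rw [mul_pow, h2, h5]
  field_simp
  ring

lemma kernel_right (h : JacobiPair κ ω S D) (ht : Real.sqrt κ = 2 * t * (1 + κ)) (s : ℝ) :
    2 * t * (jacZ κ S D 0 s ^ 2 + 1) * jacZ κ S D (1 / Real.sqrt κ) s =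
      jacZ κ S D 0 s + Complex.I / (ω * (1 + κ)) * jacZd κ ω S D 0 s := by
  have h2 : (Real.sqrt κ : ℂ) ^ 2 = κ := by exact_mod_cast Real.sq_sqrt h.hκ.1.le
  have h4 := h.one_add_mul_sq_ne_zero s
  have h5 := sqrt_complex ht
  have h6 : (ω : ℂ) ≠ 0 := by exact_mod_cast h.hω.ne'
  have h7 := h.one_add_kappa_ne_zero
  rw [h.jacW_eq, jacZ_zero, jacZd_zero]
  push_cast
  rw [mul_pow, h2, h5]
  field_simp
  ring

lemma kernel_up (h : JacobiPair κ ω S D) (ht : Real.sqrt κ = 2 * t * (1 + κ)) (s : ℝ) :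
    2 * t * jacZ κ S D 0 s * (jacZ κ S D (1 / Real.sqrt κ) s ^ 2 + 1) =
      jacZ κ S D (1 / Real.sqrt κ) s -
        Complex.I / (ω * (1 + κ)) * jacZd κ ω S D (1 / Real.sqrt κ) s := by
  have h2 : (Real.sqrt κ : ℂ) ^ 2 = κ := by exact_mod_cast Real.sq_sqrt h.hκ.1.le
  have h4 := h.one_add_mul_sq_ne_zero s
  have h5 := sqrt_complex ht
  have h6 : (ω : ℂ) ≠ 0 := by exact_mod_cast h.hω.ne'
  have h7 := h.one_add_kappa_ne_zero
  have e3 := Complex.I_sq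
  rw [h.jacW_sq_add_one, h.jacWd_eq, jacZ_zero]
  push_cast
  generalize jacZ κ S D (1 / Real.sqrt κ) s = W
  have h8 : 4 * (t:ℂ) * (1 + κ) * Real.sqrt κ = 2 * κ := by
    linear_combination 2 * h2 - 2 * (Real.sqrt κ : ℂ) * h5
  have h9 : 1 + (S s : ℂ) ^ 2 * κ ≠ 0 := by rwa [mul_comm]
  field_simp
  linear_combination (W * (S s : ℂ) ^ 2) * h8 - W * (1 - κ * (S s : ℂ) ^ 2) * e3

end Kernel

end JacobiPair

/-- The exponential `exp(2πims)`. -/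
def expM (m : ℤ) (s : ℝ) : ℂ := Complex.exp (2 * π * Complex.I * m * s)

lemma continuous_expM (m : ℤ) : Continuous (expM m) := by unfold expM; fun_prop

lemma hasDerivAt_expM (m : ℤ) (s : ℝ) :
    HasDerivAt (expM m) (2 * π * Complex.I * m * expM m s) s := by
  have h1 : HasDerivAt (fun s : ℝ => 2 * (π:ℂ) * Complex.I * m * s)
      (2 * π * Complex.I * m * 1) s := (Complex.ofRealCLM.hasDerivAt (x := s)).const_mul _
  refine h1.cexp.congr_deriv ?_
  rw [expM]; ring

lemma norm_expM (m : ℤ) (s : ℝ) : ‖expM m s‖ = 1 := by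
  rw [expM, show 2 * (π:ℂ) * Complex.I * m * s = ((2 * π * m * s : ℝ) : ℂ) * Complex.I by
    push_cast; ring, Complex.norm_exp_ofReal_mul_I]

lemma expM_zero (m : ℤ) : expM m 0 = 1 := by simp [expM]

lemma expM_zero_left (s : ℝ) : expM 0 s = 1 := by simp [expM]

lemma expM_one (m : ℤ) : expM m 1 = 1 := by
  rw [expM, Complex.exp_eq_one_iff]
  exact ⟨m, by push_cast; ring⟩

lemma expM_add_one (m : ℤ) (s : ℝ) : expM m (s + 1) = expM m s := by
  have : expM m (s + 1) = expM m s * expM m 1 := by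
    simp only [expM]; rw [← Complex.exp_add]; congr 1; push_cast; ring
  rw [this, expM_one, mul_one]

lemma expM_eq (m : ℤ) (s : ℝ) : expM m s =
    ((Real.cos (2 * π * m * s) : ℝ) : ℂ) + ((Real.sin (2 * π * m * s) : ℝ) : ℂ) * Complex.I := by
  rw [expM, show 2 * (π:ℂ) * Complex.I * m * s = ((2 * π * m * s : ℝ) : ℂ) * Complex.I by
    push_cast; ring, Complex.exp_mul_I]
  push_cast; rfl

lemma integral_deriv_eq_zero {f f' : ℝ → ℂ} (hf : ∀ s, HasDerivAt f (f' s) s)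
    (hc : Continuous f') (h01 : f 1 = f 0) : ∫ s in (0:ℝ)..1, f' s = 0 := by
  rw [intervalIntegral.integral_eq_sub_of_hasDerivAt (fun s _ => hf s)
    (hc.intervalIntegrable _ _), h01, sub_self]

/-- Integration by parts over a period against an exponential. -/
lemma integral_deriv_mul_expM {f f' : ℝ → ℂ} (hf : ∀ s, HasDerivAt f (f' s) s)
    (hc : Continuous f') (h01 : f 1 = f 0) (m : ℤ) :
    ∫ s in (0:ℝ)..1, f' s * expM m s =
      -(2 * π * Complex.I * m) * ∫ s in (0:ℝ)..1, f s * expM m s := by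
  have hfc : Continuous f := continuous_iff_continuousAt.2 fun s => (hf s).continuousAt
  have he := continuous_expM m
  have h := integral_deriv_eq_zero (fun s => (hf s).mul (hasDerivAt_expM m s))
    (by fun_prop) (by simp [h01, expM_zero, expM_one])
  rw [intervalIntegral.integral_add (Continuous.intervalIntegrable (by fun_prop) _ _)
    (Continuous.intervalIntegrable (by fun_prop) _ _)] at h
  rw [eq_neg_of_add_eq_zero_left h, ← intervalIntegral.integral_const_mul,
    ← intervalIntegral.integral_neg]
  congr 1
  ext s
  ring

/-- The Fourier coefficients of the powers of `jacZ κ S D 0 = √κ S`. -/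
def fourS (κ : ℝ) (S : ℝ → ℝ) (n : ℕ) (m : ℤ) : ℝ :=
  ∫ s in (0:ℝ)..1, (Real.sqrt κ * S s) ^ n * Real.cos (2 * π * m * s)

lemma fourS_neg (κ : ℝ) (S : ℝ → ℝ) (n : ℕ) (m : ℤ) : fourS κ S n (-m) = fourS κ S n m := by
  simp [fourS]

namespace JacobiPair

variable {κ ω : ℝ} {S D : ℝ → ℝ}

lemma S_one_sub (h : JacobiPair κ ω S D) (s : ℝ) : S (1 - s) = S s := by
  rw [show 1 - s = -s + 1 / 2 + 1 / 2 by ring, h.half_S, h.half_S, neg_neg, h.neg_S]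

lemma integral_pow_mul_sin (h : JacobiPair κ ω S D) (n : ℕ) (m : ℤ) :
    ∫ s in (0:ℝ)..1, (Real.sqrt κ * S s) ^ n * Real.sin (2 * π * m * s) = 0 := by
  have h1 := intervalIntegral.integral_comp_sub_left (a := 0) (b := 1)
    (fun s => (Real.sqrt κ * S s) ^ n * Real.sin (2 * π * m * s)) 1
  simp only [sub_self, sub_zero, h.S_one_sub] at h1
  have h2 : ∀ s : ℝ, Real.sin (2 * π * m * (1 - s)) = -Real.sin (2 * π * m * s) := by
    intro s
    rw [show 2 * π * m * (1 - s) = m * (2 * π) - 2 * π * m * s by ring,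
      Real.sin_int_mul_two_pi_sub]
  simp only [h2, mul_neg, intervalIntegral.integral_neg] at h1
  linarith

lemma integral_jacZ_zero_pow (h : JacobiPair κ ω S D) (n : ℕ) (m : ℤ) :
    ∫ s in (0:ℝ)..1, jacZ κ S D 0 s ^ n * expM m s = (fourS κ S n m : ℂ) := by
  have hS := h.continuous_S
  have h1 : ∀ s, jacZ κ S D 0 s ^ n * expM m s =
      (((Real.sqrt κ * S s) ^ n * Real.cos (2 * π * m * s) : ℝ) : ℂ) +
      (((Real.sqrt κ * S s) ^ n * Real.sin (2 * π * m * s) : ℝ) : ℂ) * Complex.I := by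
    intro s
    rw [jacZ_zero, expM_eq]; push_cast; ring
  simp only [h1]
  rw [intervalIntegral.integral_add (Continuous.intervalIntegrable (by fun_prop) _ _)
    (Continuous.intervalIntegrable (by fun_prop) _ _), intervalIntegral.integral_mul_const,
    intervalIntegral.integral_ofReal, intervalIntegral.integral_ofReal,
    h.integral_pow_mul_sin]
  simp [fourS]

lemma jacZ_one_eq (h : JacobiPair κ ω S D) (X : ℝ) : jacZ κ S D X 1 = jacZ κ S D X 0 := by
  have := h.jacZ_one X 0
  simpa using this

lemma hasDerivAt_pow_jacZ (h : JacobiPair κ ω S D) (X : ℝ) (n : ℕ) (s : ℝ) :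
    HasDerivAt (fun s => jacZ κ S D X s ^ n)
      (n * jacZ κ S D X s ^ (n - 1) * jacZd κ ω S D X s) s := by
  exact (h.hasDerivAt_jacZ X s).pow n

lemma integral_deriv_jacZ_pow (h : JacobiPair κ ω S D) (X : ℝ) (n : ℕ) (m : ℤ) :
    ∫ s in (0:ℝ)..1, n * jacZ κ S D X s ^ (n - 1) * jacZd κ ω S D X s * expM m s =
      -(2 * π * Complex.I * m) * ∫ s in (0:ℝ)..1, jacZ κ S D X s ^ n * expM m s := by
  have h1 := h.continuous_jacZ_right X
  have h2 := h.continuous_jacZd_right X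
  exact integral_deriv_mul_expM (h.hasDerivAt_pow_jacZ X n) (by fun_prop)
    (by rw [h.jacZ_one_eq]) m

lemma hasDerivAt_integral_jacZ_pow (h : JacobiPair κ ω S D) (n : ℕ) (m : ℤ) (X : ℝ) :
    HasDerivAt (fun X => ∫ s in (0:ℝ)..1, jacZ κ S D X s ^ n * expM m s)
      (2 * π * m / (ω * ellG κ X) * ∫ s in (0:ℝ)..1, jacZ κ S D X s ^ n * expM m s) X := by
  have he := continuous_expM m
  have hG := ellG_continuous κ
  have hGp := ellG_pos κ
  have hω := h.hω
  set F' : ℝ → ℝ → ℂ := fun X s => n * jacZ κ S D X s ^ (n - 1) *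
    (Complex.I / (ω * ellG κ X) * jacZd κ ω S D X s) * expM m s with hF'
  have hFc : Continuous (Function.uncurry F') := by
    have h1 := h.continuous_jacZ
    have h2 := h.continuous_jacZd
    have h3 : Continuous fun p : ℝ × ℝ => Complex.I / ((ω:ℂ) * (ellG κ p.1 : ℂ)) := by
      refine Continuous.div (by fun_prop) (by fun_prop) fun p => ?_
      have : ω * ellG κ p.1 ≠ 0 := (mul_pos hω (hGp _)).ne'
      exact_mod_cast this
    have h4 : Continuous fun p : ℝ × ℝ => jacZ κ S D p.1 p.2 := h1
    have h5 : Continuous fun p : ℝ × ℝ => jacZd κ ω S D p.1 p.2 := h2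
    show Continuous fun p : ℝ × ℝ => n * jacZ κ S D p.1 p.2 ^ (n - 1) *
      (Complex.I / (ω * ellG κ p.1) * jacZd κ ω S D p.1 p.2) * expM m p.2
    fun_prop
  obtain ⟨C, hC⟩ := ((isCompact_Icc (a := X - 1) (b := X + 1)).prod
    (isCompact_Icc (a := (0:ℝ)) (b := 1))).exists_bound_of_continuousOn hFc.continuousOn
  have key := (intervalIntegral.hasDerivAt_integral_of_dominated_loc_of_deriv_le
    (μ := MeasureTheory.volume) (a := (0:ℝ)) (b := 1)
    (F := fun X s => jacZ κ S D X s ^ n * expM m s) (F' := F') (x₀ := X)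
    (bound := fun _ => C) (s := Icc (X - 1) (X + 1)) (Icc_mem_nhds (by linarith) (by linarith))
    (Filter.Eventually.of_forall fun Y => by
      have := h.continuous_jacZ_right Y
      exact Continuous.aestronglyMeasurable (by fun_prop))
    (by
      have := h.continuous_jacZ_right X
      exact Continuous.intervalIntegrable (by fun_prop) _ _)
    (by
      have : Continuous (F' X) := Continuous.uncurry_left X hFc
      exact this.aestronglyMeasurable)
    (Filter.Eventually.of_forall fun s hs Y hY => by
      rw [uIoc_of_le zero_le_one] at hs
      exact hC (Y, s) ⟨hY, hs.1.le, hs.2⟩)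
    (by simp)
    (Filter.Eventually.of_forall fun s _ Y _ => by
      exact ((h.hasDerivAt_jacZ_left Y s).pow n).mul_const _)).2
  refine key.congr_deriv ?_
  have h6 : ∀ s, F' X s = Complex.I / (ω * ellG κ X) *
      (n * jacZ κ S D X s ^ (n - 1) * jacZd κ ω S D X s * expM m s) := by
    intro s; simp only [hF']; ring
  simp only [h6, intervalIntegral.integral_const_mul, h.integral_deriv_jacZ_pow]
  linear_combination (-(2 * π * m / (ω * ellG κ X : ℂ)) *
    ∫ s in (0:ℝ)..1, jacZ κ S D X s ^ n * expM m s) * Complex.I_sq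

/-- Shifting the line of integration. -/
lemma integral_jacZ_pow (h : JacobiPair κ ω S D) (n : ℕ) (m : ℤ) (X : ℝ) :
    ∫ s in (0:ℝ)..1, jacZ κ S D X s ^ n * expM m s =
      ((Real.exp (2 * π * m * ellY κ ω X) * fourS κ S n m : ℝ) : ℂ) := by
  set J := fun X => ∫ s in (0:ℝ)..1, jacZ κ S D X s ^ n * expM m s with hJ
  have h1 : ∀ X, HasDerivAt (fun X => ((Real.exp (-(2 * π * m * ellY κ ω X)) : ℝ) : ℂ) * J X)
      0 X := by
    intro X
    have h2 : HasDerivAt (fun X => ((Real.exp (-(2 * π * m * ellY κ ω X)) : ℝ) : ℂ))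
        ((Real.exp (-(2 * π * m * ellY κ ω X)) * -(2 * π * m * (1 / (ω * ellG κ X))) : ℝ) : ℂ)
        X :=
      (((hasDerivAt_ellY κ ω X).const_mul (2 * π * m)).neg.exp).ofReal_comp
    refine (h2.mul (h.hasDerivAt_integral_jacZ_pow n m X)).congr_deriv ?_
    push_cast
    ring
  have h2 := is_const_of_deriv_eq_zero (fun X => (h1 X).differentiableAt)
    (fun X => (h1 X).deriv) X 0
  simp only [ellY_zero, mul_zero, neg_zero, Real.exp_zero, Complex.ofReal_one, one_mul] at h2
  rw [show J 0 = (fourS κ S n m : ℂ) from h.integral_jacZ_zero_pow n m] at h2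
  rw [show (∫ s in (0:ℝ)..1, jacZ κ S D X s ^ n * expM m s) = J X from rfl]
  rw [Complex.ofReal_mul, ← h2, ← mul_assoc, ← Complex.ofReal_mul, ← Real.exp_add]
  simp

lemma abs_fourS_le (h : JacobiPair κ ω S D) (n : ℕ) (m : ℤ) (X : ℝ) :
    |fourS κ S n m| ≤ Real.exp (-(2 * π * m * ellY κ ω X)) * Real.sqrt (κ * (1 + X ^ 2)) ^ n := by
  have h1 := h.integral_jacZ_pow n m X
  have h2 : ‖∫ s in (0:ℝ)..1, jacZ κ S D X s ^ n * expM m s‖ ≤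
      Real.sqrt (κ * (1 + X ^ 2)) ^ n * |1 - 0| := by
    refine intervalIntegral.norm_integral_le_of_norm_le_const fun s _ => ?_
    rw [norm_mul, norm_expM, mul_one, norm_pow]
    exact pow_le_pow_left₀ (norm_nonneg _) (h.norm_jacZ_le X s) n
  rw [h1, Complex.norm_real, Real.norm_eq_abs, abs_mul, abs_of_pos (Real.exp_pos _)] at h2
  rw [Real.exp_neg, inv_mul_eq_div, le_div_iff₀ (Real.exp_pos _), mul_comm]
  simpa using h2

lemma fourS_zero (m : ℤ) (hm : m ≠ 0) : fourS κ S 0 m = 0 := by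
  have hm' : (m:ℝ) ≠ 0 := by exact_mod_cast hm
  have h0 : 2 * π * (m:ℝ) ≠ 0 := mul_ne_zero (by positivity) hm'
  simp only [fourS, pow_zero, one_mul]
  rw [intervalIntegral.integral_comp_mul_left (fun x => Real.cos x) h0, integral_cos]
  have : Real.sin (2 * π * m * 1) = 0 := by
    rw [show 2 * π * m * 1 = ((2 * m : ℤ) : ℝ) * π by push_cast; ring, Real.sin_int_mul_pi]
  rw [this]; simp

end JacobiPair

lemma expM_eq_fourier (m : ℤ) (s : ℝ) : expM m s = fourier m (s : UnitAddCircle) := by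
  rw [fourier_coe_apply, expM]
  congr 1
  push_cast
  ring

lemma hasSum_fourier_of_summable {f : ℝ → ℂ} (hf : Continuous f) (hp : ∀ s, f (s + 1) = f s)
    (hs : Summable fun m : ℤ => ∫ s in (0:ℝ)..1, f s * expM m s) (s : ℝ) :
    HasSum (fun m : ℤ => (∫ s in (0:ℝ)..1, f s * expM m s) * expM (-m) s) (f s) := by
  have hper : Function.Periodic f 1 := hp
  let F : C(UnitAddCircle, ℂ) := ⟨hper.lift, continuous_coinduced_dom.mpr hf⟩
  have hF : ∀ x : ℝ, F (x : UnitAddCircle) = f x := fun x => hper.lift_coe x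
  have hc : ∀ m : ℤ, fourierCoeff F (-m) = ∫ s in (0:ℝ)..1, f s * expM m s := by
    intro m
    rw [fourierCoeff_eq_intervalIntegral _ _ 0]
    simp only [neg_neg, hF, ← expM_eq_fourier, zero_add, smul_eq_mul, div_one, one_smul]
    congr 1
    ext s
    ring
  have hsF : Summable (fourierCoeff F) := by
    rw [← (Equiv.neg ℤ).summable_iff]
    exact hs.congr fun m => (hc m).symm
  have h1 := has_pointwise_sum_fourier_series_of_summable hsF (s : UnitAddCircle)
  rw [← (Equiv.neg ℤ).hasSum_iff, hF] at h1
  refine h1.congr_fun fun m => ?_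
  rw [expM_eq_fourier, Function.comp_apply, Equiv.neg_apply, hc, smul_eq_mul]

lemma eq_of_fourier_eq {f g : ℝ → ℂ} (hf : Continuous f) (hp : ∀ s, f (s + 1) = f s)
    (hg : Continuous g) (hgp : ∀ s, g (s + 1) = g s)
    (h : ∀ m : ℤ, ∫ s in (0:ℝ)..1, f s * expM m s = ∫ s in (0:ℝ)..1, g s * expM m s) :
    f = g := by
  have he := continuous_expM
  have h0 : ∀ m : ℤ, ∫ s in (0:ℝ)..1, (f s - g s) * expM m s = 0 := by
    intro m
    have := he m
    simp only [sub_mul]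
    rw [intervalIntegral.integral_sub (Continuous.intervalIntegrable (by fun_prop) _ _)
      (Continuous.intervalIntegrable (by fun_prop) _ _), h, sub_self]
  ext s
  have h1 := hasSum_fourier_of_summable (f := fun s => f s - g s) (by fun_prop)
    (fun s => by rw [hp, hgp]) (by simp only [h0]; exact summable_zero) s
  simp only [h0, zero_mul] at h1
  exact sub_eq_zero.1 (h1.unique hasSum_zero)

lemma integral_expM (m : ℤ) : ∫ s in (0:ℝ)..1, expM m s = if m = 0 then 1 else 0 := by
  split_ifs with hm
  · simp [hm, expM_zero_left]
  · have hm' : (m:ℂ) ≠ 0 := by exact_mod_cast hm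
    have h1 := integral_deriv_mul_expM (f := fun _ => (1:ℂ)) (f' := fun _ => 0)
      (fun s => hasDerivAt_const s 1) continuous_const rfl m
    simp only [zero_mul, intervalIntegral.integral_zero, one_mul] at h1
    have h2 : -(2 * (π:ℂ) * Complex.I * m) ≠ 0 := by
      simp [hm', Real.pi_ne_zero, Complex.I_ne_zero]
    exact (mul_eq_zero.1 h1.symm).resolve_left h2

lemma expM_add (m n : ℤ) (s : ℝ) : expM m s * expM n s = expM (m + n) s := by
  simp only [expM]; rw [← Complex.exp_add]; congr 1; push_cast; ring

lemma summable_coeff_mul_pow {κ : ℝ} {v : ℂ → ℂ} {a : ℕ → ℕ → ℝ} (ha : IsCoeff κ v a) {m : ℕ}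
    (hm : 1 ≤ m) {r : ℝ} (hr0 : 0 ≤ r) (hr : r < 1) : Summable fun n => |a n m| * r ^ n := by
  set R := (1 + r) / 2 with hR
  have hR0 : 0 < R := by rw [hR]; linarith
  have hR1 : R < 1 := by rw [hR]; linarith
  have h1 := (ha m hm (Complex.I * R) (by
    rintro ⟨h1, -⟩
    simp at h1
    exact hR0.ne' h1) (by simpa [abs_of_pos hR0] using hR1)).summable.norm
  refine h1.of_nonneg_of_le (fun n => by positivity) fun n => ?_
  rw [norm_mul, norm_pow, norm_mul, Complex.norm_I, Complex.norm_real, Complex.norm_real, one_mul,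
    Real.norm_eq_abs, Real.norm_eq_abs, abs_of_pos hR0]
  gcongr
  rw [hR]; linarith

namespace JacobiPair

variable {κ : ℝ} {S D : ℝ → ℝ}

lemma sq_S_lt (h : JacobiPair κ (4 * Kell κ) S D) {s : ℝ} (hs : s ∈ Ioo (0:ℝ) (1 / 2)) :
    S s ^ 2 < 1 := by
  refine lt_of_le_of_ne (h.sq_S_le s) fun h1 => ?_
  have h2 := h.sq_D s
  rw [h1] at h2
  have := h.D_pos s hs
  have h3 : D s ^ 2 = 0 := by rw [h2]; ring
  exact this.ne' (pow_eq_zero_iff two_ne_zero |>.1 h3)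

lemma vmap_eq (h : JacobiPair κ (4 * Kell κ) S D) {v : ℂ → ℂ} (hv : IsVmap κ v) {s : ℝ}
    (hs : s ∈ Ioo (0:ℝ) (1 / 2)) : v ((Real.sqrt κ * S s : ℝ) : ℂ) = s - 1 / 4 := by
  have hk := h.hκ.1
  have hK := h.hω
  have hsq : Real.sqrt κ ^ 2 = κ := Real.sq_sqrt hk.le
  have hsp : 0 < Real.sqrt κ := Real.sqrt_pos.2 hk
  have h1 : ∀ u ∈ Ioo (0:ℝ) (1 / 2),
      HasDerivAt (fun u : ℝ => v ((Real.sqrt κ * S u : ℝ) : ℂ) - u) 0 u := by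
    intro u hu
    have hD := h.D_pos u hu
    have h2 : HasDerivAt (fun u : ℝ => ((Real.sqrt κ * S u : ℝ) : ℂ))
        ((Real.sqrt κ * (4 * Kell κ * D u) : ℝ) : ℂ) u :=
      ((h.deriv_S u).const_mul (Real.sqrt κ)).ofReal_comp
    have h3 := hv.deriv_real (Real.sqrt κ * S u) (by
      rw [mul_pow, hsq]
      have := h.sq_S_lt hu
      nlinarith)
    have h4 : HasDerivAt (fun u : ℝ => (u : ℂ)) 1 u := Complex.ofRealCLM.hasDerivAt (x := u)
    refine ((h3.comp u h2).sub h4).congr_deriv ?_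
    rw [mul_pow, hsq, show (κ - κ * S u ^ 2) * (1 - κ * (κ * S u ^ 2)) = κ * D u ^ 2 by
      rw [h.sq_D]; ring, Real.sqrt_mul hk.le, Real.sqrt_sq hD.le, ← Complex.ofReal_mul,
      ← Complex.ofReal_one, ← Complex.ofReal_sub, Complex.ofReal_eq_zero]
    have : Kell κ ≠ 0 := fun h0 => by rw [h0] at hK; simp at hK
    field_simp
    ring
  have h5 := isOpen_Ioo.is_const_of_deriv_eq_zero isPreconnected_Ioo
    (fun u hu => (h1 u hu).differentiableAt.differentiableWithinAt)
    (fun u hu => (h1 u hu).deriv) hs (show (1 / 4 : ℝ) ∈ Ioo (0:ℝ) (1 / 2) by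
      constructor <;> norm_num)
  simp only [h.S_quarter, mul_zero, Complex.ofReal_zero, hv.map_zero] at h5
  rw [sub_eq_iff_eq_add.1 h5]
  push_cast
  ring

lemma hasSum_coeff (h : JacobiPair κ (4 * Kell κ) S D) {v : ℂ → ℂ} (hv : IsVmap κ v)
    {a : ℕ → ℕ → ℝ} (ha : IsCoeff κ v a) {m : ℕ} (hm : 1 ≤ m) (s : ℝ) :
    HasSum (fun n => a n m * (Real.sqrt κ * S s) ^ n)
      (Real.cos (2 * π * m * s) - Real.cos (π * m / 2)) := by
  have hk := h.hκ.1
  have hS := h.continuous_S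
  have hsq : Real.sqrt κ ^ 2 = κ := Real.sq_sqrt hk.le
  have hsp : 0 < Real.sqrt κ := Real.sqrt_pos.2 hk
  have hs1 : Real.sqrt κ < 1 := by
    rw [Real.sqrt_lt' one_pos]; simpa using h.hκ.2
  have hsum := summable_coeff_mul_pow ha hm hsp.le hs1
  have hbd : ∀ n u, ‖a n m * (Real.sqrt κ * S u) ^ n‖ ≤ |a n m| * Real.sqrt κ ^ n := by
    intro n u
    rw [norm_mul, norm_pow, norm_mul, Real.norm_eq_abs, Real.norm_eq_abs, Real.norm_eq_abs,
      abs_of_pos hsp]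
    have : |S u| ≤ 1 := by
      rw [← sq_le_one_iff_abs_le_one]; exact h.sq_S_le u
    gcongr
    exact mul_le_of_le_one_right hsp.le this
  have hsm : ∀ u, Summable fun n => a n m * (Real.sqrt κ * S u) ^ n := fun u =>
    Summable.of_norm_bounded hsum (hbd · u)
  set A : Set ℝ := {u | ∑' n, a n m * (Real.sqrt κ * S u) ^ n =
    Real.cos (2 * π * m * u) - Real.cos (π * m / 2)} with hA
  have hAc : IsClosed A := by
    refine isClosed_eq (continuous_tsum (fun n => by fun_prop) hsum hbd) (by fun_prop)
  have hA1 : Ioo (0:ℝ) (1 / 2) ⊆ A := by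
    intro u hu
    have h2 := h.sq_S_lt hu
    have h1 := ha m hm ((Real.sqrt κ * S u : ℝ) : ℂ) (by
      rintro ⟨-, h1⟩
      rw [Complex.ofReal_re, mul_pow, hsq] at h1
      nlinarith) (by
      rw [Complex.norm_real, Real.norm_eq_abs, abs_mul, abs_of_pos hsp]
      have : |S u| < 1 := by rw [← sq_lt_one_iff_abs_lt_one]; exact h2
      nlinarith [abs_nonneg (S u)])
    rw [fmFun, h.vmap_eq hv hu] at h1
    have h3 : HasSum (fun n => a n m * (Real.sqrt κ * S u) ^ n)
        (Real.cos (2 * π * m * u) - Real.cos (π * m / 2)) := by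
      rw [← Complex.hasSum_ofReal]
      push_cast at h1 ⊢
      convert! h1 using 3
      ring
    exact h3.tsum_eq
  have hA2 : Icc (0:ℝ) (1 / 2) ⊆ A := by
    rw [← closure_Ioo (by norm_num : (0:ℝ) ≠ 1 / 2)]
    exact closure_minimal hA1 hAc
  have hper : ∀ (u : ℝ) (n : ℤ), S (u - n) = S u := by
    have : Function.Periodic S 1 := fun u => by
      rw [show u + 1 = u + 1 / 2 + 1 / 2 by ring, h.half_S, h.half_S, neg_neg]
    intro u n
    have := this.sub_int_mul_eq (x := u) n
    simpa using this
  have hA3 : Int.fract s ∈ A := by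
    by_cases hf : Int.fract s ≤ 1 / 2
    · exact hA2 ⟨Int.fract_nonneg s, hf⟩
    · have h1 : 1 - Int.fract s ∈ A := hA2 ⟨by linarith [Int.fract_lt_one s], by linarith⟩
      simp only [hA, mem_ofPred_eq, h.S_one_sub] at h1 ⊢
      rw [h1, show 2 * π * m * (1 - Int.fract s) = m * (2 * π) - 2 * π * m * Int.fract s by ring,
        Real.cos_nat_mul_two_pi_sub]
  have hA4 : s ∈ A := by
    rw [← Int.self_sub_floor] at hA3
    simp only [hA, mem_ofPred_eq, hper] at hA3 ⊢
    rw [hA3, show 2 * π * m * (s - ⌊s⌋) = 2 * π * m * s - ((m * ⌊s⌋ : ℤ) : ℝ) * (2 * π) by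
      push_cast; ring, Real.cos_sub_int_mul_two_pi]
  have := (hsm s).hasSum
  rwa [show ∑' n, a n m * (Real.sqrt κ * S s) ^ n = _ from hA4] at this

end JacobiPair

lemma ellY_neg (κ ω X : ℝ) : ellY κ ω (-X) = -ellY κ ω X := by
  have h1 : ∀ X, HasDerivAt (fun X => ellY κ ω (-X) + ellY κ ω X) 0 X := by
    intro X
    have h2 := (hasDerivAt_ellY κ ω (-X)).scomp X (hasDerivAt_neg X)
    refine (h2.add (hasDerivAt_ellY κ ω X)).congr_deriv ?_
    have : ellG κ (-X) = ellG κ X := by simp [ellG]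
    rw [this]
    simp
  have h2 := is_const_of_deriv_eq_zero (fun X => (h1 X).differentiableAt)
    (fun X => (h1 X).deriv) X 0
  simp only [ellY_zero, neg_zero, add_zero] at h2
  linarith

lemma ellG_inv {κ X : ℝ} (hκ : 0 < κ) (hX : 0 < X) :
    ellG κ (-(1 / (κ * X))) = ellG κ X / (κ * X ^ 2) := by
  rw [ellG, ellG, show (1 + (-(1 / (κ * X))) ^ 2) * (1 + κ ^ 2 * (-(1 / (κ * X))) ^ 2) =
    ((1 + X ^ 2) * (1 + κ ^ 2 * X ^ 2)) / (κ * X ^ 2) ^ 2 by field_simp; ring,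
    Real.sqrt_div (by positivity), Real.sqrt_sq (by positivity)]

lemma ellY_inv {κ ω X : ℝ} (hκ : 0 < κ) (hX : 0 < X) :
    ellY κ ω (-(1 / (κ * X))) = ellY κ ω X - 2 * ellY κ ω (1 / Real.sqrt κ) := by
  have h1 : ∀ X ∈ Ioi (0:ℝ), HasDerivAt (fun X => ellY κ ω (-(1 / (κ * X))) - ellY κ ω X) 0 X := by
    intro X hX
    have hX' : (0:ℝ) < X := hX
    have h3 : HasDerivAt (fun X : ℝ => -(1 / (κ * X))) (1 / (κ * X ^ 2)) X := by
      have h4 := ((hasDerivAt_inv hX'.ne').const_mul (-(1 / κ)))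
      refine (h4.congr_of_eventuallyEq (Filter.Eventually.of_forall fun Y => ?_)).congr_deriv ?_
      · simp only []
        field_simp
      · field_simp
    have h2 := (hasDerivAt_ellY κ ω (-(1 / (κ * X)))).comp X h3
    refine (h2.sub (hasDerivAt_ellY κ ω X)).congr_deriv ?_
    rw [ellG_inv hκ hX']
    have := ellG_pos κ X
    by_cases hω : ω = 0
    · simp [hω]
    field_simp
    ring
  have hs : 0 < Real.sqrt κ := Real.sqrt_pos.2 hκ
  have hsq : Real.sqrt κ ^ 2 = κ := Real.sq_sqrt hκ.le
  have h5 := isOpen_Ioi.is_const_of_deriv_eq_zero isPreconnected_Ioi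
    (fun u hu => (h1 u hu).differentiableAt.differentiableWithinAt)
    (fun u hu => (h1 u hu).deriv) hX (show (1 / Real.sqrt κ : ℝ) ∈ Ioi (0:ℝ) by
      simpa using hs)
  rw [show 1 / (κ * (1 / Real.sqrt κ)) = 1 / Real.sqrt κ by
    nth_rewrite 1 [← hsq]; field_simp] at h5
  have h6 := ellY_neg κ ω (1 / Real.sqrt κ)
  linarith

namespace JacobiPair

variable {κ ω : ℝ} {S D : ℝ → ℝ}

lemma jacZ_ne_zero (h : JacobiPair κ ω S D) {X : ℝ} (hX : 0 < X) (s : ℝ) : jacZ κ S D X s ≠ 0 :=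
  left_ne_zero_of_mul_eq_one (h.jacZ_mul hX s)

lemma S_nonneg (h : JacobiPair κ ω S D) {s : ℝ} (hs : s ∈ Icc (1 / 4 : ℝ) (3 / 4)) : 0 ≤ S s := by
  have hmono : StrictMonoOn S (Icc 0 (1 / 2)) := by
    refine strictMonoOn_of_deriv_pos (convex_Icc _ _) h.continuous_S.continuousOn fun u hu => ?_
    rw [interior_Icc] at hu
    rw [(h.deriv_S u).deriv]
    exact mul_pos h.hω (h.D_pos u hu)
  have h1 : ∀ u ∈ Icc (1 / 4 : ℝ) (1 / 2), 0 ≤ S u := by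
    intro u hu
    rw [← h.S_quarter]
    exact hmono.monotoneOn ⟨by norm_num, by norm_num⟩ ⟨by linarith [hu.1], hu.2⟩ hu.1
  by_cases h2 : s ≤ 1 / 2
  · exact h1 s ⟨hs.1, h2⟩
  · rw [← h.S_one_sub]
    exact h1 _ ⟨by linarith [hs.2], by linarith⟩

lemma D_quarter (h : JacobiPair κ ω S D) : D (1 / 4) = 1 := by
  have h1 := h.sq_D (1 / 4)
  have h2 := h.D_pos (1 / 4) ⟨by norm_num, by norm_num⟩
  rw [h.S_quarter] at h1
  nlinarith

lemma jacZ_quarter (h : JacobiPair κ ω S D) (X : ℝ) :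
    jacZ κ S D X (1 / 4) = ((Real.sqrt κ * X : ℝ) : ℂ) * Complex.I := by
  rw [jacZ, h.S_quarter, h.D_quarter]
  push_cast
  ring

lemma jacZ_mem_slitPlane (h : JacobiPair κ ω S D) {X : ℝ} (hX : 0 < X) {s : ℝ}
    (hs : s ∈ Icc (1 / 4 : ℝ) (3 / 4)) : jacZ κ S D X s ∈ slitPlane := by
  have h1 : jacZ κ S D X s = ((Real.sqrt κ * S s * ellG κ X / (1 + κ ^ 2 * S s ^ 2 * X ^ 2) : ℝ) : ℂ)
      + ((Real.sqrt κ * D s * X / (1 + κ ^ 2 * S s ^ 2 * X ^ 2) : ℝ) : ℂ) * Complex.I := by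
    rw [jacZ]; push_cast; ring
  have hre : 0 ≤ (jacZ κ S D X s).re := by
    rw [h1]
    simp only [Complex.add_re, Complex.ofReal_re, Complex.re_ofReal_mul, Complex.I_re, mul_zero,
      add_zero]
    have := h.S_nonneg hs
    have := ellG_pos κ X
    positivity
  rw [Complex.mem_slitPlane_iff]
  by_contra hc
  push Not at hc
  exact h.jacZ_ne_zero hX s (Complex.ext (le_antisymm hc.1 hre) hc.2)

lemma integral_logDeriv_jacZ (h : JacobiPair κ ω S D) {X : ℝ} (hX : 0 < X) :
    ∫ s in (0:ℝ)..1, jacZd κ ω S D X s / jacZ κ S D X s = -(2 * π * Complex.I) := by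
  have hc1 := h.continuous_jacZ_right X
  have hc2 := h.continuous_jacZd_right X
  have hc : Continuous fun s => jacZd κ ω S D X s / jacZ κ S D X s :=
    hc2.div hc1 (h.jacZ_ne_zero hX)
  have hper : Function.Periodic (fun s => jacZd κ ω S D X s / jacZ κ S D X s) (1 / 2) := by
    intro s
    simp only [h.jacZ_half, h.jacZd_half, neg_div_neg_eq]
  have hsX : 0 < Real.sqrt κ * X := mul_pos (Real.sqrt_pos.2 h.hκ.1) hX
  have h1 : ∫ s in (1 / 4:ℝ)..(3 / 4), jacZd κ ω S D X s / jacZ κ S D X s = -(π * Complex.I) := by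
    rw [intervalIntegral.integral_eq_sub_of_hasDerivAt
      (f := fun s => Complex.log (jacZ κ S D X s)) (fun s hs => ?_) (hc.intervalIntegrable _ _)]
    · rw [show (3 / 4 : ℝ) = 1 / 4 + 1 / 2 by norm_num, h.jacZ_half, h.jacZ_quarter,
        Complex.log_ofReal_mul hsX Complex.I_ne_zero, ← mul_neg,
        Complex.log_ofReal_mul hsX (neg_ne_zero.2 Complex.I_ne_zero), Complex.log_I,
        Complex.log_neg_I]
      ring
    · rw [uIcc_of_le (by norm_num)] at hs
      exact (h.hasDerivAt_jacZ X s).clog_real (h.jacZ_mem_slitPlane hX hs)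
  have h2 := hper.intervalIntegral_add_eq 0 (1 / 4)
  have h3 := hper.intervalIntegral_add_eq (1 / 2) (1 / 4)
  rw [zero_add, show (1 / 4 + 1 / 2 : ℝ) = 3 / 4 by norm_num, h1] at h2
  rw [show (1 / 2 + 1 / 2 : ℝ) = 1 by norm_num, show (1 / 4 + 1 / 2 : ℝ) = 3 / 4 by norm_num,
    h1] at h3
  rw [← intervalIntegral.integral_add_adjacent_intervals (b := 1 / 2) (hc.intervalIntegrable _ _)
    (hc.intervalIntegrable _ _), h2, h3]
  ring

lemma hasDerivAt_zpow_jacZ (h : JacobiPair κ ω S D) {X : ℝ} (hX : 0 < X) (k : ℤ) (s : ℝ) :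
    HasDerivAt (fun s => jacZ κ S D X s ^ k)
      (k * (jacZ κ S D X s ^ (k - 1) * jacZd κ ω S D X s)) s := by
  refine ((hasDerivAt_zpow k _ (Or.inl (h.jacZ_ne_zero hX s))).comp s
    (h.hasDerivAt_jacZ X s)).congr_deriv ?_
  ring

lemma continuous_zpow_jacZ (h : JacobiPair κ ω S D) {X : ℝ} (hX : 0 < X) (k : ℤ) :
    Continuous fun s => jacZ κ S D X s ^ k :=
  continuous_iff_continuousAt.2 fun s => (h.hasDerivAt_zpow_jacZ hX k s).continuousAt

lemma integral_zpow_jacZ_mul (h : JacobiPair κ ω S D) {X : ℝ} (hX : 0 < X) (k : ℤ) :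
    ∫ s in (0:ℝ)..1, jacZ κ S D X s ^ (k - 1) * jacZd κ ω S D X s =
      if k = 0 then -(2 * π * Complex.I) else 0 := by
  have hc := h.continuous_zpow_jacZ hX
  have hc2 := h.continuous_jacZd_right X
  split_ifs with hk
  · rw [← h.integral_logDeriv_jacZ hX, hk]
    congr 1
    ext s
    rw [zero_sub, zpow_neg_one, inv_mul_eq_div]
  · have h1 := integral_deriv_eq_zero (h.hasDerivAt_zpow_jacZ hX k)
      (by have := hc (k - 1); fun_prop) (by simp only [h.jacZ_one_eq])
    rw [intervalIntegral.integral_const_mul] at h1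
    exact (mul_eq_zero.1 h1).resolve_left (by exact_mod_cast hk)

lemma integral_jacZ_zpow_neg (h : JacobiPair κ ω S D) {X : ℝ} (hX : 0 < X) (p : ℕ) (m : ℤ) :
    ∫ s in (0:ℝ)..1, jacZ κ S D X s ^ (-(p:ℤ)) * expM m s =
      ((Real.exp (2 * π * m * (ellY κ ω X - 2 * ellY κ ω (1 / Real.sqrt κ))) *
        fourS κ S p m : ℝ) : ℂ) := by
  rw [← ellY_inv h.hκ.1 hX, ← h.integral_jacZ_pow]
  congr 1
  ext s
  rw [zpow_neg, zpow_natCast, ← inv_pow, inv_eq_of_mul_eq_one_right (h.jacZ_mul hX s)]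

end JacobiPair

lemma hasSum_integral_mul {ι : Type*} [Countable ι] {F : ι → ℝ → ℂ} {P u : ℝ → ℂ} {B : ι → ℝ}
    (hF : ∀ n, Continuous (F n)) (hu : Continuous u) (hB : Summable B)
    (hFB : ∀ n s, ‖F n s‖ ≤ B n) (hP : ∀ s, HasSum (fun n => F n s) (P s)) :
    HasSum (fun n => ∫ s in (0:ℝ)..1, u s * F n s) (∫ s in (0:ℝ)..1, u s * P s) := by
  obtain ⟨C, hC⟩ := (isCompact_Icc (a := (0:ℝ)) (b := 1)).exists_bound_of_continuousOn
    hu.continuousOn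
  refine intervalIntegral.hasSum_integral_of_dominated_convergence (fun n _ => C * B n)
    (fun n => (hu.mul (hF n)).aestronglyMeasurable)
    (fun n => Filter.Eventually.of_forall fun s hs => ?_)
    (Filter.Eventually.of_forall fun s _ => hB.mul_left C) (by simp)
    (Filter.Eventually.of_forall fun s _ => (hP s).mul_left _)
  rw [uIoc_of_le zero_le_one] at hs
  have h1 := hC s ⟨hs.1.le, hs.2⟩
  rw [norm_mul]
  exact mul_le_mul h1 (hFB n s) (norm_nonneg _) ((norm_nonneg _).trans h1)

namespace JacobiPair

variable {κ ω : ℝ} {S D : ℝ → ℝ} {b : ℕ → ℝ} {m : ℕ} {c₀ : ℝ}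

/-- The function `cos(2πm(s+iY)) - c₀`, written with exponentials. -/
def shiftCos (m : ℕ) (c₀ Y s : ℝ) : ℂ :=
  ((Real.exp (-(2 * π * m * Y)) / 2 : ℝ) : ℂ) * expM m s +
    ((Real.exp (2 * π * m * Y) / 2 : ℝ) : ℂ) * expM (-m) s - (c₀ : ℂ) * expM 0 s

lemma continuous_shiftCos (m : ℕ) (c₀ Y : ℝ) : Continuous (shiftCos m c₀ Y) := by
  have := continuous_expM
  unfold shiftCos
  have h1 := this m
  have h2 := this (-m)
  have h3 := this 0
  fun_prop

lemma shiftCos_add_one (m : ℕ) (c₀ Y s : ℝ) : shiftCos m c₀ Y (s + 1) = shiftCos m c₀ Y s := by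
  simp only [shiftCos, expM_add_one]

lemma shiftCos_zero (m : ℕ) (c₀ s : ℝ) :
    shiftCos m c₀ 0 s = ((Real.cos (2 * π * m * s) - c₀ : ℝ) : ℂ) := by
  simp only [shiftCos, expM_eq]
  push_cast
  rw [show 2 * (π:ℂ) * -m * s = -(2 * π * m * s) by ring, Complex.cos_neg, Complex.sin_neg]
  simp
  ring

lemma integral_mul_shiftCos {u : ℝ → ℂ} (hu : Continuous u) (m : ℕ) (c₀ Y : ℝ) :
    ∫ s in (0:ℝ)..1, u s * shiftCos m c₀ Y s =
      ((Real.exp (-(2 * π * m * Y)) / 2 : ℝ) : ℂ) * (∫ s in (0:ℝ)..1, u s * expM m s) +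
      ((Real.exp (2 * π * m * Y) / 2 : ℝ) : ℂ) * (∫ s in (0:ℝ)..1, u s * expM (-m) s) -
      (c₀ : ℂ) * (∫ s in (0:ℝ)..1, u s * expM 0 s) := by
  have h1 := continuous_expM m
  have h2 := continuous_expM (-m)
  have h3 := continuous_expM 0
  rw [← intervalIntegral.integral_const_mul, ← intervalIntegral.integral_const_mul,
    ← intervalIntegral.integral_const_mul, ← intervalIntegral.integral_add
    (Continuous.intervalIntegrable (by fun_prop) _ _)
    (Continuous.intervalIntegrable (by fun_prop) _ _), ← intervalIntegral.integral_sub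
    (Continuous.intervalIntegrable (by fun_prop) _ _)
    (Continuous.intervalIntegrable (by fun_prop) _ _)]
  congr 1
  ext s
  rw [shiftCos]
  ring

lemma integral_expM_mul_shiftCos (m : ℕ) (c₀ Y : ℝ) (j : ℤ) :
    ∫ s in (0:ℝ)..1, expM j s * shiftCos m c₀ Y s = ((Real.exp (2 * π * j * Y) : ℝ) : ℂ) *
      ∫ s in (0:ℝ)..1, expM j s * shiftCos m c₀ 0 s := by
  rw [integral_mul_shiftCos (continuous_expM j), integral_mul_shiftCos (continuous_expM j)]
  simp only [expM_add, integral_expM]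
  have h1 : ((Real.exp (-(2 * π * m * Y)) / 2 : ℝ) : ℂ) * (if j + m = 0 then 1 else 0) =
      ((Real.exp (2 * π * j * Y) : ℝ) : ℂ) * (1 / 2 * (if j + m = 0 then 1 else 0)) := by
    split_ifs with hj
    · rw [eq_neg_of_add_eq_zero_left hj]; push_cast; ring_nf
    · simp
  have h2 : ((Real.exp (2 * π * m * Y) / 2 : ℝ) : ℂ) * (if j + -m = 0 then 1 else 0) =
      ((Real.exp (2 * π * j * Y) : ℝ) : ℂ) * (1 / 2 * (if j + -m = 0 then 1 else 0)) := by
    split_ifs with hj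
    · rw [eq_neg_of_add_eq_zero_left hj]; push_cast; ring_nf
    · simp
  have h3 : (c₀ : ℂ) * (if j + 0 = 0 then 1 else 0) =
      ((Real.exp (2 * π * j * Y) : ℝ) : ℂ) * (c₀ * (if j + 0 = 0 then 1 else 0)) := by
    split_ifs with hj
    · rw [eq_neg_of_add_eq_zero_left hj]; simp
    · simp
  simp only [mul_zero, neg_zero, Real.exp_zero]
  push_cast at h1 h2 h3 ⊢
  linear_combination h1 + h2 - h3

lemma summable_coeff_mul_jacZ (h : JacobiPair κ ω S D)
    (hb : ∀ r : ℝ, 0 ≤ r → r < 1 → Summable fun n => |b n| * r ^ n) {X : ℝ}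
    (hX : κ * X ^ 2 < 1) :
    ∃ B : ℕ → ℝ, Summable B ∧ ∀ n s, ‖(b n : ℂ) * jacZ κ S D X s ^ n‖ ≤ B n := by
  obtain ⟨r, hr1, hr0, hr⟩ := h.exists_norm_jacZ_le hX
  refine ⟨_, hb r hr0 hr1, fun n s => ?_⟩
  rw [norm_mul, norm_pow, Complex.norm_real, Real.norm_eq_abs]
  gcongr
  exact hr s

/-- The expansion of the shifted cosine in powers of `jacZ`. -/
lemma hasSum_jacZ (h : JacobiPair κ ω S D)
    (hb : ∀ r : ℝ, 0 ≤ r → r < 1 → Summable fun n => |b n| * r ^ n)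
    (hb1 : ∀ s, HasSum (fun n => b n * (Real.sqrt κ * S s) ^ n) (Real.cos (2 * π * m * s) - c₀))
    {X : ℝ} (hX : κ * X ^ 2 < 1) (s : ℝ) :
    HasSum (fun n => (b n : ℂ) * jacZ κ S D X s ^ n) (shiftCos m c₀ (ellY κ ω X) s) := by
  have hc : ∀ X n, Continuous fun s => (b n : ℂ) * jacZ κ S D X s ^ n := fun X n => by
    have := h.continuous_jacZ_right X
    fun_prop
  have h0 : κ * 0 ^ 2 < 1 := by norm_num
  obtain ⟨B, hB, hB2⟩ := h.summable_coeff_mul_jacZ hb hX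
  obtain ⟨B0, hB0, hB02⟩ := h.summable_coeff_mul_jacZ hb h0
  have hP : ∀ s, HasSum (fun n => (b n : ℂ) * jacZ κ S D X s ^ n)
      (∑' n, (b n : ℂ) * jacZ κ S D X s ^ n) := fun s =>
    (Summable.of_norm_bounded hB (hB2 · s)).hasSum
  have hP0 : ∀ s, HasSum (fun n => (b n : ℂ) * jacZ κ S D 0 s ^ n) (shiftCos m c₀ 0 s) := by
    intro s
    have h1 := Complex.hasSum_ofReal.2 (hb1 s)
    rw [← shiftCos_zero] at h1
    refine h1.congr_fun fun n => ?_
    rw [jacZ_zero]; push_cast; ring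
  have hI : ∀ (j : ℤ) X n, ∫ s in (0:ℝ)..1, expM j s * ((b n : ℂ) * jacZ κ S D X s ^ n) =
      ((Real.exp (2 * π * j * ellY κ ω X) : ℝ) : ℂ) * (b n * fourS κ S n j) := by
    intro j X n
    have h1 := h.integral_jacZ_pow n j X
    rw [Complex.ofReal_mul] at h1
    rw [mul_left_comm, ← h1, ← intervalIntegral.integral_const_mul]
    congr 1
    ext s
    ring
  have heq := eq_of_fourier_eq (f := fun s => ∑' n, (b n : ℂ) * jacZ κ S D X s ^ n)
    (g := shiftCos m c₀ (ellY κ ω X)) (continuous_tsum (hc X) hB hB2)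
    (fun s => by simp only [h.jacZ_one]) (continuous_shiftCos _ _ _) (shiftCos_add_one _ _ _)
    (fun j => by
      have h1 := hasSum_integral_mul (hc X) (continuous_expM j) hB hB2 hP
      have h2 := hasSum_integral_mul (hc 0) (continuous_expM j) hB0 hB02 hP0
      simp only [hI, ellY_zero, mul_zero, Real.exp_zero, Complex.ofReal_one, one_mul] at h1 h2
      simp only [mul_comm _ (expM j _)]
      rw [h1.unique (h2.mul_left _), ← integral_expM_mul_shiftCos])
  rw [← heq]
  exact hP s

/-- The Taylor coefficients in terms of the Fourier coefficients. -/
lemma coeff_eq (h : JacobiPair κ ω S D)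
    (hb : ∀ r : ℝ, 0 ≤ r → r < 1 → Summable fun n => |b n| * r ^ n)
    (hb1 : ∀ s, HasSum (fun n => b n * (Real.sqrt κ * S s) ^ n) (Real.cos (2 * π * m * s) - c₀))
    (p : ℕ) :
    2 * p * b p = m * fourS κ S p m * (Real.exp (4 * π * m * ellY κ ω (1 / Real.sqrt κ)) -
      Real.exp (-(4 * π * m * ellY κ ω (1 / Real.sqrt κ)))) := by
  have hX : κ * 1 ^ 2 < 1 := by simpa using h.hκ.2
  set Y := ellY κ ω 1 with hY
  set T := ellY κ ω (1 / Real.sqrt κ) with hT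
  have hc : ∀ n, Continuous fun s => (b n : ℂ) * jacZ κ S D 1 s ^ n := fun n => by
    have := h.continuous_jacZ_right 1
    fun_prop
  have hcz := h.continuous_zpow_jacZ one_pos
  have hcd := h.continuous_jacZd_right 1
  have hu : Continuous fun s => jacZ κ S D 1 s ^ (-(p:ℤ) - 1) * jacZd κ ω S D 1 s := by
    have := hcz (-(p:ℤ) - 1)
    fun_prop
  obtain ⟨B, hB, hB2⟩ := h.summable_coeff_mul_jacZ hb hX
  have h1 := hasSum_integral_mul hc hu hB hB2 (h.hasSum_jacZ hb hb1 hX)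
  have h2 : ∀ n : ℕ, ∫ s in (0:ℝ)..1, jacZ κ S D 1 s ^ (-(p:ℤ) - 1) * jacZd κ ω S D 1 s *
      ((b n : ℂ) * jacZ κ S D 1 s ^ n) =
      (b n : ℂ) * if n = p then -(2 * π * Complex.I) else 0 := by
    intro n
    have h3 := h.integral_zpow_jacZ_mul one_pos ((n:ℤ) - p)
    simp only [sub_eq_zero, Nat.cast_inj] at h3
    rw [← h3, ← intervalIntegral.integral_const_mul]
    congr 1
    ext s
    rw [show (n:ℤ) - p - 1 = (-(p:ℤ) - 1) + n by ring, zpow_add₀ (h.jacZ_ne_zero one_pos s),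
      zpow_natCast]
    ring
  simp only [h2] at h1
  have h4 := h1.unique (hasSum_single p fun n hn => by rw [if_neg hn, mul_zero])
  rw [if_pos rfl] at h4
  have h5 : ∀ j : ℤ, -(p:ℂ) * ∫ s in (0:ℝ)..1,
      jacZ κ S D 1 s ^ (-(p:ℤ) - 1) * jacZd κ ω S D 1 s * expM j s =
      -(2 * π * Complex.I * j) *
        ((Real.exp (2 * π * j * (Y - 2 * T)) * fourS κ S p j : ℝ) : ℂ) := by
    intro j
    have h6 := integral_deriv_mul_expM (h.hasDerivAt_zpow_jacZ one_pos (-(p:ℤ)))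
      (by fun_prop) (by simp only [h.jacZ_one_eq]) j
    rw [h.integral_jacZ_zpow_neg one_pos] at h6
    rw [← h6, ← intervalIntegral.integral_const_mul]
    congr 1
    ext s
    push_cast
    ring
  rw [integral_mul_shiftCos hu] at h4
  have h6 := h5 m
  have h7 := h5 (-m)
  have h8 := h5 0
  rw [fourS_neg] at h7
  have e1 : Real.exp (-(2 * π * m * Y)) * Real.exp (2 * π * (m:ℤ) * (Y - 2 * T)) =
      Real.exp (-(4 * π * m * T)) := by
    rw [← Real.exp_add]; congr 1; push_cast; ring
  have e2 : Real.exp (2 * π * m * Y) * Real.exp (2 * π * ((-m:ℤ):ℝ) * (Y - 2 * T)) =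
      Real.exp (4 * π * m * T) := by
    rw [← Real.exp_add]; congr 1; push_cast; ring
  rw [← e1, ← e2]
  have hpi : (2 * (π:ℂ) * Complex.I) ≠ 0 := Complex.two_pi_I_ne_zero
  rw [← Complex.ofReal_inj]
  refine mul_left_cancel₀ hpi ?_
  push_cast at h4 h6 h7 h8 ⊢
  linear_combination (2 * p : ℂ) * h4 + Complex.exp (-(2 * π * m * (ellY κ ω 1 : ℂ))) * h6 +
    Complex.exp (2 * π * m * (ellY κ ω 1 : ℂ)) * h7 - 2 * (c₀ : ℂ) * h8

end JacobiPair

/-- `2π` times the height of the line on which `√κ · sn` has modulus one. -/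
def jacEta (κ ω : ℝ) : ℝ := 2 * π * ellY κ ω (1 / Real.sqrt κ)

/-- `a n m` are the coefficients of `cos(2πms) - cos(πm/2)` as a power series in `√κ S(s)`. -/
structure CosExpansion (κ : ℝ) (S : ℝ → ℝ) (a : ℕ → ℕ → ℝ) : Prop where
  summable : ∀ m, 1 ≤ m → ∀ r : ℝ, 0 ≤ r → r < 1 → Summable fun n => |a n m| * r ^ n
  hasSum : ∀ m : ℕ, 1 ≤ m → ∀ s, HasSum (fun n => a n m * (Real.sqrt κ * S s) ^ n)
    (Real.cos (2 * π * m * s) - Real.cos (π * m / 2))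

lemma eq_zero_of_hasSum_pow {d : ℕ → ℝ} {r : ℝ} (hr : 0 < r)
    (h : ∀ x : ℝ, |x| < r → HasSum (fun n => d n * x ^ n) 0) (n : ℕ) : d n = 0 := by
  have h1 : HasFPowerSeriesAt (0 : ℝ → ℝ) (FormalMultilinearSeries.ofScalars ℝ d) 0 := by
    rw [hasFPowerSeriesAt_iff]
    filter_upwards [Metric.ball_mem_nhds (0:ℝ) hr] with x hx
    rw [mem_ball_zero_iff, Real.norm_eq_abs] at hx
    have := h x hx
    refine this.congr_fun fun n => ?_
    rw [FormalMultilinearSeries.coeff_ofScalars, smul_eq_mul, mul_comm]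
  have h2 := h1.eq_zero
  have h3 := FormalMultilinearSeries.coeff_ofScalars (𝕜 := ℝ) (p := d) (n := n)
  rw [h2] at h3
  simpa [FormalMultilinearSeries.coeff] using h3.symm

namespace JacobiPair

variable {κ ω : ℝ} {S D : ℝ → ℝ} {a : ℕ → ℕ → ℝ}

lemma jacEta_pos (h : JacobiPair κ ω S D) : 0 < jacEta κ ω := by
  have h1 := ellY_strictMono (κ := κ) h.hω (show 0 < 1 / Real.sqrt κ by
    have := h.sqrt_pos'; positivity)
  rw [ellY_zero] at h1
  unfold jacEta
  positivity

lemma coeff_eq_eta (h : JacobiPair κ ω S D) (hA : CosExpansion κ S a) {m : ℕ} (hm : 1 ≤ m)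
    (p : ℕ) : 2 * p * a p m = m * fourS κ S p m * (Real.exp (2 * m * jacEta κ ω) -
      Real.exp (-(2 * m * jacEta κ ω))) := by
  rw [h.coeff_eq (hA.summable m hm) (hA.hasSum m hm) p, jacEta]
  ring_nf

lemma coeff_zero (h : JacobiPair κ ω S D) (hA : CosExpansion κ S a) {m : ℕ} (hm : 1 ≤ m) :
    a 0 m = 0 := by
  have h1 := hA.hasSum m hm (1 / 4)
  rw [h.S_quarter, mul_zero] at h1
  have h2 := h1.unique (hasSum_single 0 fun n hn => by rw [zero_pow hn, mul_zero])
  rw [pow_zero, mul_one] at h2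
  rw [← h2, sub_eq_zero]
  congr 1
  ring

/-- Geometric bounds for the Fourier and Taylor coefficients. -/
lemma exists_bounds (h : JacobiPair κ ω S D) (hA : CosExpansion κ S a) :
    ∃ ρ C : ℝ, 0 < ρ ∧ ρ < 1 ∧ 0 < C ∧
      (∀ n m : ℕ, |fourS κ S n m| ≤ Real.exp (-(m * jacEta κ ω)) * ρ ^ m * C ^ n) ∧
      (∀ l m : ℕ, 1 ≤ m → |a l m| ≤ m * Real.exp (m * jacEta κ ω) * ρ ^ m * C ^ l) := by
  set X := 1 / Real.sqrt κ + 1 with hX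
  set ρ := Real.exp (jacEta κ ω - 2 * π * ellY κ ω X) with hρ
  set C := Real.sqrt (κ * (1 + X ^ 2)) with hC
  have hk := h.hκ.1
  have hC0 : 0 < C := Real.sqrt_pos.2 (by positivity)
  have hρ0 : 0 < ρ := Real.exp_pos _
  have hρ1 : ρ < 1 := by
    rw [hρ, Real.exp_lt_one_iff]
    have h1 := ellY_strictMono (κ := κ) h.hω (show 1 / Real.sqrt κ < X by linarith)
    have := Real.pi_pos
    rw [jacEta]
    nlinarith
  have hF : ∀ n m : ℕ, |fourS κ S n m| ≤ Real.exp (-(m * jacEta κ ω)) * ρ ^ m * C ^ n := by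
    intro n m
    have h1 := h.abs_fourS_le n m X
    refine h1.trans (le_of_eq ?_)
    rw [hρ, ← Real.exp_nat_mul, ← Real.exp_add]
    congr 2
    push_cast
    ring
  refine ⟨ρ, C, hρ0, hρ1, hC0, hF, fun l m hm => ?_⟩
  rcases Nat.eq_zero_or_pos l with hl | hl
  · rw [hl, h.coeff_zero hA hm, abs_zero]
    positivity
  · have h1 := h.coeff_eq_eta hA hm l
    have hη := h.jacEta_pos
    have hl' : (1:ℝ) ≤ l := by exact_mod_cast hl
    have h2 : |a l m| ≤ |2 * l * a l m| := by
      rw [abs_mul, abs_of_pos (by positivity : (0:ℝ) < 2 * l)]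
      nlinarith [abs_nonneg (a l m)]
    have h3 : |Real.exp (2 * m * jacEta κ ω) - Real.exp (-(2 * m * jacEta κ ω))| ≤
        Real.exp (2 * m * jacEta κ ω) := by
      have h4 : Real.exp (-(2 * m * jacEta κ ω)) ≤ Real.exp (2 * m * jacEta κ ω) := by
        rw [Real.exp_le_exp]
        have : 0 ≤ m * jacEta κ ω := by positivity
        linarith
      rw [abs_of_nonneg (by linarith)]
      linarith [Real.exp_pos (-(2 * m * jacEta κ ω))]
    rw [h1, abs_mul, abs_mul, Nat.abs_cast] at h2
    refine h2.trans ?_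
    calc (m:ℝ) * |fourS κ S l m| * |Real.exp (2 * m * jacEta κ ω) - Real.exp (-(2 * m * jacEta κ ω))|
        ≤ m * (Real.exp (-(m * jacEta κ ω)) * ρ ^ m * C ^ l) * Real.exp (2 * m * jacEta κ ω) := by
          gcongr
          exact hF l m
      _ = m * (Real.exp (-(m * jacEta κ ω)) * Real.exp (2 * m * jacEta κ ω)) * ρ ^ m * C ^ l := by
          ring
      _ = _ := by
          rw [← Real.exp_add]
          congr 4
          ring

lemma summable_nat_mul_sq_pow {ρ : ℝ} (hρ0 : 0 < ρ) (hρ1 : ρ < 1) :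
    Summable fun m : ℕ => (m:ℝ) * (ρ ^ 2) ^ m := by
  have h1 : ‖ρ ^ 2‖ < 1 := by
    rw [Real.norm_eq_abs, abs_of_pos (by positivity)]; nlinarith
  simpa using summable_pow_mul_geometric_of_norm_lt_one 1 h1

lemma abs_fourS_mul_coeff_le {ρ C : ℝ} (hC : 0 < C)
    (hF : ∀ n m : ℕ, |fourS κ S n m| ≤ Real.exp (-(m * jacEta κ ω)) * ρ ^ m * C ^ n)
    (ha : ∀ l m : ℕ, 1 ≤ m → |a l m| ≤ m * Real.exp (m * jacEta κ ω) * ρ ^ m * C ^ l)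
    (hρ0 : 0 < ρ) (n l : ℕ) {m : ℕ} (hm : 1 ≤ m) :
    |fourS κ S n m * a l m| ≤ m * (ρ ^ 2) ^ m * C ^ n * C ^ l := by
  rw [abs_mul]
  refine (mul_le_mul (hF n m) (ha l m hm) (abs_nonneg _) (by positivity)).trans (le_of_eq ?_)
  have : Real.exp (-(m * jacEta κ ω)) * Real.exp (m * jacEta κ ω) = 1 := by
    rw [← Real.exp_add]; simp
  linear_combination (m * ρ ^ m * ρ ^ m * C ^ n * C ^ l) * this

lemma hasSum_fourS_mul_cos (h : JacobiPair κ ω S D) (hA : CosExpansion κ S a) {n : ℕ} (hn : 1 ≤ n)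
    (s : ℝ) : HasSum (fun m : ℕ => 2 * fourS κ S n (m + 1 : ℕ) *
      (Real.cos (2 * π * (m + 1 : ℕ) * s) - Real.cos (π * (m + 1 : ℕ) / 2)))
      ((Real.sqrt κ * S s) ^ n) := by
  obtain ⟨ρ, C, hρ0, hρ1, hC, hF, -⟩ := h.exists_bounds hA
  have hη := h.jacEta_pos
  have hsN : Summable fun m : ℕ => (fourS κ S n m : ℂ) := by
    refine Summable.of_norm_bounded
      ((summable_geometric_of_lt_one hρ0.le hρ1).mul_right (C ^ n)) fun m => ?_
    rw [Complex.norm_real, Real.norm_eq_abs]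
    refine (hF n m).trans ?_
    rw [mul_assoc]
    refine mul_le_of_le_one_left (by positivity) ?_
    rw [Real.exp_le_one_iff]
    have : 0 ≤ m * jacEta κ ω := by positivity
    linarith
  have hsZ : Summable fun m : ℤ => (fourS κ S n m : ℂ) :=
    Summable.of_nat_of_neg hsN (by simpa only [fourS_neg] using hsN)
  have key : ∀ u, HasSum (fun m : ℕ => 2 * fourS κ S n m * Real.cos (2 * π * m * u))
      ((Real.sqrt κ * S u) ^ n + fourS κ S n 0) := by
    intro u
    have h1 := hasSum_fourier_of_summable (f := fun s => jacZ κ S D 0 s ^ n)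
      ((h.continuous_jacZ_right 0).pow n) (fun s => by simp only [h.jacZ_one])
      (by simpa only [h.integral_jacZ_zero_pow] using hsZ) u
    simp only [h.integral_jacZ_zero_pow] at h1
    rw [jacZ_zero] at h1
    have h2 := h1.nat_add_neg
    rw [← Complex.hasSum_ofReal]
    simp only [neg_zero, expM_zero_left, mul_one] at h2
    push_cast at h2 ⊢
    refine h2.congr_fun fun m => ?_
    rw [neg_neg, fourS_neg, expM_eq, expM_eq]
    push_cast
    rw [show 2 * (π:ℂ) * -m * u = -(2 * π * m * u) by ring, Complex.cos_neg, Complex.sin_neg]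
    ring
  have h1 := (key s).sub (key (1 / 4))
  rw [h.S_quarter, mul_zero, zero_pow (by omega), zero_add, add_sub_cancel_right] at h1
  rw [← hasSum_nat_add_iff' 1] at h1
  simp only [Finset.sum_range_one, Nat.cast_zero, mul_zero, zero_mul, Real.cos_zero, sub_self,
    sub_zero] at h1
  refine h1.congr_fun fun m => ?_
  rw [mul_sub]
  congr 3
  ring

/-- Biorthogonality of Fourier and Taylor coefficients. -/
lemma hasSum_fourS_mul_coeff (h : JacobiPair κ ω S D) (hA : CosExpansion κ S a) {n : ℕ}
    (hn : 1 ≤ n) (l : ℕ) : HasSum (fun m : ℕ => 2 * (fourS κ S n (m + 1 : ℕ) * a l (m + 1)))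
      (if n = l then 1 else 0) := by
  obtain ⟨ρ, C, hρ0, hρ1, hC, hF, ha⟩ := h.exists_bounds hA
  have hb := fun n l m => abs_fourS_mul_coeff_le hC hF ha hρ0 n l (m := m + 1) (by omega)
  have hs := (summable_nat_mul_sq_pow hρ0 hρ1).comp_injective (add_left_injective 1)
  have hsm : ∀ l, Summable fun m : ℕ => 2 * (fourS κ S n (m + 1 : ℕ) * a l (m + 1)) := by
    intro l
    refine Summable.mul_left 2 (Summable.of_norm_bounded
      ((hs.mul_right (C ^ n)).mul_right (C ^ l)) fun m => ?_)
    exact hb n l m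
  set r := min (Real.sqrt κ) (1 / C) with hr
  have hsp := h.sqrt_pos'
  have hrpos : 0 < r := lt_min hsp (by positivity)
  have hd : ∀ l, (∑' m : ℕ, 2 * (fourS κ S n (m + 1 : ℕ) * a l (m + 1))) -
      (if n = l then 1 else 0) = 0 := by
    refine eq_zero_of_hasSum_pow hrpos fun x hx => ?_
    have hxC : |x| * C < 1 := by
      have := hx.trans_le (min_le_right _ _)
      rwa [lt_div_iff₀ hC] at this
    obtain ⟨s, hsx⟩ : ∃ s, Real.sqrt κ * S s = x := by
      have hxk := abs_lt.1 (hx.trans_le (min_le_left _ _))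
      have hc : ContinuousOn (fun s => Real.sqrt κ * S s) (Icc 0 (1 / 2)) := by
        have := h.continuous_S
        fun_prop
      have hS2 : S (1 / 2) = 1 := by
        have := h.half_S 0
        rw [zero_add, h.S_zero, neg_neg] at this
        exact this
      obtain ⟨s, -, hs⟩ := intermediate_value_Icc (by norm_num) hc
        (show x ∈ Icc _ _ by
          simp only [h.S_zero, hS2]
          constructor <;> linarith [hxk.1, hxk.2])
      exact ⟨s, hs⟩
    have h2 : Summable fun q : ℕ × ℕ =>
        2 * (fourS κ S n (q.1 + 1 : ℕ) * a q.2 (q.1 + 1)) * x ^ q.2 := by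
      have h3 : Summable fun l : ℕ => (|x| * C) ^ l :=
        summable_geometric_of_lt_one (by positivity) hxC
      refine Summable.of_norm_bounded (((hs.mul_right (2 * C ^ n)).mul_of_nonneg h3
        (fun m => by simp only [Function.comp_apply, Pi.zero_apply]; positivity)
        (fun l => by simp only [Pi.zero_apply]; positivity))) fun q => ?_
      rw [norm_mul, norm_mul, norm_pow, Real.norm_eq_abs, Real.norm_eq_abs, Real.norm_eq_abs,
        abs_two]
      refine (mul_le_mul_of_nonneg_right (mul_le_mul_of_nonneg_left (hb n q.2 q.1) zero_le_two)
        (by positivity)).trans (le_of_eq ?_)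
      simp only [Function.comp_apply]
      rw [mul_pow]
      ring
    have h4 := h.hasSum_fourS_mul_cos hA hn s
    rw [hsx] at h4
    have h5 : ∀ m : ℕ, HasSum (fun l => 2 * (fourS κ S n (m + 1 : ℕ) * a l (m + 1)) * x ^ l)
        (2 * fourS κ S n (m + 1 : ℕ) * (Real.cos (2 * π * (m + 1 : ℕ) * s) -
          Real.cos (π * (m + 1 : ℕ) / 2))) := by
      intro m
      have h6 := (hA.hasSum (m + 1) (by omega) s).mul_left (2 * fourS κ S n (m + 1 : ℕ))
      rw [hsx] at h6
      refine h6.congr_fun fun l => ?_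
      ring
    have h7 := h2.hasSum
    have h8 := (h7.prod_fiberwise h5).unique h4
    rw [h8] at h7
    have h9 := ((Equiv.prodComm ℕ ℕ).hasSum_iff.2 h7).prod_fiberwise
      (fun l => (hsm l).hasSum.mul_right (x ^ l))
    have h10 : HasSum (fun l => (if n = l then (1:ℝ) else 0) * x ^ l) (x ^ n) := by
      have := hasSum_ite_eq n (x ^ n)
      refine this.congr_fun fun l => ?_
      by_cases hl : n = l
      · simp [hl]
      · simp [hl, Ne.symm hl]
    have h11 := h9.sub h10
    rw [sub_self] at h11
    refine h11.congr_fun fun l => ?_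
    ring
  have := (hsm l).hasSum
  rwa [sub_eq_zero.1 (hd l)] at this

end JacobiPair

/-- The basic solutions of the walk recursion in the open quadrant. -/
def jacG (κ : ℝ) (S D : ℝ → ℝ) (m : ℤ) (x y : ℕ) : ℝ :=
  (∫ s in (0:ℝ)..1, jacZ κ S D 0 s ^ x * jacZ κ S D (1 / Real.sqrt κ) s ^ y * expM m s).re

namespace JacobiPair

variable {κ ω t : ℝ} {S D : ℝ → ℝ}

lemma continuous_jacG_integrand (h : JacobiPair κ ω S D) (m : ℤ) (x y : ℕ) : Continuous fun s =>
    jacZ κ S D 0 s ^ x * jacZ κ S D (1 / Real.sqrt κ) s ^ y * expM m s := by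
  have h1 := h.continuous_jacZ_right 0
  have h2 := h.continuous_jacZ_right (1 / Real.sqrt κ)
  have h3 := continuous_expM m
  fun_prop

lemma abs_jacG_le (h : JacobiPair κ ω S D) (m : ℤ) (x y : ℕ) : |jacG κ S D m x y| ≤ 1 := by
  refine (Complex.abs_re_le_norm _).trans ?_
  have := intervalIntegral.norm_integral_le_of_norm_le_const (a := 0) (b := 1) (C := 1)
    (f := fun s => jacZ κ S D 0 s ^ x * jacZ κ S D (1 / Real.sqrt κ) s ^ y * expM m s)
    fun s _ => by
      rw [norm_mul, norm_mul, norm_expM, norm_pow, norm_pow, h.norm_jacW, one_pow, mul_one,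
        mul_one]
      exact pow_le_one₀ (norm_nonneg _) (h.norm_jacZ_zero_le s)
  simpa using this

lemma jacG_zero_right (h : JacobiPair κ ω S D) (m : ℤ) (x : ℕ) :
    jacG κ S D m x 0 = fourS κ S x m := by
  simp only [jacG, pow_zero, mul_one]
  rw [h.integral_jacZ_zero_pow, Complex.ofReal_re]

lemma jacG_zero_left (h : JacobiPair κ ω S D) (m : ℤ) (y : ℕ) :
    jacG κ S D m 0 y = Real.exp (m * jacEta κ ω) * fourS κ S y m := by
  simp only [jacG, pow_zero, one_mul]
  rw [h.integral_jacZ_pow, Complex.ofReal_re, jacEta]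
  ring_nf

lemma jacG_interior (h : JacobiPair κ ω S D) (ht : Real.sqrt κ = 2 * t * (1 + κ)) (m : ℤ)
    {x y : ℕ} (hx : 1 ≤ x) (hy : 1 ≤ y) :
    jacG κ S D m x y = t * (jacG κ S D m (x + 1) (y + 1) + jacG κ S D m (x + 1) (y - 1) +
      jacG κ S D m (x - 1) (y - 1) + jacG κ S D m (x - 1) (y + 1)) := by
  obtain ⟨x, rfl⟩ := Nat.exists_eq_add_of_le' hx
  obtain ⟨y, rfl⟩ := Nat.exists_eq_add_of_le' hy
  have hI : ∀ x y, IntervalIntegrable (fun s =>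
      jacZ κ S D 0 s ^ x * jacZ κ S D (1 / Real.sqrt κ) s ^ y * expM m s)
      MeasureTheory.volume 0 1 := fun x y =>
    (h.continuous_jacG_integrand m x y).intervalIntegrable _ _
  simp only [jacG, Nat.add_sub_cancel]
  rw [← Complex.add_re, ← Complex.add_re, ← Complex.add_re, ← Complex.re_ofReal_mul,
    ← intervalIntegral.integral_add (hI _ _) (hI _ _),
    ← intervalIntegral.integral_add ((hI _ _).add (hI _ _)) (hI _ _),
    ← intervalIntegral.integral_add (((hI _ _).add (hI _ _)).add (hI _ _)) (hI _ _),
    ← intervalIntegral.integral_const_mul]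
  congr 2
  ext s
  linear_combination -(jacZ κ S D 0 s ^ x * jacZ κ S D (1 / Real.sqrt κ) s ^ y * expM m s) *
    h.kernel ht s

lemma jacG_right (h : JacobiPair κ ω S D) (ht : Real.sqrt κ = 2 * t * (1 + κ)) (m : ℤ)
    {n : ℕ} (hn : 1 ≤ n) :
    2 * t * (jacG κ S D m (n + 1) 1 + jacG κ S D m (n - 1) 1) =
      fourS κ S n m * (1 + 2 * π * m / (ω * (1 + κ) * n)) := by
  have hn0 : (n:ℂ) ≠ 0 := by exact_mod_cast (by omega : n ≠ 0)
  have hω : (ω : ℂ) ≠ 0 := by exact_mod_cast h.hω.ne'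
  have hk := h.one_add_kappa_ne_zero
  have hI : ∀ x y, IntervalIntegrable (fun s =>
      jacZ κ S D 0 s ^ x * jacZ κ S D (1 / Real.sqrt κ) s ^ y * expM m s)
      MeasureTheory.volume 0 1 := fun x y =>
    (h.continuous_jacG_integrand m x y).intervalIntegrable _ _
  have h1 := h.continuous_jacZ_right 0
  have h2 := h.continuous_jacZd_right 0
  have h3 := continuous_expM m
  have h4 := h.integral_deriv_jacZ_pow 0 n m
  rw [h.integral_jacZ_zero_pow] at h4
  have h5 : (2 * t : ℝ) * ((∫ s in (0:ℝ)..1, jacZ κ S D 0 s ^ (n + 1) *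
      jacZ κ S D (1 / Real.sqrt κ) s ^ 1 * expM m s) + ∫ s in (0:ℝ)..1, jacZ κ S D 0 s ^ (n - 1) *
      jacZ κ S D (1 / Real.sqrt κ) s ^ 1 * expM m s) =
      (fourS κ S n m : ℂ) + Complex.I / (ω * (1 + κ) * n) * ∫ s in (0:ℝ)..1,
        n * jacZ κ S D 0 s ^ (n - 1) * jacZd κ ω S D 0 s * expM m s := by
    rw [← h.integral_jacZ_zero_pow, ← intervalIntegral.integral_const_mul,
      ← intervalIntegral.integral_add (hI _ _) (hI _ _), ← intervalIntegral.integral_const_mul,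
      ← intervalIntegral.integral_add (Continuous.intervalIntegrable (by fun_prop) _ _)
      (Continuous.intervalIntegrable (by fun_prop) _ _)]
    congr 1
    ext s
    obtain ⟨n, rfl⟩ := Nat.exists_eq_add_of_le' hn
    have h6 := h.kernel_right ht s
    have h7 : Complex.I / (ω * (1 + κ) * (n + 1 : ℕ)) * ((n + 1 : ℕ) * jacZ κ S D 0 s ^ n *
        jacZd κ ω S D 0 s * expM m s) = Complex.I / (ω * (1 + κ)) * jacZd κ ω S D 0 s *
        (jacZ κ S D 0 s ^ n * expM m s) := by
      field_simp
    rw [Nat.add_sub_cancel, h7]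
    push_cast
    linear_combination (jacZ κ S D 0 s ^ n * expM m s) * h6
  rw [h4] at h5
  have h6 : (fourS κ S n m : ℂ) + Complex.I / (ω * (1 + κ) * n) *
      (-(2 * π * Complex.I * m) * (fourS κ S n m : ℂ)) =
      ((fourS κ S n m * (1 + 2 * π * m / (ω * (1 + κ) * n)) : ℝ) : ℂ) := by
    push_cast
    field_simp
    linear_combination (-(2 * π * m * (fourS κ S n m : ℂ)) : ℂ) * Complex.I_sq
  rw [h6] at h5
  have h7 := congrArg Complex.re h5
  rw [Complex.re_ofReal_mul, Complex.add_re, Complex.ofReal_re] at h7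
  exact h7

lemma jacG_up (h : JacobiPair κ ω S D) (ht : Real.sqrt κ = 2 * t * (1 + κ)) (m : ℤ)
    {n : ℕ} (hn : 1 ≤ n) :
    2 * t * (jacG κ S D m 1 (n + 1) + jacG κ S D m 1 (n - 1)) =
      Real.exp (m * jacEta κ ω) * fourS κ S n m * (1 - 2 * π * m / (ω * (1 + κ) * n)) := by
  have hn0 : (n:ℂ) ≠ 0 := by exact_mod_cast (by omega : n ≠ 0)
  have hω : (ω : ℂ) ≠ 0 := by exact_mod_cast h.hω.ne'
  have hk := h.one_add_kappa_ne_zero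
  have hI : ∀ x y, IntervalIntegrable (fun s =>
      jacZ κ S D 0 s ^ x * jacZ κ S D (1 / Real.sqrt κ) s ^ y * expM m s)
      MeasureTheory.volume 0 1 := fun x y =>
    (h.continuous_jacG_integrand m x y).intervalIntegrable _ _
  have h1 := h.continuous_jacZ_right (1 / Real.sqrt κ)
  have h2 := h.continuous_jacZd_right (1 / Real.sqrt κ)
  have h3 := continuous_expM m
  have h4 := h.integral_deriv_jacZ_pow (1 / Real.sqrt κ) n m
  have hW : ∫ s in (0:ℝ)..1, jacZ κ S D (1 / Real.sqrt κ) s ^ n * expM m s =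
      ((Real.exp (m * jacEta κ ω) * fourS κ S n m : ℝ) : ℂ) := by
    rw [h.integral_jacZ_pow, jacEta]
    ring_nf
  rw [hW] at h4
  have h5 : (2 * t : ℝ) * ((∫ s in (0:ℝ)..1, jacZ κ S D 0 s ^ 1 *
      jacZ κ S D (1 / Real.sqrt κ) s ^ (n + 1) * expM m s) + ∫ s in (0:ℝ)..1,
      jacZ κ S D 0 s ^ 1 * jacZ κ S D (1 / Real.sqrt κ) s ^ (n - 1) * expM m s) =
      ((Real.exp (m * jacEta κ ω) * fourS κ S n m : ℝ) : ℂ) -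
        Complex.I / (ω * (1 + κ) * n) * ∫ s in (0:ℝ)..1,
        n * jacZ κ S D (1 / Real.sqrt κ) s ^ (n - 1) * jacZd κ ω S D (1 / Real.sqrt κ) s *
          expM m s := by
    rw [← hW, ← intervalIntegral.integral_const_mul,
      ← intervalIntegral.integral_add (hI _ _) (hI _ _), ← intervalIntegral.integral_const_mul,
      ← intervalIntegral.integral_sub (Continuous.intervalIntegrable (by fun_prop) _ _)
      (Continuous.intervalIntegrable (by fun_prop) _ _)]
    congr 1
    ext s
    obtain ⟨n, rfl⟩ := Nat.exists_eq_add_of_le' hn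
    have h6 := h.kernel_up ht s
    generalize jacZ κ S D (1 / Real.sqrt κ) s = W at *
    generalize jacZd κ ω S D (1 / Real.sqrt κ) s = W' at *
    have h7 : Complex.I / (ω * (1 + κ) * (n + 1 : ℕ)) * ((n + 1 : ℕ) * W ^ n *
        W' * expM m s) = Complex.I / (ω * (1 + κ)) * W' * (W ^ n * expM m s) := by
      field_simp
    rw [Nat.add_sub_cancel, h7]
    push_cast
    linear_combination (W ^ n * expM m s) * h6
  rw [h4] at h5
  have h6 : ((Real.exp (m * jacEta κ ω) * fourS κ S n m : ℝ) : ℂ) -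
      Complex.I / (ω * (1 + κ) * n) *
      (-(2 * π * Complex.I * m) * ((Real.exp (m * jacEta κ ω) * fourS κ S n m : ℝ) : ℂ)) =
      ((Real.exp (m * jacEta κ ω) * fourS κ S n m * (1 - 2 * π * m / (ω * (1 + κ) * n)) : ℝ) :
        ℂ) := by
    generalize Real.exp (m * jacEta κ ω) * fourS κ S n m = f
    push_cast
    field_simp
    linear_combination (2 * π * m * (f : ℂ) : ℂ) * Complex.I_sq
  rw [h6] at h5
  have h7 := congrArg Complex.re h5
  rw [Complex.re_ofReal_mul, Complex.add_re, Complex.ofReal_re] at h7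
  exact h7

end JacobiPair

/-- The solution of the walk recursion on the quadrants attached to the frequency `m`. -/
def modeH (κ ω : ℝ) (S D : ℝ → ℝ) (i m x y : ℕ) : ℝ :=
  (Real.exp (i * (m * jacEta κ ω)) * jacG κ S D m x y -
    Real.exp (-(i * (m * jacEta κ ω))) * jacG κ S D (-m) x y) / 2

/-- The coefficient of `modeH` in the solution of the boundary problem. -/
def modeCoeff (κ ω : ℝ) (a : ℕ → ℕ → ℝ) (j l m : ℕ) : ℝ :=
  2 * a l m / Real.sinh (j * (m * jacEta κ ω))

namespace JacobiPair

variable {κ ω t : ℝ} {S D : ℝ → ℝ} {a : ℕ → ℕ → ℝ}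

lemma abs_modeH_le (h : JacobiPair κ ω S D) (i m x y : ℕ) :
    |modeH κ ω S D i m x y| ≤ Real.exp (i * (m * jacEta κ ω)) := by
  have hη := h.jacEta_pos
  have h1 := h.abs_jacG_le m x y
  have h2 := h.abs_jacG_le (-m) x y
  have h3 : Real.exp (-(i * (m * jacEta κ ω))) ≤ Real.exp (i * (m * jacEta κ ω)) :=
    Real.exp_le_exp.2 (neg_le_self (by positivity))
  have h4 := Real.exp_pos (i * (m * jacEta κ ω))
  have h5 := Real.exp_pos (-(i * (m * jacEta κ ω)))
  rw [modeH, abs_div, abs_two, div_le_iff₀ two_pos]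
  refine (abs_sub _ _).trans ?_
  rw [abs_mul, abs_mul, abs_of_pos h4, abs_of_pos h5]
  nlinarith [abs_nonneg (jacG κ S D m x y), abs_nonneg (jacG κ S D (-m) x y)]

lemma modeH_zero_right (h : JacobiPair κ ω S D) (i m n : ℕ) :
    modeH κ ω S D i m n 0 = fourS κ S n m * Real.sinh (i * (m * jacEta κ ω)) := by
  rw [modeH, h.jacG_zero_right, h.jacG_zero_right, fourS_neg, Real.sinh_eq]
  ring

lemma exp_succ_mul (i m : ℕ) (η : ℝ) : Real.exp ((i + 1 : ℕ) * (m * η)) =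
    Real.exp (i * (m * η)) * Real.exp (m * η) := by
  rw [← Real.exp_add]
  push_cast
  ring_nf

lemma exp_neg_succ_mul (i m : ℕ) (η : ℝ) : Real.exp (-((i + 1 : ℕ) * (m * η))) =
    Real.exp (-(i * (m * η))) * Real.exp (-(m * η)) := by
  rw [← Real.exp_add]
  push_cast
  ring_nf

lemma modeH_zero_left (h : JacobiPair κ ω S D) (i m n : ℕ) :
    modeH κ ω S D i m 0 n = modeH κ ω S D (i + 1) m n 0 := by
  rw [modeH, modeH, h.jacG_zero_left, h.jacG_zero_left, h.jacG_zero_right, h.jacG_zero_right,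
    exp_succ_mul, exp_neg_succ_mul]
  push_cast
  rw [neg_mul]
  ring

lemma modeH_interior (h : JacobiPair κ ω S D) (ht : Real.sqrt κ = 2 * t * (1 + κ)) (i m : ℕ)
    {x y : ℕ} (hx : 1 ≤ x) (hy : 1 ≤ y) :
    modeH κ ω S D i m x y = t * (modeH κ ω S D i m (x + 1) (y + 1) +
      modeH κ ω S D i m (x + 1) (y - 1) + modeH κ ω S D i m (x - 1) (y - 1) +
      modeH κ ω S D i m (x - 1) (y + 1)) := by
  rw [modeH, h.jacG_interior ht m hx hy, h.jacG_interior ht (-m) hx hy]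
  simp only [modeH]
  ring

lemma modeH_axis (h : JacobiPair κ ω S D) (ht : Real.sqrt κ = 2 * t * (1 + κ)) (i m : ℕ)
    {n : ℕ} (hn : 1 ≤ n) :
    modeH κ ω S D (i + 1) m n 0 = t * (modeH κ ω S D (i + 1) m (n + 1) 1 +
      modeH κ ω S D i m 1 (n + 1) + modeH κ ω S D i m 1 (n - 1) +
      modeH κ ω S D (i + 1) m (n - 1) 1) := by
  have h1 := h.jacG_right ht m hn
  have h2 := h.jacG_right ht (-m) hn
  have h3 := h.jacG_up ht m hn
  have h4 := h.jacG_up ht (-m) hn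
  rw [fourS_neg] at h2 h4
  push_cast at h1 h2 h3 h4
  rw [neg_mul] at h4
  simp only [modeH]
  rw [exp_succ_mul, exp_neg_succ_mul, h.jacG_zero_right, h.jacG_zero_right, fourS_neg]
  generalize Real.exp (i * (m * jacEta κ ω)) = A at *
  generalize Real.exp (-(i * (m * jacEta κ ω))) = A' at *
  generalize Real.exp (m * jacEta κ ω) = B at *
  generalize Real.exp (-(m * jacEta κ ω)) = B' at *
  linear_combination (-(A * B) / 4) * h1 + (A' * B' / 4) * h2 - (A / 4) * h3 + (A' / 4) * h4

lemma modeH_exit (h : JacobiPair κ ω S D) (ht : Real.sqrt κ = 2 * t * (1 + κ)) (m : ℕ)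
    {n : ℕ} (hn : 1 ≤ n) :
    t * (modeH κ ω S D 0 m (n + 1) 1 + modeH κ ω S D 0 m (n - 1) 1) =
      fourS κ S n m * (π * m / (ω * (1 + κ) * n)) := by
  have h1 := h.jacG_right ht m hn
  have h2 := h.jacG_right ht (-m) hn
  rw [fourS_neg] at h2
  push_cast at h1 h2
  simp only [modeH, Nat.cast_zero, zero_mul, neg_zero, Real.exp_zero, one_mul]
  linear_combination (1 / 4) * h1 - (1 / 4) * h2

lemma exists_bound_modeCoeff_mul_modeH (h : JacobiPair κ ω S D) (hA : CosExpansion κ S a)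
    (j l : ℕ) : ∃ b : ℕ → ℝ, Summable b ∧ ∀ i m x y, i < j →
      |modeCoeff κ ω a j l (m + 1) * modeH κ ω S D i (m + 1) x y| ≤ b m := by
  obtain ⟨ρ, C, hρ0, hρ1, hC, -, ha⟩ := h.exists_bounds hA
  have hη := h.jacEta_pos
  set η := jacEta κ ω
  have hδ : 0 < 1 - Real.exp (-(2 * η)) := by
    have h1 : Real.exp (-(2 * η)) < Real.exp 0 := Real.exp_lt_exp.2 (by linarith)
    rw [Real.exp_zero] at h1
    linarith
  have hs : Summable fun m : ℕ => (m:ℝ) * ρ ^ m := by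
    have h1 : ‖ρ‖ < 1 := by rwa [Real.norm_eq_abs, abs_of_pos hρ0]
    simpa using summable_pow_mul_geometric_of_norm_lt_one 1 h1
  refine ⟨fun m => 4 * C ^ l / (1 - Real.exp (-(2 * η))) * (((m + 1 : ℕ) : ℝ) * ρ ^ (m + 1)),
    (hs.comp_injective (add_left_injective 1)).mul_left _, fun i m x y hi => ?_⟩
  beta_reduce
  have hM : 1 ≤ m + 1 := by omega
  generalize m + 1 = M at *
  have hM' : (1:ℝ) ≤ M := by exact_mod_cast hM
  have hi' : (i:ℝ) + 1 ≤ j := by exact_mod_cast hi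
  have hi0 : (0:ℝ) ≤ i := Nat.cast_nonneg i
  have hMη : η ≤ M * η := by nlinarith
  have hsinh : Real.exp (j * (M * η)) * (1 - Real.exp (-(2 * η))) / 2 ≤
      Real.sinh (j * (M * η)) := by
    rw [Real.sinh_eq]
    have h1 : Real.exp (-(j * (M * η))) ≤
        Real.exp (j * (M * η)) * Real.exp (-(2 * η)) := by
      rw [← Real.exp_add]
      refine Real.exp_le_exp.2 ?_
      nlinarith
    linarith
  have he := Real.exp_pos (j * (M * η))
  have hsp : 0 < Real.exp (j * (M * η)) * (1 - Real.exp (-(2 * η))) / 2 := by positivity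
  have hsp' := hsp.trans_le hsinh
  have h3 : Real.exp (M * η) * Real.exp (i * (M * η)) ≤ Real.exp (j * (M * η)) := by
    rw [← Real.exp_add]
    refine Real.exp_le_exp.2 ?_
    nlinarith
  rw [abs_mul, modeCoeff, abs_div, abs_mul, abs_two, abs_of_pos hsp']
  calc 2 * |a l M| / Real.sinh (j * (M * η)) * |modeH κ ω S D i M x y|
      ≤ 2 * (M * Real.exp (M * η) * ρ ^ M * C ^ l) /
        (Real.exp (j * (M * η)) * (1 - Real.exp (-(2 * η))) / 2) *
          Real.exp (i * (M * η)) := by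
        gcongr
        · exact ha l M hM
        · exact h.abs_modeH_le i M x y
    _ = 4 * C ^ l / (1 - Real.exp (-(2 * η))) * (M * ρ ^ M) *
        (Real.exp (M * η) * Real.exp (i * (M * η)) / Real.exp (j * (M * η))) := by
        field_simp
        ring
    _ ≤ 4 * C ^ l / (1 - Real.exp (-(2 * η))) * (M * ρ ^ M) :=
        mul_le_of_le_one_right (by positivity) ((div_le_one he).2 h3)

lemma modeCoeff_mul_sinh (h : JacobiPair κ ω S D) {j l m : ℕ} (hj : 1 ≤ j) (hm : 1 ≤ m) :
    modeCoeff κ ω a j l m * Real.sinh (j * (m * jacEta κ ω)) = 2 * a l m := by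
  have hη := h.jacEta_pos
  have hj' : (0:ℝ) < j := by exact_mod_cast hj
  have hm' : (0:ℝ) < m := by exact_mod_cast hm
  rw [modeCoeff, div_mul_cancel₀]
  exact (Real.sinh_pos_iff.2 (by positivity)).ne'

lemma modeCoeff_mul_modeH_exit (h : JacobiPair κ ω S D) (hA : CosExpansion κ S a)
    (ht : Real.sqrt κ = 2 * t * (1 + κ)) {j l m p : ℕ} (hm : 1 ≤ m) (hp : 1 ≤ p) :
    modeCoeff κ ω a j l m * (t * (modeH κ ω S D 0 m (p + 1) 1 + modeH κ ω S D 0 m (p - 1) 1)) =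
      8 * π / (ω * (1 + κ)) * (a l m * a p m /
        ((Real.exp (j * (m * jacEta κ ω)) - Real.exp (-(j * (m * jacEta κ ω)))) *
          (Real.exp (2 * m * jacEta κ ω) - Real.exp (-(2 * m * jacEta κ ω))))) := by
  have hη := h.jacEta_pos
  have hm' : (0:ℝ) < m := by exact_mod_cast hm
  have hp' : (p:ℝ) ≠ 0 := by exact_mod_cast (by omega : p ≠ 0)
  have hd : Real.exp (2 * m * jacEta κ ω) - Real.exp (-(2 * m * jacEta κ ω)) ≠ 0 := by
    refine (sub_pos.2 (Real.exp_lt_exp.2 (neg_lt_self ?_))).ne'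
    positivity
  have h1 := h.coeff_eq_eta hA hm p
  have h2 : a p m = m * fourS κ S p m * (Real.exp (2 * m * jacEta κ ω) -
      Real.exp (-(2 * m * jacEta κ ω))) / (2 * p) := by
    rw [← h1]
    field_simp
  rw [h.modeH_exit ht m hp, h2, modeCoeff, Real.sinh_eq]
  generalize Real.exp (j * (m * jacEta κ ω)) - Real.exp (-(j * (m * jacEta κ ω))) = s
  generalize Real.exp (2 * m * jacEta κ ω) - Real.exp (-(2 * m * jacEta κ ω)) = d at *
  have hω := h.hω.ne'
  have hk : 1 + κ ≠ 0 := by have := h.hκ.1; positivity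
  rcases eq_or_ne s 0 with rfl | hs
  · simp
  field_simp
  ring

end JacobiPair

namespace JacobiPair

variable {κ ω t : ℝ} {S D : ℝ → ℝ} {a : ℕ → ℕ → ℝ}

lemma hasSum_walks (h : JacobiPair κ ω S D) (hA : CosExpansion κ S a)
    (ht : t ∈ Ioo (0:ℝ) (1 / 4)) (hκt : Real.sqrt κ = 2 * t * (1 + κ)) {j l p : ℕ} (hj : 1 ≤ j)
    (hp : 1 ≤ p) : ∃ T : ℝ,
    HasSum (fun w : {w : List (ℤ × ℤ) // WCond l p (π / 2 * j) (Ioo 0 (π / 2 * j)) w} =>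
      t ^ (w.val.length - 1)) T ∧
    HasSum (fun m : ℕ => 8 * π / (ω * (1 + κ)) * (a l (m + 1) * a p (m + 1) /
        ((Real.exp (j * ((m + 1 : ℕ) * jacEta κ ω)) -
          Real.exp (-(j * ((m + 1 : ℕ) * jacEta κ ω)))) *
          (Real.exp (2 * (m + 1 : ℕ) * jacEta κ ω) -
            Real.exp (-(2 * (m + 1 : ℕ) * jacEta κ ω)))))) T := by
  obtain ⟨b, hb, hbd⟩ := h.exists_bound_modeCoeff_mul_modeH hA j l
  set H : ℕ → ℕ → ℕ → ℝ := fun i x y =>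
    ∑' m, modeCoeff κ ω a j l (m + 1) * modeH κ ω S D i (m + 1) x y with hH
  have hs : ∀ {i} x y, i < j → HasSum (fun m =>
      modeCoeff κ ω a j l (m + 1) * modeH κ ω S D i (m + 1) x y) (H i x y) := fun x y hi =>
    (Summable.of_norm_bounded hb fun m => hbd _ m x y hi).hasSum
  refine ⟨t * (H 0 (p + 1) 1 + H 0 (p - 1) 1),
    hasSum_walks_of_boundary_problem (B := ∑' m, b m) ht hj hp H ?_ ?_ ?_ ?_ ?_ ?_ ?_, ?_⟩
  · intro i x y hi
    rw [← Real.norm_eq_abs]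
    exact tsum_of_norm_bounded hb.hasSum fun m => hbd i m x y hi
  · intro i hi
    refine (hs 0 0 hi).unique ?_
    simp only [h.modeH_zero_right, JacobiPair.fourS_zero _ (Int.natCast_ne_zero.2 (Nat.succ_ne_zero _)),
      zero_mul, mul_zero]
    exact hasSum_zero
  · intro i x y hi hx hy
    refine (hs x y hi).unique ?_
    refine (((((hs _ _ hi).add (hs _ _ hi)).add (hs _ _ hi)).add (hs _ _ hi)).mul_left
      t).congr_fun fun m => ?_
    rw [h.modeH_interior hκt i (m + 1) hx hy]
    ring
  · intro i n hi hn
    have hi' : i < j := by omega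
    refine (hs n 0 hi).unique ?_
    refine (((((hs _ _ hi).add (hs _ _ hi')).add (hs _ _ hi')).add (hs _ _ hi)).mul_left
      t).congr_fun fun m => ?_
    rw [h.modeH_axis hκt i (m + 1) hn]
    ring
  · intro i n _ _
    simp only [hH, h.modeH_zero_left]
  · intro n hn
    refine (hs 0 n (by omega)).unique ?_
    refine (h.hasSum_fourS_mul_coeff hA hn l).congr_fun fun m => ?_
    rw [h.modeH_zero_left, h.modeH_zero_right, Nat.sub_add_cancel hj]
    have := h.modeCoeff_mul_sinh (a := a) (l := l) hj (Nat.le_add_left 1 m)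
    linear_combination fourS κ S n (m + 1 : ℕ) * this
  · intro n _
    simp only [hH, h.modeH_zero_right, Nat.cast_zero, zero_mul, Real.sinh_zero, mul_zero,
      tsum_zero]
  · refine (((hs _ _ hj).add (hs _ _ hj)).mul_left t).congr_fun fun m => ?_
    rw [← h.modeCoeff_mul_modeH_exit hA hκt (Nat.le_add_left 1 m) hp]
    ring

end JacobiPair

lemma sqrt_kLanden {k : ℝ} (hk : k ∈ Ioo (0:ℝ) 1) :
    Real.sqrt (kLanden k) = k / 2 * (1 + kLanden k) := by
  have h1 := kComp_sq hk
  have h2 := (kComp_mem hk).1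
  have h3 := hk.1
  have h4 : k / 2 * (1 + kLanden k) = k / (1 + kComp k) := by
    rw [kLanden]
    field_simp
    ring
  have h5 : kLanden k = (k / (1 + kComp k)) ^ 2 := by
    rw [kLanden]
    field_simp
    linear_combination -h1
  rw [h4, h5, Real.sqrt_sq (by positivity)]

lemma four_kell_kLanden {k : ℝ} (hk : k ∈ Ioo (0:ℝ) 1) :
    4 * Kell (kLanden k) * (1 + kLanden k) = 4 * Kell k := by
  have h2 := (kComp_mem hk).1
  rw [kell_kLanden hk, kLanden]
  field_simp
  ring

lemma qNome_eq_exp_jacEta {k : ℝ} (hk : k ∈ Ioo (0:ℝ) 1) :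
    qNome k = Real.exp (-(2 * jacEta (kLanden k) (4 * Kell (kLanden k)))) := by
  have h1 := kell_pos hk
  have h2 := (kComp_mem hk).1
  rw [qNome, jacEta, ellY_inv_sqrt (kLanden_mem hk), kell_kLanden hk, kell_kComp_kLanden hk]
  congr 1
  field_simp
  ring

lemma qNome_rpow {k : ℝ} (hk : k ∈ Ioo (0:ℝ) 1) (x : ℝ) :
    qNome k ^ x = Real.exp (-(2 * x * jacEta (kLanden k) (4 * Kell (kLanden k)))) := by
  rw [qNome_eq_exp_jacEta hk, ← Real.exp_mul]
  ring_nf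

/-- Theorem `A^{(α)}` (Theorem 1(ii), row 1): for `t ∈ (0,1/4)`, `k = 4t`, `l,p ≥ 1` and
`α ∈ (π/2)ℤ` with `α > 0`, the sum over walks defining `W^{(α,(0,α))}_{l,p}(t)` converges,
and it equals `(2π/K(k)) Σ_{m≥1} a_{l,m} a_{p,m} / ((q^{-mα/π} - q^{mα/π})(q^{-m} - q^m))`,
the series converging absolutely. -/
theorem statement0 (t : ℝ) (ht : t ∈ Set.Ioo (0 : ℝ) (1 / 4)) (k : ℝ) (hk : k = 4 * t)
    (v : ℂ → ℂ) (hv : IsVmap (kLanden k) v)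
    (a : ℕ → ℕ → ℝ) (ha : IsCoeff (kLanden k) v a)
    (l p : ℕ) (hl : 1 ≤ l) (hp : 1 ≤ p)
    (j : ℤ) (hj : 0 < j) (α : ℝ) (hα : α = π / 2 * j) :
    Summable (fun w : {w : List (ℤ × ℤ) // WCond l p α (Set.Ioo 0 α) w} =>
        t ^ (w.val.length - 1)) ∧
    Summable (fun m : ℕ => a l (m + 1) * a p (m + 1) /
        ((qNome k ^ (-(((m : ℝ) + 1) * α) / π) - qNome k ^ ((((m : ℝ) + 1) * α) / π)) *
          (qNome k ^ (-((m : ℝ) + 1)) - qNome k ^ ((m : ℝ) + 1)))) ∧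
    Wgen t l p α (Set.Ioo 0 α) =
      2 * π / Kell k * ∑' m : ℕ, a l (m + 1) * a p (m + 1) /
        ((qNome k ^ (-(((m : ℝ) + 1) * α) / π) - qNome k ^ ((((m : ℝ) + 1) * α) / π)) *
          (qNome k ^ (-((m : ℝ) + 1)) - qNome k ^ ((m : ℝ) + 1))) := by
  have hk1 : k ∈ Ioo (0:ℝ) 1 := by
    rw [hk]
    constructor <;> linarith [ht.1, ht.2]
  obtain ⟨S, D, h⟩ := exists_jacobiPair (kLanden_mem hk1)
  have hA : CosExpansion (kLanden k) S a :=
    ⟨fun m hm r h0 h1 => summable_coeff_mul_pow ha hm h0 h1,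
      fun m hm s => h.hasSum_coeff hv ha hm s⟩
  have hκt : Real.sqrt (kLanden k) = 2 * t * (1 + kLanden k) := by
    rw [sqrt_kLanden hk1]
    linear_combination (1 + kLanden k) / 2 * hk
  lift j to ℕ using hj.le
  have hj1 : 1 ≤ j := by exact_mod_cast hj
  rw [Int.cast_natCast] at hα
  subst hα
  obtain ⟨T, hT, hT'⟩ := h.hasSum_walks hA ht hκt (l := l) hj1 hp
  have hK := kell_pos hk1
  have hc : 8 * π / (4 * Kell (kLanden k) * (1 + kLanden k)) = 2 * π / Kell k := by
    rw [four_kell_kLanden hk1]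
    field_simp
    ring
  have hexp : ∀ m : ℕ, (qNome k ^ (-(((m : ℝ) + 1) * (π / 2 * j)) / π) -
        qNome k ^ ((((m : ℝ) + 1) * (π / 2 * j)) / π)) *
          (qNome k ^ (-((m : ℝ) + 1)) - qNome k ^ ((m : ℝ) + 1)) =
      (Real.exp (j * ((m + 1 : ℕ) * jacEta (kLanden k) (4 * Kell (kLanden k)))) -
          Real.exp (-(j * ((m + 1 : ℕ) * jacEta (kLanden k) (4 * Kell (kLanden k)))))) *
        (Real.exp (2 * (m + 1 : ℕ) * jacEta (kLanden k) (4 * Kell (kLanden k))) -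
          Real.exp (-(2 * (m + 1 : ℕ) * jacEta (kLanden k) (4 * Kell (kLanden k))))) := by
    intro m
    simp only [qNome_rpow hk1]
    push_cast
    congr 3
    · field_simp
    · field_simp
    · ring
  rw [hc] at hT'
  simp only [← hexp] at hT'
  have hs := (summable_mul_left_iff (by positivity : 2 * π / Kell k ≠ 0)).1 hT'.summable
  refine ⟨hT.summable, hs, ?_⟩
  rw [← tsum_mul_left, hT'.tsum_eq, Wgen, hT.tsum_eq]

end
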